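/- Every measurable pseudo-Anosov homeomorphism F : Σ → Σ exhibits sensitive dependence on initial conditions, and is therefore chaotic in the sense of Devaney (it is topologically transitive, has dense periodic points, and has sensitive dependence on initial conditions). -/

import Mathlib

open MeasureTheory Set Function Topology Filter
open scoped ENNReal

noncomputable section

variable {S : Type} [TopologicalSpace S] [MeasurableSpace S]

/-- `d` is (the distance function of) a metric on `S` compatible with its topology. -/
def IsCompatibleMetric (S : Type) [TopologicalSpace S] (d : S → S → ℝ) : Prop :=
  (∀ x y, d x y = d y x) ∧ (∀ x y, d x y = 0 ↔ x = y) ∧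
  (∀ x y z, d x z ≤ d x y + d y z) ∧
  (∀ s : Set S, IsOpen s ↔ ∀ x ∈ s, ∃ ε > (0 : ℝ), ∀ y, d x y < ε → y ∈ s)

/-- An immersed line: a continuous injective image of `ℝ`. -/
def IsImmersedLine (ℓ : Set S) : Prop :=
  ∃ f : ℝ → S, Continuous f ∧ Function.Injective f ∧ Set.range f = ℓ

/-- `A` is a closed stream arc of the immersed line `ℓ` with endpoints `x` and `y`. -/
def IsArcIn (ℓ A : Set S) (x y : S) : Prop :=
  ∃ f : ℝ → S, Continuous f ∧ Function.Injective f ∧ Set.range f = ℓ ∧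
    ∃ a b : ℝ, a ≤ b ∧ f a = x ∧ f b = y ∧ A = f '' Set.Icc a b

/-- `A` is a closed stream arc of the immersed line `ℓ`. -/
def IsArc (ℓ A : Set S) : Prop := ∃ x y, IsArcIn ℓ A x y

/-- Topological transversality of two immersed lines at a point `x`: local pieces (arcs) of the
two lines through `x` are, in some chart around `x`, the two coordinate axes. -/
def TransverseAt (ℓ ℓ' : Set S) (x : S) : Prop :=
  ∃ α β : Set S, x ∈ α ∧ x ∈ β ∧ IsArc ℓ α ∧ IsArc ℓ' β ∧
    ∃ U : Set S, IsOpen U ∧ x ∈ U ∧ ∃ e : U ≃ₜ ℝ × ℝ,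
      Subtype.val '' (⇑e ⁻¹' {p : ℝ × ℝ | p.2 = 0}) = α ∩ U ∧
      Subtype.val '' (⇑e ⁻¹' {p : ℝ × ℝ | p.1 = 0}) = β ∩ U

/-- The (manifold) boundary of the surface `S`: points having no neighbourhood
homeomorphic to the plane. -/
def ManifoldBdry (S : Type) [TopologicalSpace S] : Set S :=
  {x : S | ¬ ∃ U : Set S, IsOpen U ∧ x ∈ U ∧ Nonempty (U ≃ₜ ℝ × ℝ)}

/-- An Oxtoby–Ulam (OU) measure on the compact surface `S`: Borel (via the ambient
`BorelSpace` assumption), non-atomic, positive on non-empty open sets, and vanishing on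
the boundary of `S`. -/
structure IsOUMeasure (μ : Measure S) : Prop where
  noAtoms : ∀ x : S, μ {x} = 0
  openPos : ∀ U : Set S, IsOpen U → U.Nonempty → 0 < μ U
  boundaryNull : μ (ManifoldBdry S) = 0

/-- A measured turbulation on `S` (with ambient measure `μ`): a partition of a full
`μ`-measure Borel subset of `S` into streamlines (immersed lines), together with an
OU measure on each streamline which is finite on closed stream arcs. -/
structure MeasuredTurbulation (μ : Measure S) where
  lines : Set (Set S)
  lines_immersed : ∀ ℓ ∈ lines, IsImmersedLine ℓ
  lines_disjoint : lines.PairwiseDisjoint id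
  domain_borel : MeasurableSet (⋃₀ lines)
  domain_full : μ (⋃₀ lines) = 1
  ν : Set S → Measure S
  ν_supported : ∀ ℓ ∈ lines, ν ℓ ℓᶜ = 0
  ν_nonatomic : ∀ ℓ ∈ lines, ∀ x : S, ν ℓ {x} = 0
  ν_arc_pos : ∀ ℓ ∈ lines, ∀ A : Set S, ∀ x y : S, IsArcIn ℓ A x y → x ≠ y → 0 < ν ℓ A
  ν_arc_finite : ∀ ℓ ∈ lines, ∀ A : Set S, ∀ x y : S, IsArcIn ℓ A x y → ν ℓ A < ⊤

namespace MeasuredTurbulation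

variable {μ : Measure S}

/-- Tameness with respect to a given metric `d`: stream arcs of small stream measure are small. -/
def TameWith (T : MeasuredTurbulation μ) (d : S → S → ℝ) : Prop :=
  ∀ ε : ℝ, 0 < ε → ∃ δ : ℝ, 0 < δ ∧
    ∀ ℓ ∈ T.lines, ∀ A : Set S, ∀ x y : S,
      IsArcIn ℓ A x y → T.ν ℓ A < ENNReal.ofReal δ → d x y < ε

/-- A measured turbulation is tame if it is tame with respect to (every, equivalently some)
metric on `S` compatible with its topology. -/
def Tame (T : MeasuredTurbulation μ) : Prop :=
  ∀ d : S → S → ℝ, IsCompatibleMetric S d → T.TameWith d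

/-- Every streamline is dense in `S`. -/
def DenseStreamlines (T : MeasuredTurbulation μ) : Prop := ∀ ℓ ∈ T.lines, Dense ℓ

/-- Two measured turbulations are transverse if almost every point lies on streamlines of both
which intersect transversely there. -/
def TransversePair (Ts Tu : MeasuredTurbulation μ) : Prop :=
  ∃ W : Set S, MeasurableSet W ∧ μ W = 1 ∧
    ∀ x ∈ W, ∃ ℓ ∈ Ts.lines, ∃ ℓ' ∈ Tu.lines, x ∈ ℓ ∧ x ∈ ℓ' ∧ TransverseAt ℓ ℓ' x

end MeasuredTurbulation

/-- A tartan for the (stable, unstable) pair of measured turbulations `(Ts, Tu)`. -/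
structure Tartan {μ : Measure S} (Ts Tu : MeasuredTurbulation μ) where
  Rs : Set S
  Ru : Set S
  borel_s : MeasurableSet Rs
  borel_u : MeasurableSet Ru
  fibs : Set (Set S)
  fibu : Set (Set S)
  fibs_disjoint : fibs.PairwiseDisjoint id
  fibu_disjoint : fibu.PairwiseDisjoint id
  fibs_cover : ⋃₀ fibs = Rs
  fibu_cover : ⋃₀ fibu = Ru
  /-- (a) every stable fiber meets every unstable fiber in exactly one point. -/
  inter_unique : ∀ A ∈ fibs, ∀ B ∈ fibu, ∃! z : S, z ∈ A ∩ B
  /-- The fibers are stream arcs of the corresponding turbulations, and (b) they can be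
  oriented consistently: every stable fiber crosses the unstable fibers in the same order,
  and vice versa. -/
  oriented : ∃ ords ordu : Set S → S → S → Prop,
    (∀ A ∈ fibs, ∃ ℓ ∈ Ts.lines, ∃ f : ℝ → S, Continuous f ∧ Function.Injective f ∧
        Set.range f = ℓ ∧ ∃ a b : ℝ, a ≤ b ∧ A = f '' Set.Icc a b ∧
        ∀ s ∈ Set.Icc a b, ∀ t ∈ Set.Icc a b, (ords A (f s) (f t) ↔ s ≤ t)) ∧
    (∀ B ∈ fibu, ∃ ℓ ∈ Tu.lines, ∃ f : ℝ → S, Continuous f ∧ Function.Injective f ∧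
        Set.range f = ℓ ∧ ∃ a b : ℝ, a ≤ b ∧ B = f '' Set.Icc a b ∧
        ∀ s ∈ Set.Icc a b, ∀ t ∈ Set.Icc a b, (ordu B (f s) (f t) ↔ s ≤ t)) ∧
    (∀ A ∈ fibs, ∀ A' ∈ fibs, ∀ B ∈ fibu, ∀ B' ∈ fibu,
      ∀ p ∈ A ∩ B, ∀ q ∈ A ∩ B', ∀ p' ∈ A' ∩ B, ∀ q' ∈ A' ∩ B',
        (ords A p q ↔ ords A' p' q')) ∧
    (∀ B ∈ fibu, ∀ B' ∈ fibu, ∀ A ∈ fibs, ∀ A' ∈ fibs,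
      ∀ p ∈ B ∩ A, ∀ q ∈ B ∩ A', ∀ p' ∈ B' ∩ A, ∀ q' ∈ B' ∩ A',
        (ordu B p q ↔ ordu B' p' q'))
  /-- (c) the stream measures of the fibers are bounded above. -/
  bounded : ∃ L : ℝ≥0∞, L < ⊤ ∧
    (∀ A ∈ fibs, ∀ ℓ ∈ Ts.lines, A ⊆ ℓ → Ts.ν ℓ A ≤ L) ∧
    (∀ B ∈ fibu, ∀ ℓ ∈ Tu.lines, B ⊆ ℓ → Tu.ν ℓ B ≤ L)
  /-- (d) `Rs ∪ Ru` is contained in an open topological disk. -/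
  in_disk : ∃ U : Set S, IsOpen U ∧ Rs ∪ Ru ⊆ U ∧ Nonempty (U ≃ₜ ℝ × ℝ)

namespace Tartan

variable {μ : Measure S} {Ts Tu : MeasuredTurbulation μ}

/-- The set `R^⋔` of tartan intersection points. -/
def core (R : Tartan Ts Tu) : Set S := R.Rs ∩ R.Ru

/-- The tartan `R` is compatible with the ambient measure `μ`: for all stable and unstable
fibers `𝔰`, `𝔲`, the bijection `ψ : E^𝔰 × E^𝔲 → R^⋔`, `(x, y) ↦ 𝔲(x) ⋔ 𝔰(y)`, is
bi-measurable and pushes `ν_𝔰 × ν_𝔲` forward to `μ` restricted to `R^⋔`. -/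
def Compatible (R : Tartan Ts Tu) : Prop :=
  ∀ 𝔰 ∈ R.fibs, ∀ 𝔲 ∈ R.fibu,
  ∀ ℓs ∈ Ts.lines, 𝔰 ⊆ ℓs → ∀ ℓu ∈ Tu.lines, 𝔲 ⊆ ℓu →
  ∃ ψ : S × S → S,
    (∀ x ∈ 𝔰 ∩ R.core, ∀ y ∈ 𝔲 ∩ R.core,
      ∀ B ∈ R.fibu, x ∈ B → ∀ A ∈ R.fibs, y ∈ A → ψ (x, y) ∈ B ∩ A) ∧
    Set.InjOn ψ ((𝔰 ∩ R.core) ×ˢ (𝔲 ∩ R.core)) ∧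
    ψ '' ((𝔰 ∩ R.core) ×ˢ (𝔲 ∩ R.core)) = R.core ∧
    Measurable ψ ∧
    (∀ E : Set (S × S), E ⊆ (𝔰 ∩ R.core) ×ˢ (𝔲 ∩ R.core) → MeasurableSet E →
      MeasurableSet (ψ '' E)) ∧
    Measure.map ψ (((Ts.ν ℓs).restrict (𝔰 ∩ R.core)).prod
      ((Tu.ν ℓu).restrict (𝔲 ∩ R.core))) = μ.restrict R.core

/-- Image of `B ⊆ E^𝔰` under the holonomy map `h_{𝔰,𝔰'} : E^𝔰 → E^{𝔰'}`, `x ↦ 𝔲(x) ⋔ 𝔰'`. -/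
def holSS (R : Tartan Ts Tu) (𝔰' B : Set S) : Set S :=
  {x' : S | ∃ x ∈ B, ∃ Bu ∈ R.fibu, x ∈ Bu ∧ x' ∈ Bu ∩ 𝔰'}

/-- Image of `B ⊆ E^𝔲` under the holonomy map `h_{𝔲,𝔲'} : E^𝔲 → E^{𝔲'}`, `y ↦ 𝔰(y) ⋔ 𝔲'`. -/
def holUU (R : Tartan Ts Tu) (𝔲' B : Set S) : Set S :=
  {y' : S | ∃ y ∈ B, ∃ A ∈ R.fibs, y ∈ A ∧ y' ∈ A ∩ 𝔲'}

/-- "`𝔲(x) ⋔ 𝔰(y) ∈ A`": the intersection point of the unstable fiber through `x` and the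
stable fiber through `y` belongs to `A`. -/
def sectMem (R : Tartan Ts Tu) (A : Set S) (x y : S) : Prop :=
  ∃ B ∈ R.fibu, x ∈ B ∧ ∃ C ∈ R.fibs, y ∈ C ∧ ∃ z ∈ B ∩ C, z ∈ A

/-- `ν_{𝔲(x)}(A ∩ 𝔲(x))`: the stream measure of `A` along the unstable fiber through `x`. -/
def fiberMeasU (R : Tartan Ts Tu) (A : Set S) (x : S) : ℝ≥0∞ :=
  ⨆ (B : Set S) (_ : B ∈ R.fibu) (_ : x ∈ B) (ℓ : Set S) (_ : ℓ ∈ Tu.lines) (_ : B ⊆ ℓ),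
    Tu.ν ℓ (A ∩ B)

/-- `ν_{𝔰(y)}(A ∩ 𝔰(y))`: the stream measure of `A` along the stable fiber through `y`. -/
def fiberMeasS (R : Tartan Ts Tu) (A : Set S) (y : S) : ℝ≥0∞ :=
  ⨆ (C : Set S) (_ : C ∈ R.fibs) (_ : y ∈ C) (ℓ : Set S) (_ : ℓ ∈ Ts.lines) (_ : C ⊆ ℓ),
    Ts.ν ℓ (A ∩ C)

end Tartan

/-- The union of the stable streamlines containing fibers of `R`. -/
def stableSaturation {μ : Measure S} {Ts Tu : MeasuredTurbulation μ} (R : Tartan Ts Tu) :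
    Set S :=
  ⋃₀ {ℓ : Set S | ℓ ∈ Ts.lines ∧ ∃ A ∈ R.fibs, A ⊆ ℓ}

/-- The union of the unstable streamlines containing fibers of `R`. -/
def unstableSaturation {μ : Measure S} {Ts Tu : MeasuredTurbulation μ} (R : Tartan Ts Tu) :
    Set S :=
  ⋃₀ {ℓ : Set S | ℓ ∈ Tu.lines ∧ ∃ B ∈ R.fibu, B ⊆ ℓ}

/-- The pair `(Ts, Tu)` is full: countably many compatible tartans cover a full measure
subset of `S`, and every non-empty open set contains a positive measure compatible tartan. -/
def FullPair {μ : Measure S} (Ts Tu : MeasuredTurbulation μ) : Prop :=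
  (∃ R : ℕ → Tartan Ts Tu, (∀ i, (R i).Compatible) ∧ μ (⋃ i, (R i).core) = 1) ∧
  (∀ U : Set S, IsOpen U → U.Nonempty →
    ∃ R : Tartan Ts Tu, R.Compatible ∧ 0 < μ R.core ∧ R.Rs ∪ R.Ru ⊆ U)

/-- `(Ts, Tu)` are measurable pseudo-Anosov turbulations: transverse, tame, full, with
dense streamlines. -/
def MPATurbulations {μ : Measure S} (Ts Tu : MeasuredTurbulation μ) : Prop :=
  Ts.TransversePair Tu ∧ Ts.Tame ∧ Tu.Tame ∧ FullPair Ts Tu ∧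
    Ts.DenseStreamlines ∧ Tu.DenseStreamlines

/-- `F` is a measurable pseudo-Anosov homeomorphism with invariant turbulations `(Ts, Tu)`
and dilatation `lam > 1`. -/
structure IsMPA (μ : Measure S) (F : S ≃ₜ S) (Ts Tu : MeasuredTurbulation μ)
    (lam : ℝ) : Prop where
  measurePreserving : MeasurePreserving (⇑F) μ μ
  one_lt_lam : 1 < lam
  turbulations : MPATurbulations Ts Tu
  stable_image : ∀ ℓ ∈ Ts.lines, ⇑F '' ℓ ∈ Ts.lines
  unstable_image : ∀ ℓ ∈ Tu.lines, ⇑F '' ℓ ∈ Tu.lines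
  stable_contract : ∀ ℓ ∈ Ts.lines, ∀ A : Set S, ∀ x y : S, IsArcIn ℓ A x y →
    Ts.ν (⇑F '' ℓ) (⇑F '' A) = (ENNReal.ofReal lam)⁻¹ * Ts.ν ℓ A
  unstable_expand : ∀ ℓ ∈ Tu.lines, ∀ A : Set S, ∀ x y : S, IsArcIn ℓ A x y →
    Tu.ν (⇑F '' ℓ) (⇑F '' A) = ENNReal.ofReal lam * Tu.ν ℓ A

/-- `x` is a (two-sided) density point of `D` along the streamline `ℓ` of `T`. -/
def DensityPtAlong {μ : Measure S} (T : MeasuredTurbulation μ) (ℓ D : Set S) (x : S) :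
    Prop :=
  ∀ ε : ℝ, 0 < ε → ∃ δ : ℝ, 0 < δ ∧ ∀ A : Set S, ∀ y : S,
    IsArcIn ℓ A x y → T.ν ℓ A < ENNReal.ofReal δ →
      (1 - ε) * (T.ν ℓ A).toReal ≤ (T.ν ℓ (A ∩ D)).toReal

/-- The set `den_k(R)` of level `k` density points of the tartan `R`. -/
def denSet {μ : Measure S} {Ts Tu : MeasuredTurbulation μ} (R : Tartan Ts Tu) :
    ℕ → Set S
  | 0 => R.core
  | k + 1 =>
    {x : S | x ∈ denSet R k ∧
      (∀ ℓ ∈ Ts.lines, x ∈ ℓ → DensityPtAlong Ts ℓ (denSet R k) x) ∧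
      (∀ ℓ ∈ Tu.lines, x ∈ ℓ → DensityPtAlong Tu ℓ (denSet R k) x)}

/-- The set `X_{δ,η}(R)`: points of `R^⋔` all of whose stable and unstable stream arcs of
measure less than `η` contain points of `R^⋔` in density at least `1 - δ`. -/
def Xset {μ : Measure S} {Ts Tu : MeasuredTurbulation μ} (R : Tartan Ts Tu)
    (δ η : ℝ) : Set S :=
  {x : S | x ∈ R.core ∧
    (∀ ℓ ∈ Ts.lines, x ∈ ℓ → ∀ A : Set S, ∀ y : S, IsArcIn ℓ A x y →
      Ts.ν ℓ A < ENNReal.ofReal η →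
        ENNReal.ofReal (1 - δ) * Ts.ν ℓ A ≤ Ts.ν ℓ (A ∩ R.core)) ∧
    (∀ ℓ ∈ Tu.lines, x ∈ ℓ → ∀ A : Set S, ∀ y : S, IsArcIn ℓ A x y →
      Tu.ν ℓ A < ENNReal.ofReal η →
        ENNReal.ofReal (1 - δ) * Tu.ν ℓ A ≤ Tu.ν ℓ (A ∩ R.core))}

/-- A regular tartan: for `y ∈ 𝔰(x) ∩ R^⋔` and `z ∈ 𝔲(x) ∩ R^⋔` at small stream distance
from `x`, all the fibers of the subtartan `R(y,z)` (the subarcs of stable fibers running from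
`𝔲(y)` to `𝔲(z) = 𝔲(x)`, and of unstable fibers running from `𝔰(y) = 𝔰(x)` to `𝔰(z)`)
are contained in `U`. -/
def Tartan.Regular {μ : Measure S} {Ts Tu : MeasuredTurbulation μ}
    (R : Tartan Ts Tu) : Prop :=
  ∀ x ∈ R.core, ∀ U ∈ 𝓝 x, ∃ δ : ℝ, 0 < δ ∧
    ∀ 𝔰x ∈ R.fibs, x ∈ 𝔰x → ∀ 𝔲x ∈ R.fibu, x ∈ 𝔲x →
    ∀ y ∈ 𝔰x ∩ R.core, ∀ z ∈ 𝔲x ∩ R.core,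
    (∀ ℓ ∈ Ts.lines, 𝔰x ⊆ ℓ → ∀ α : Set S, IsArcIn ℓ α x y →
      Ts.ν ℓ α < ENNReal.ofReal δ) →
    (∀ ℓ ∈ Tu.lines, 𝔲x ⊆ ℓ → ∀ α : Set S, IsArcIn ℓ α x z →
      Tu.ν ℓ α < ENNReal.ofReal δ) →
    ∀ 𝔲y ∈ R.fibu, y ∈ 𝔲y → ∀ 𝔰z ∈ R.fibs, z ∈ 𝔰z →
      ((∀ A ∈ R.fibs, ∀ p q : S, p ∈ A ∩ 𝔲y → q ∈ A ∩ 𝔲x →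
          ∀ ℓ ∈ Ts.lines, A ⊆ ℓ → ∀ α : Set S, IsArcIn ℓ α p q → α ⊆ U) ∧
       (∀ B ∈ R.fibu, ∀ p q : S, p ∈ B ∩ 𝔰x → q ∈ B ∩ 𝔰z →
          ∀ ℓ ∈ Tu.lines, B ⊆ ℓ → ∀ β : Set S, IsArcIn ℓ β p q → β ⊆ U))

/-- A (stable) bi-Lipschitz regular tartan: for some metric compatible with the topology of
`S` and some `K ≥ 1`, stream measure and distance are `K`-bi-Lipschitz comparable along
stable fibers. -/
def Tartan.StableBiLipschitzRegular {μ : Measure S} {Ts Tu : MeasuredTurbulation μ}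
    (R : Tartan Ts Tu) : Prop :=
  ∃ d : S → S → ℝ, IsCompatibleMetric S d ∧ ∃ K : ℝ, 1 ≤ K ∧
    ∀ 𝔰 ∈ R.fibs, ∀ x ∈ 𝔰, ∀ y ∈ 𝔰, ∀ ℓ ∈ Ts.lines, 𝔰 ⊆ ℓ →
      ∀ α : Set S, IsArcIn ℓ α x y →
        d x y / K ≤ (Ts.ν ℓ α).toReal ∧ (Ts.ν ℓ α).toReal ≤ K * d x y

/-- The turbulation `T` has partial flowboxes: if `x` and `y` lie on the same streamline
`ℓ`, and arcs transverse to `ℓ` at `x` and `y` contain transverse intersections with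
streamlines of `T` arbitrarily close to `x` and `y` on the same side of `ℓ`, then every
neighbourhood `U` of the stream arc `[x,y]` contains other stream arcs with endpoints on the
two transversals.  (The transversals and the side are encoded via a chart straightening the
streamline.) -/
def HasPartialFlowboxes {μ : Measure S} (T : MeasuredTurbulation μ) : Prop :=
  ∀ ℓ ∈ T.lines, ∀ x y : S, ∀ A : Set S, IsArcIn ℓ A x y →
  ∀ V : Set S, IsOpen V → ∀ e : V ≃ₜ ℝ × ℝ, A ⊆ V →
  (Subtype.val '' (⇑e ⁻¹' {p : ℝ × ℝ | p.2 = 0}) ⊆ ℓ) →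
  (∃ hx : x ∈ V, e ⟨x, hx⟩ = (0, 0)) →
  (∃ hy : y ∈ V, e ⟨y, hy⟩ = (1, 0)) →
  (∀ ε : ℝ, 0 < ε → ∃ p : S, ∃ hp : p ∈ V,
      (e ⟨p, hp⟩).1 = 0 ∧ 0 < (e ⟨p, hp⟩).2 ∧ (e ⟨p, hp⟩).2 < ε ∧
      ∃ ℓ' ∈ T.lines, p ∈ ℓ' ∧
        TransverseAt ℓ' (Subtype.val '' (⇑e ⁻¹' {q : ℝ × ℝ | q.1 = 0})) p) →
  (∀ ε : ℝ, 0 < ε → ∃ p : S, ∃ hp : p ∈ V,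
      (e ⟨p, hp⟩).1 = 1 ∧ 0 < (e ⟨p, hp⟩).2 ∧ (e ⟨p, hp⟩).2 < ε ∧
      ∃ ℓ' ∈ T.lines, p ∈ ℓ' ∧
        TransverseAt ℓ' (Subtype.val '' (⇑e ⁻¹' {q : ℝ × ℝ | q.1 = 1})) p) →
  ∀ U : Set S, IsOpen U → A ⊆ U →
    ∃ ℓ'' ∈ T.lines, ∃ A'' : Set S, ∃ x'' y'' : S, IsArcIn ℓ'' A'' x'' y'' ∧
      A'' ⊆ U ∧ A'' ≠ A ∧
      x'' ∈ Subtype.val '' (⇑e ⁻¹' {q : ℝ × ℝ | q.1 = 0}) ∧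
      y'' ∈ Subtype.val '' (⇑e ⁻¹' {q : ℝ × ℝ | q.1 = 1})

/-- Forward Birkhoff averages of `φ` under the homeomorphism `F`. -/
def birkhoffFwd (F : S ≃ₜ S) (φ : S → ℝ) (x : S) (n : ℕ) : ℝ :=
  (n : ℝ)⁻¹ * ∑ i ∈ Finset.range n, φ ((⇑F)^[i] x)

/-- Backward Birkhoff averages of `φ` under the homeomorphism `F`. -/
def birkhoffBwd (F : S ≃ₜ S) (φ : S → ℝ) (x : S) (n : ℕ) : ℝ :=
  (n : ℝ)⁻¹ * ∑ i ∈ Finset.range n, φ ((⇑F.symm)^[i] x)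

/-- The set `Z` of points where the forward and backward Birkhoff averages of `φ` exist
and are equal. -/
def ZSet (F : S ≃ₜ S) (φ : S → ℝ) : Set S :=
  {x : S | ∃ c : ℝ, Tendsto (birkhoffFwd F φ x) atTop (𝓝 c) ∧
      Tendsto (birkhoffBwd F φ x) atTop (𝓝 c)}

/-- The relation `~` on `Z`: `x ~ y` if they are joined by a finite chain of stream arcs
whose consecutive intersections contain points of `Z`. -/
def StreamRel {μ : Measure S} (Ts Tu : MeasuredTurbulation μ) (F : S ≃ₜ S)
    (φ : S → ℝ) (x y : S) : Prop :=
  x ∈ ZSet F φ ∧ y ∈ ZSet F φ ∧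
  (x = y ∨ ∃ k : ℕ, ∃ α : Fin (k + 1) → Set S,
    (∀ i, (∃ ℓ ∈ Ts.lines, IsArc ℓ (α i)) ∨ (∃ ℓ ∈ Tu.lines, IsArc ℓ (α i))) ∧
    x ∈ α 0 ∧ y ∈ α (Fin.last k) ∧
    ∀ i : Fin k, ∃ z ∈ α i.castSucc ∩ α i.succ, z ∈ ZSet F φ)

set_option linter.unusedSectionVars false

/-- The variation of a continuous logarithm of `f` along `[a, b]`. -/
def lvar (f : ℝ → ℂ) (a b : ℝ) : ℂ :=
  Classical.epsilon fun v ↦ ∃ u : ℝ → ℂ, ContinuousOn u (Icc a b) ∧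
    (∀ t ∈ Icc a b, Complex.exp (u t) = f t) ∧ v = u b - u a

lemma sub_const_of_exp_eq {X : Type*} [TopologicalSpace X] {s : Set X} (hs : IsPreconnected s)
    {u v : X → ℂ} (hu : ContinuousOn u s) (hv : ContinuousOn v s)
    (h : ∀ x ∈ s, Complex.exp (u x) = Complex.exp (v x)) {x y : X} (hx : x ∈ s) (hy : y ∈ s) :
    u x - v x = u y - v y := by
  have key : ∀ z ∈ s, ∃ n : ℤ, u z - v z = n * (2 * Real.pi * Complex.I) := by
    intro z hz
    obtain ⟨n, hn⟩ := Complex.exp_eq_exp_iff_exists_int.1 (h z hz)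
    exact ⟨n, by rw [hn]; ring⟩
  have hpi : (2 * Real.pi * Complex.I : ℂ) ≠ 0 := Complex.two_pi_I_ne_zero
  let w : X → ℝ := fun z ↦ ((u z - v z) / (2 * Real.pi * Complex.I)).re
  have hw : ContinuousOn w s :=
    Complex.continuous_re.comp_continuousOn ((hu.sub hv).div_const _)
  have hwn : ∀ z ∈ s, ∃ n : ℤ, w z = n ∧ u z - v z = n * (2 * Real.pi * Complex.I) := by
    intro z hz
    obtain ⟨n, hn⟩ := key z hz
    refine ⟨n, ?_, hn⟩
    simp only [w]
    rw [hn, mul_div_assoc, div_self hpi]; simp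
  have hpre : IsPreconnected (w '' s) := hs.image w hw
  have hsub : w '' s ⊆ Set.range ((↑) : ℤ → ℝ) := by
    rintro _ ⟨z, hz, rfl⟩
    obtain ⟨n, hn, -⟩ := hwn z hz
    exact ⟨n, hn.symm⟩
  obtain ⟨n, hn, hn'⟩ := hwn x hx
  obtain ⟨m, hm, hm'⟩ := hwn y hy
  have hord := hpre.ordConnected
  have hnm : n = m := by
    by_contra hne
    have : ∀ p q : ℤ, p < q → (p : ℝ) ∈ w '' s → (q : ℝ) ∈ w '' s → False := by
      intro p q hpq hp hq
      have hmem : (p : ℝ) + 1 / 2 ∈ w '' s := by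
        apply hord.out hp hq
        have : (p : ℝ) + 1 ≤ q := by exact_mod_cast hpq
        constructor <;> linarith
      obtain ⟨k, hk⟩ := hsub hmem
      have h1 : (p : ℝ) < k := by rw [hk]; linarith
      have h2 : (k : ℝ) < p + 1 := by rw [hk]; linarith
      have h1' : p < k := by exact_mod_cast h1
      have h2' : k < p + 1 := by exact_mod_cast h2
      omega
    have hnm' : (n : ℝ) ∈ w '' s := ⟨x, hx, hn⟩
    have hmm' : (m : ℝ) ∈ w '' s := ⟨y, hy, hm⟩
    rcases lt_or_gt_of_ne hne with h | h
    · exact this _ _ h hnm' hmm'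
    · exact this _ _ h hmm' hnm'
  rw [hn', hm', hnm]

lemma lvar_eq {f u : ℝ → ℂ} {a b : ℝ} (hab : a ≤ b) (hu : ContinuousOn u (Icc a b))
    (h : ∀ t ∈ Icc a b, Complex.exp (u t) = f t) : lvar f a b = u b - u a := by
  obtain ⟨w, hw, hw', hv⟩ := Classical.epsilon_spec
    (p := fun v ↦ ∃ u : ℝ → ℂ, ContinuousOn u (Icc a b) ∧
    (∀ t ∈ Icc a b, Complex.exp (u t) = f t) ∧ v = u b - u a) ⟨_, u, hu, h, rfl⟩
  have := sub_const_of_exp_eq isPreconnected_Icc hw hu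
    (fun x hx ↦ by rw [hw' x hx, h x hx]) (left_mem_Icc.2 hab) (right_mem_Icc.2 hab)
  rw [lvar, hv]
  linear_combination -this

lemma isSimplyConnected_univ_of_convex {E : Type*} [NormedAddCommGroup E] [NormedSpace ℝ E] :
    IsSimplyConnected (univ : Set E) :=
  haveI : ContractibleSpace (univ : Set E) :=
    Convex.contractibleSpace convex_univ univ_nonempty
  inferInstanceAs (SimplyConnectedSpace (univ : Set E))

lemma exists_log_Icc {f : ℝ → ℂ} {a b : ℝ} (hab : a ≤ b) (hf : ContinuousOn f (Icc a b))
    (h0 : ∀ t ∈ Icc a b, f t ≠ 0) :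
    ∃ u : ℝ → ℂ, ContinuousOn u (Icc a b) ∧ ∀ t ∈ Icc a b, Complex.exp (u t) = f t := by
  have hu : IsSimplyConnected (univ : Set ℝ) := isSimplyConnected_univ_of_convex
  obtain ⟨u, hu, hu'⟩ := Complex.exists_continuousOn_eqOn_exp_comp hu isOpen_univ
    (g := IccExtend hab (fun t : Icc a b ↦ f t))
    ((hf.domRestrict.Icc_extend' (h := hab)).continuousOn) (by
      rintro ⟨t, -, ht⟩
      exact h0 _ (projIcc a b hab t).2 ht)
  refine ⟨u, hu.mono (subset_univ _), fun t ht ↦ ?_⟩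
  have := hu' (mem_univ t)
  simp only [comp_apply] at this
  rw [this, IccExtend_of_mem hab _ ht]

lemma exists_log_square {f : ℝ × ℝ → ℂ} {a b c d : ℝ} (hab : a ≤ b) (hcd : c ≤ d)
    (hf : ContinuousOn f (Icc a b ×ˢ Icc c d)) (h0 : ∀ t ∈ Icc a b ×ˢ Icc c d, f t ≠ 0) :
    ∃ u : ℝ × ℝ → ℂ, ContinuousOn u (Icc a b ×ˢ Icc c d) ∧
      ∀ t ∈ Icc a b ×ˢ Icc c d, Complex.exp (u t) = f t := by
  have hu : IsSimplyConnected (univ : Set (ℝ × ℝ)) :=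
    isSimplyConnected_univ_of_convex
  let r : ℝ × ℝ → ℝ × ℝ := fun p ↦ (projIcc a b hab p.1, projIcc c d hcd p.2)
  have hr : Continuous r := by
    have h1 : Continuous (projIcc a b hab) := continuous_projIcc
    have h2 : Continuous (projIcc c d hcd) := continuous_projIcc
    exact (continuous_subtype_val.comp (h1.comp continuous_fst)).prodMk
      (continuous_subtype_val.comp (h2.comp continuous_snd))
  have hrm : ∀ p, r p ∈ Icc a b ×ˢ Icc c d := fun p ↦ ⟨Subtype.prop _, Subtype.prop _⟩
  obtain ⟨u, hu, hu'⟩ := Complex.exists_continuousOn_eqOn_exp_comp hu isOpen_univ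
    (g := f ∘ r) ((hf.comp_continuous hr hrm).continuousOn) (by
      rintro ⟨t, -, ht⟩
      exact h0 _ (hrm t) ht)
  refine ⟨u, hu.mono (subset_univ _), fun t ht ↦ ?_⟩
  have := hu' (mem_univ t)
  simp only [comp_apply] at this
  rw [this]
  congr 1
  simp only [r]
  rw [projIcc_of_mem hab ht.1, projIcc_of_mem hcd ht.2]

lemma lvar_congr {f g : ℝ → ℂ} {a b : ℝ} (h : EqOn f g (Icc a b)) : lvar f a b = lvar g a b := by
  refine congrArg Classical.epsilon (funext fun v ↦ propext (exists_congr fun u ↦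
    and_congr_right fun _ ↦ and_congr_left fun _ ↦ forall₂_congr fun t ht ↦ ?_))
  rw [h ht]

lemma lvar_concat {f : ℝ → ℂ} {a b c : ℝ} (hab : a ≤ b) (hbc : b ≤ c)
    (hf : ContinuousOn f (Icc a c)) (h0 : ∀ t ∈ Icc a c, f t ≠ 0) :
    lvar f a c = lvar f a b + lvar f b c := by
  obtain ⟨u, hu, hu'⟩ := exists_log_Icc (hab.trans hbc) hf h0
  have h1 : Icc a b ⊆ Icc a c := Icc_subset_Icc_right hbc
  have h2 : Icc b c ⊆ Icc a c := Icc_subset_Icc_left hab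
  rw [lvar_eq (hab.trans hbc) hu hu', lvar_eq hab (hu.mono h1) (fun t ht ↦ hu' t (h1 ht)),
    lvar_eq hbc (hu.mono h2) (fun t ht ↦ hu' t (h2 ht))]
  ring

lemma lvar_neg {f : ℝ → ℂ} {a b : ℝ} (hab : a ≤ b)
    (hf : ContinuousOn f (Icc a b)) (h0 : ∀ t ∈ Icc a b, f t ≠ 0) :
    lvar (fun t ↦ -f t) a b = lvar f a b := by
  obtain ⟨u, hu, hu'⟩ := exists_log_Icc hab hf h0
  rw [lvar_eq hab hu hu', lvar_eq (u := fun t ↦ u t + Real.pi * Complex.I) hab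
    (hu.add continuousOn_const) (fun t ht ↦ by simp [Complex.exp_add, hu' t ht])]
  ring

lemma lvar_sub_comm {f g : ℝ → ℂ} {a b : ℝ} (hab : a ≤ b)
    (hf : ContinuousOn f (Icc a b)) (hg : ContinuousOn g (Icc a b))
    (h0 : ∀ t ∈ Icc a b, f t ≠ g t) :
    lvar (fun t ↦ f t - g t) a b = lvar (fun t ↦ g t - f t) a b := by
  refine (lvar_neg hab (f := fun t ↦ f t - g t) (hf.sub hg)
    (fun t ht ↦ sub_ne_zero.2 (h0 t ht))).symm.trans ?_
  exact lvar_congr fun t _ ↦ by simp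

lemma lvar_mul {f g : ℝ → ℂ} {a b : ℝ} (hab : a ≤ b)
    (hf : ContinuousOn f (Icc a b)) (hf0 : ∀ t ∈ Icc a b, f t ≠ 0)
    (hg : ContinuousOn g (Icc a b)) (hg0 : ∀ t ∈ Icc a b, g t ≠ 0) :
    lvar (fun t ↦ f t * g t) a b = lvar f a b + lvar g a b := by
  obtain ⟨u, hu, hu'⟩ := exists_log_Icc hab hf hf0
  obtain ⟨v, hv, hv'⟩ := exists_log_Icc hab hg hg0
  rw [lvar_eq hab hu hu', lvar_eq hab hv hv', lvar_eq (u := fun t ↦ u t + v t) hab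
    (hu.add hv) (fun t ht ↦ by rw [Complex.exp_add, hu' t ht, hv' t ht])]
  ring

lemma lvar_const {c : ℂ} (hc : c ≠ 0) {a b : ℝ} (hab : a ≤ b) : lvar (fun _ ↦ c) a b = 0 := by
  rw [lvar_eq (u := fun _ ↦ Complex.log c) hab continuousOn_const
    (fun t _ ↦ Complex.exp_log hc), sub_self]

lemma lvar_square {D : ℝ → ℝ → ℂ} {a b c d : ℝ} (hab : a ≤ b) (hcd : c ≤ d)
    (hD : ContinuousOn (uncurry D) (Icc a b ×ˢ Icc c d))
    (h0 : ∀ s ∈ Icc a b, ∀ t ∈ Icc c d, D s t ≠ 0) :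
    lvar (fun s ↦ D s c) a b + lvar (fun t ↦ D b t) c d =
      lvar (fun s ↦ D s d) a b + lvar (fun t ↦ D a t) c d := by
  obtain ⟨u, hu, hu'⟩ := exists_log_square hab hcd hD (fun p hp ↦ h0 p.1 hp.1 p.2 hp.2)
  have hs : ∀ t ∈ Icc c d, lvar (fun s ↦ D s t) a b = u (b, t) - u (a, t) := fun t ht ↦
    lvar_eq (u := fun s ↦ u (s, t)) hab
      (hu.comp (by fun_prop) (fun s hs ↦ ⟨hs, ht⟩)) (fun s hs ↦ hu' (s, t) ⟨hs, ht⟩)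
  have ht : ∀ s ∈ Icc a b, lvar (fun t ↦ D s t) c d = u (s, d) - u (s, c) := fun s hs ↦
    lvar_eq (u := fun t ↦ u (s, t)) hcd
      (hu.comp (by fun_prop) (fun t ht ↦ ⟨hs, ht⟩)) (fun t ht ↦ hu' (s, t) ⟨hs, ht⟩)
  rw [hs c (left_mem_Icc.2 hcd), hs d (right_mem_Icc.2 hcd), ht b (right_mem_Icc.2 hab),
    ht a (left_mem_Icc.2 hab)]
  ring

lemma lvar_diag {D : ℝ → ℝ → ℂ} {a b : ℝ} (hab : a ≤ b)
    (hD : ContinuousOn (uncurry D) (Icc a b ×ˢ Icc a b))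
    (h0 : ∀ s ∈ Icc a b, ∀ t ∈ Icc a b, D s t ≠ 0) :
    lvar (fun s ↦ D s s) a b = lvar (fun t ↦ D a t) a b + lvar (fun s ↦ D s b) a b := by
  obtain ⟨u, hu, hu'⟩ := exists_log_square hab hab hD (fun p hp ↦ h0 p.1 hp.1 p.2 hp.2)
  rw [lvar_eq (f := fun s ↦ D s s) (u := fun s ↦ u (s, s)) hab
      (hu.comp (by fun_prop) (fun s hs ↦ ⟨hs, hs⟩)) (fun s hs ↦ hu' (s, s) ⟨hs, hs⟩),
    lvar_eq (f := fun s ↦ D s b) (u := fun s ↦ u (s, b)) hab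
      (hu.comp (by fun_prop) (fun s hs ↦ ⟨hs, right_mem_Icc.2 hab⟩))
      (fun s hs ↦ hu' (s, b) ⟨hs, right_mem_Icc.2 hab⟩),
    lvar_eq (f := fun t ↦ D a t) (u := fun s ↦ u (a, s)) hab
      (hu.comp (by fun_prop) (fun s hs ↦ ⟨left_mem_Icc.2 hab, hs⟩))
      (fun s hs ↦ hu' (a, s) ⟨left_mem_Icc.2 hab, hs⟩)]
  ring

lemma exists_log_ratio_scale {K : Set ℂ} (hK : IsCompact K) {h : ℂ → ℂ} (hh : ContinuousOn h K)
    (h0 : ∀ z ∈ K, h z ≠ 0) :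
    ∃ δ > 0, ∀ z ∈ K, ∀ w ∈ K, dist z w < δ → 0 < (h z / h w).re := by
  obtain ⟨m, hm, hm'⟩ : ∃ m > 0, ∀ z ∈ K, m ≤ ‖h z‖ := by
    rcases K.eq_empty_or_nonempty with rfl | hne
    · exact ⟨1, one_pos, by simp⟩
    · obtain ⟨z, hz, hz'⟩ := hK.exists_isMinOn hne hh.norm
      exact ⟨‖h z‖, norm_pos_iff.2 (h0 z hz), fun w hw ↦ hz' hw⟩
  have huc := hK.uniformContinuousOn_of_continuous hh
  obtain ⟨δ, hδ, hd⟩ := Metric.uniformContinuousOn_iff.1 huc m hm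
  refine ⟨δ, hδ, fun z hz w hw hzw ↦ ?_⟩
  have h1 := hd z hz w hw hzw
  have h2 : ‖h z / h w - 1‖ < 1 := by
    have hw0 := h0 w hw
    rw [div_sub_one hw0, norm_div, div_lt_one (norm_pos_iff.2 hw0), ← dist_eq_norm]
    exact h1.trans_le (hm' w hw)
  have h3 := (Complex.abs_re_le_norm (h z / h w - 1)).trans_lt h2
  rw [abs_lt] at h3
  simp only [Complex.sub_re, Complex.one_re] at h3
  linarith [h3.1]

lemma log_mul_of_re_pos {a b : ℂ} (ha : 0 < a.re) (hb : 0 < b.re) :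
    Complex.log (a * b) = Complex.log a + Complex.log b := by
  have ha0 : a ≠ 0 := by rintro rfl; simp at ha
  have hb0 : b ≠ 0 := by rintro rfl; simp at hb
  have h1 := Complex.abs_arg_lt_pi_div_two_iff.2 (Or.inl ha)
  have h2 := Complex.abs_arg_lt_pi_div_two_iff.2 (Or.inl hb)
  rw [abs_lt] at h1 h2
  exact Complex.log_mul ha0 hb0 ⟨by linarith, by linarith⟩

lemma exists_log_strip {K : Set ℂ} (hK : IsCompact K) {h : ℂ → ℂ} (hh : ContinuousOn h K)
    (h0 : ∀ z ∈ K, h z ≠ 0) :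
    ∃ δ > 0, ∀ c : ℝ, ∃ u : ℂ → ℂ, ContinuousOn u (K ∩ {z | c ≤ z.im ∧ z.im ≤ c + δ}) ∧
      ∀ z ∈ K ∩ {z | c ≤ z.im ∧ z.im ≤ c + δ}, Complex.exp (u z) = h z := by
  obtain ⟨δ, hδ, hd⟩ := exists_log_ratio_scale hK hh h0
  obtain ⟨M, hM⟩ := hK.isBounded.exists_norm_le
  set η := δ / 8 with hη
  have hηpos : 0 < η := by positivity
  refine ⟨η, hηpos, fun c ↦ ?_⟩
  set S := K ∩ {z : ℂ | c ≤ z.im ∧ z.im ≤ c + η} with hS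
  have hclose : ∀ z ∈ S, ∀ w ∈ S, |z.re - w.re| ≤ 2 * η → 0 < (h z / h w).re := by
    rintro z ⟨hz, hz1, hz2⟩ w ⟨hw, hw1, hw2⟩ hzw
    refine hd z hz w hw ?_
    rw [dist_eq_norm]
    refine (Complex.norm_le_abs_re_add_abs_im _).trans_lt ?_
    have : |(z - w).im| ≤ η := by rw [Complex.sub_im, abs_le]; constructor <;> linarith
    rw [Complex.sub_re]
    linarith
  have hcoc : ∀ z ∈ S, ∀ w ∈ S, ∀ v ∈ S, |z.re - w.re| ≤ 2 * η → |w.re - v.re| ≤ 2 * η →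
      Complex.log (h z / h w) + Complex.log (h w / h v) = Complex.log (h z / h v) := by
    intro z hz w hw v hv h1 h2
    rw [← log_mul_of_re_pos (hclose z hz w hw h1) (hclose w hw v hv h2), div_mul_div_cancel₀]
    exact h0 w hw.1
  have key : ∀ j : ℕ, ∃ u : ℂ → ℂ, (∀ z ∈ S, z.re ≤ -M - 1 + j * η → Complex.exp (u z) = h z) ∧
      ∀ z ∈ S, ∀ w ∈ S, z.re ≤ -M - 1 + j * η → w.re ≤ -M - 1 + j * η → |z.re - w.re| ≤ η →
        u z - u w = Complex.log (h z / h w) := by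
    intro j
    induction j with
    | zero =>
      refine ⟨0, fun z hz hz' ↦ ?_, fun z hz w hw hz' ↦ ?_⟩ <;>
      · have := (abs_le.1 ((Complex.abs_re_le_norm z).trans (hM z hz.1))).1
        simp at hz'
        linarith
    | succ j ih =>
      obtain ⟨u, hu, hu'⟩ := ih
      set t := -M - 1 + j * η with ht
      have ht' : -M - 1 + ((j + 1 : ℕ) : ℝ) * η = t + η := by push_cast; ring
      rw [ht']
      -- a base value for the new cell
      obtain ⟨v, hv, hv', hv''⟩ : ∃ v : ℂ → ℂ,
          (∀ z ∈ S, t < z.re → z.re ≤ t + η → Complex.exp (v z) = h z) ∧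
          (∀ z ∈ S, ∀ w ∈ S, t < z.re → z.re ≤ t + η → t < w.re → w.re ≤ t + η →
            v z - v w = Complex.log (h z / h w)) ∧
          (∀ z ∈ S, ∀ w ∈ S, t < z.re → z.re ≤ t + η → w.re ≤ t → t - η ≤ w.re →
            v z - u w = Complex.log (h z / h w)) := by
        by_cases hbase : ∃ z0 ∈ S, t - η ≤ z0.re ∧ z0.re ≤ t
        · obtain ⟨z0, hz0, hz1, hz2⟩ := hbase
          have h00 := h0 z0 hz0.1
          refine ⟨fun z ↦ u z0 + Complex.log (h z / h z0), fun z hz h1 h2 ↦ ?_,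
            fun z hz w hw h1 h2 h3 h4 ↦ ?_, fun z hz w hw h1 h2 h3 h4 ↦ ?_⟩
          · rw [Complex.exp_add, hu z0 hz0 hz2, Complex.exp_log (div_ne_zero (h0 z hz.1) h00),
              mul_div_cancel₀ _ h00]
          · have := hcoc z hz w hw z0 hz0 (by rw [abs_le]; constructor <;> linarith)
              (by rw [abs_le]; constructor <;> linarith)
            linear_combination -this
          · have := hcoc z hz w hw z0 hz0 (by rw [abs_le]; constructor <;> linarith)
              (by rw [abs_le]; constructor <;> linarith)
            have h5 := hu' w hw z0 hz0 h3 hz2 (by rw [abs_le]; constructor <;> linarith)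
            linear_combination -this - h5
        · push Not at hbase
          by_cases hcell : ∃ z0 ∈ S, t < z0.re ∧ z0.re ≤ t + η
          · obtain ⟨z0, hz0, hz1, hz2⟩ := hcell
            have h00 := h0 z0 hz0.1
            refine ⟨fun z ↦ Complex.log (h z0) + Complex.log (h z / h z0), fun z hz h1 h2 ↦ ?_,
              fun z hz w hw h1 h2 h3 h4 ↦ ?_, fun z hz w hw h1 h2 h3 h4 ↦ ?_⟩
            · rw [Complex.exp_add, Complex.exp_log h00,
                Complex.exp_log (div_ne_zero (h0 z hz.1) h00), mul_div_cancel₀ _ h00]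
            · have := hcoc z hz w hw z0 hz0 (by rw [abs_le]; constructor <;> linarith)
                (by rw [abs_le]; constructor <;> linarith)
              linear_combination -this
            · have := hbase w hw h4
              linarith
          · push Not at hcell
            refine ⟨u, fun z hz h1 h2 ↦ ?_, fun z hz w hw h1 h2 h3 h4 ↦ ?_,
              fun z hz w hw h1 h2 h3 h4 ↦ ?_⟩ <;>
            · have := hcell z hz h1
              linarith
      refine ⟨fun z ↦ if z.re ≤ t then u z else v z, fun z hz h1 ↦ ?_, fun z hz w hw h1 h2 h3 ↦ ?_⟩
      · dsimp only
        split_ifs with h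
        · exact hu z hz h
        · exact hv z hz (not_le.1 h) h1
      · dsimp only
        have h3' := abs_le.1 h3
        split_ifs with h4 h5 h5
        · exact hu' z hz w hw h4 h5 h3
        · have h6 := hv'' w hw z hz (not_le.1 h5) h2 h4 (by linarith [not_le.1 h5])
          have h7 := hcoc z hz w hw z hz (by linarith) (by rw [abs_sub_comm]; linarith)
          rw [div_self (h0 z hz.1), Complex.log_one] at h7
          linear_combination -h6 - h7
        · exact hv'' z hz w hw (not_le.1 h4) h1 h5 (by linarith [not_le.1 h4])
        · exact hv' z hz w hw (not_le.1 h4) h1 (not_le.1 h5) h2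
  obtain ⟨j, hj⟩ := exists_nat_gt ((2 * M + 1) / η)
  rw [div_lt_iff₀ hηpos] at hj
  obtain ⟨u, hu, hu'⟩ := key j
  have hle : ∀ z ∈ S, z.re ≤ -M - 1 + j * η := fun z hz ↦ by
    have := (abs_le.1 ((Complex.abs_re_le_norm z).trans (hM z hz.1))).2
    linarith
  refine ⟨u, fun z hz ↦ ?_, fun z hz ↦ hu z hz (hle z hz)⟩
  have hev : ∀ᶠ w in 𝓝[S] z, u w = u z + Complex.log (h w / h z) := by
    have h1 : ∀ᶠ w in 𝓝[S] z, dist w z < η :=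
      nhdsWithin_le_nhds (Metric.ball_mem_nhds z hηpos)
    filter_upwards [h1, self_mem_nhdsWithin] with w hw hwS
    have h2 : |w.re - z.re| ≤ η := by
      rw [← Complex.sub_re]
      exact (Complex.abs_re_le_norm _).trans (by rw [← dist_eq_norm]; exact hw.le)
    rw [← hu' w hwS z hz (hle w hwS) (hle z hz) h2]
    ring
  have hcont : ContinuousWithinAt (fun w ↦ u z + Complex.log (h w / h z)) S z := by
    have hzz : h z / h z = 1 := div_self (h0 z hz.1)
    refine continuousWithinAt_const.add (ContinuousWithinAt.clog
      (((hh z hz.1).mono inter_subset_left).div_const _) ?_)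
    rw [hzz]; exact Complex.one_mem_slitPlane
  refine hcont.congr_of_eventuallyEq hev ?_
  rw [div_self (h0 z hz.1)]; simp

section

/-- Functions that agree on `K` with a product of an exponential and of integer powers of
`z - p`, `p ∉ K`. -/
inductive ExpRational (K : Set ℂ) : (ℂ → ℂ) → Prop
  | exp (u : ℂ → ℂ) (hu : ContinuousOn u K) : ExpRational K (fun z ↦ Complex.exp (u z))
  | sub (p : ℂ) (hp : p ∉ K) : ExpRational K (fun z ↦ z - p)
  | inv_sub (p : ℂ) (hp : p ∉ K) : ExpRational K (fun z ↦ (z - p)⁻¹)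
  | mul {f g : ℂ → ℂ} : ExpRational K f → ExpRational K g → ExpRational K (fun z ↦ f z * g z)
  | congr {f g : ℂ → ℂ} : ExpRational K f → EqOn f g K → ExpRational K g

namespace ExpRational

variable {K : Set ℂ} {f : ℂ → ℂ}

lemma continuousOn_and_ne_zero (hf : ExpRational K f) :
    ContinuousOn f K ∧ ∀ z ∈ K, f z ≠ 0 := by
  induction hf with
  | exp u hu => exact ⟨hu.cexp, fun z _ ↦ Complex.exp_ne_zero _⟩
  | sub p hp =>
    exact ⟨by fun_prop, fun z hz ↦ sub_ne_zero.2 fun h ↦ hp (h ▸ hz)⟩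
  | inv_sub p hp =>
    have : ∀ z ∈ K, z - p ≠ 0 := fun z hz ↦ sub_ne_zero.2 fun h ↦ hp (h ▸ hz)
    exact ⟨ContinuousOn.inv₀ (by fun_prop) this, fun z hz ↦ inv_ne_zero (this z hz)⟩
  | mul _ _ ih1 ih2 =>
    exact ⟨ih1.1.mul ih2.1, fun z hz ↦ mul_ne_zero (ih1.2 z hz) (ih2.2 z hz)⟩
  | congr _ h ih => exact ⟨ih.1.congr h.symm, fun z hz ↦ h hz ▸ ih.2 z hz⟩

lemma zpow_sub {p : ℂ} (hp : p ∉ K) (k : ℤ) : ExpRational K (fun z ↦ (z - p) ^ k) := by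
  have hne : ∀ z ∈ K, z - p ≠ 0 := fun z hz ↦ sub_ne_zero.2 fun h ↦ hp (h ▸ hz)
  induction k with
  | zero => exact (exp 0 continuousOn_const).congr fun z _ ↦ by simp
  | succ n ih =>
    exact (ih.mul (sub p hp)).congr fun z hz ↦ by simp [zpow_add₀ (hne z hz)]
  | pred n ih =>
    exact (ih.mul (inv_sub p hp)).congr fun z hz ↦ by
      simp only [zpow_sub₀ (hne z hz), zpow_one, div_eq_mul_inv]

end ExpRational

/-- A logarithm on the closed upper half plane. -/
def logUp (w : ℂ) : ℂ := Complex.log (-Complex.I * w) + Real.pi / 2 * Complex.I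

/-- A logarithm on the closed lower half plane. -/
def logDown (w : ℂ) : ℂ := Complex.log (Complex.I * w) - Real.pi / 2 * Complex.I

lemma exp_logUp {w : ℂ} (hw : w ≠ 0) : Complex.exp (logUp w) = w := by
  rw [logUp, Complex.exp_add, Complex.exp_log (by simp [hw]), Complex.exp_pi_div_two_mul_I]
  linear_combination -w * Complex.I_sq

lemma exp_logDown {w : ℂ} (hw : w ≠ 0) : Complex.exp (logDown w) = w := by
  rw [logDown, sub_eq_add_neg, Complex.exp_add, Complex.exp_log (by simp [hw]), ← neg_mul,
    show -((Real.pi : ℂ) / 2) * Complex.I = -(Real.pi / 2 * Complex.I) by ring,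
    Complex.exp_neg, Complex.exp_pi_div_two_mul_I, Complex.inv_I]
  linear_combination -w * Complex.I_sq

lemma continuousOn_logUp : ContinuousOn logUp {w | 0 ≤ w.im ∧ w ≠ 0} := by
  refine ContinuousOn.add (ContinuousOn.clog (by fun_prop) ?_) continuousOn_const
  rintro w ⟨h1, h2⟩
  rw [Complex.mem_slitPlane_iff]
  rcases h1.lt_or_eq with h | h
  · left; simpa using h
  · right
    intro h3
    apply h2
    apply Complex.ext
    · simpa using h3
    · exact h.symm

lemma continuousOn_logDown : ContinuousOn logDown {w | w.im ≤ 0 ∧ w ≠ 0} := by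
  refine ContinuousOn.sub (ContinuousOn.clog (by fun_prop) ?_) continuousOn_const
  rintro w ⟨h1, h2⟩
  rw [Complex.mem_slitPlane_iff]
  rcases h1.lt_or_eq with h | h
  · left; simpa using h
  · right
    intro h3
    apply h2
    apply Complex.ext
    · simpa using h3
    · exact h

lemma logDown_sub_logUp_of_pos {w : ℂ} (h : w.im = 0) (hr : 0 < w.re) :
    logDown w - logUp w = 0 := by
  obtain ⟨x, rfl⟩ : ∃ x : ℝ, w = x := ⟨w.re, by apply Complex.ext <;> simp [h]⟩
  have hx : 0 < x := by simpa using hr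
  rw [logDown, logUp, mul_comm Complex.I, mul_comm (-Complex.I),
    Complex.log_ofReal_mul hx Complex.I_ne_zero, Complex.log_ofReal_mul hx (by simp), Complex.log_I, Complex.log_neg_I]
  ring

lemma logDown_sub_logUp_of_neg {w : ℂ} (h : w.im = 0) (hr : w.re < 0) :
    logDown w - logUp w = -(2 * Real.pi * Complex.I) := by
  obtain ⟨x, rfl⟩ : ∃ x : ℝ, w = x := ⟨w.re, by apply Complex.ext <;> simp [h]⟩
  have hx : 0 < -x := by simpa using hr
  have e1 : Complex.I * (x : ℂ) = ((-x : ℝ) : ℂ) * (-Complex.I) := by push_cast; ring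
  have e2 : -Complex.I * (x : ℂ) = ((-x : ℝ) : ℂ) * Complex.I := by push_cast; ring
  rw [logDown, logUp, e1, e2, Complex.log_ofReal_mul hx Complex.I_ne_zero,
    Complex.log_ofReal_mul hx (by simp), Complex.log_I, Complex.log_neg_I]
  ring

lemma exists_expRational_of_line {K : Set ℂ} (hK : IsCompact K) (c : ℝ) {w : ℂ → ℂ}
    (hw : ContinuousOn w (K ∩ {z | z.im = c}))
    (hw1 : ∀ z ∈ K ∩ {z | z.im = c}, Complex.exp (w z) = 1) :
    ∃ q u v : ℂ → ℂ, ExpRational K q ∧ ContinuousOn u (K ∩ {z | c ≤ z.im}) ∧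
      ContinuousOn v (K ∩ {z | z.im ≤ c}) ∧
      (∀ z ∈ K ∩ {z | c ≤ z.im}, Complex.exp (u z) = q z) ∧
      (∀ z ∈ K ∩ {z | z.im ≤ c}, Complex.exp (v z) = q z) ∧
      ∀ z ∈ K ∩ {z | z.im = c}, w z = v z - u z := by
  set A := K ∩ {z : ℂ | z.im = c} with hA
  have hAc : IsCompact A := hK.inter_right (isClosed_eq Complex.continuous_im continuous_const)
  obtain ⟨δ, hδ, hd⟩ := Metric.uniformContinuousOn_iff.1
    (hAc.uniformContinuousOn_of_continuous hw) (2 * Real.pi) (by positivity)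
  have hloc : ∀ z ∈ A, ∀ z' ∈ A, |z.re - z'.re| < δ → w z = w z' := by
    intro z hz z' hz' h
    have h1 : dist z z' < δ := by
      rw [dist_eq_norm]
      refine (Complex.norm_le_abs_re_add_abs_im _).trans_lt ?_
      have e1 : z.im = c := hz.2
      have e2 : z'.im = c := hz'.2
      simpa [e1, e2] using h
    have h2 := hd z hz z' hz' h1
    obtain ⟨n, hn⟩ := Complex.exp_eq_exp_iff_exists_int.1 ((hw1 z hz).trans (hw1 z' hz').symm)
    rw [hn, dist_eq_norm, add_sub_cancel_left] at h2
    have h3 : ‖(n : ℂ) * (2 * Real.pi * Complex.I)‖ = |(n : ℝ)| * (2 * Real.pi) := by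
      simp [abs_of_pos Real.pi_pos]
    rw [h3] at h2
    have h4 : |(n : ℝ)| < 1 := by
      have := Real.pi_pos
      by_contra hcon
      nlinarith [not_lt.1 hcon]
    have h5 : n = 0 := by
      rw [← Int.cast_abs] at h4
      exact Int.abs_lt_one_iff.1 (by exact_mod_cast h4)
    rw [hn, h5]; simp
  obtain ⟨M, hM⟩ := hK.isBounded.exists_norm_le
  set η := δ / 3 with hη
  have hηpos : 0 < η := by positivity
  have hre : ∀ z ∈ A, -M ≤ z.re ∧ z.re ≤ M := fun z hz ↦
    abs_le.1 ((Complex.abs_re_le_norm z).trans (hM z hz.1))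
  have key : ∀ j : ℕ, ∃ q u v : ℂ → ℂ, ∃ κ : ℂ, ExpRational K q ∧
      ContinuousOn u (K ∩ {z | c ≤ z.im}) ∧ ContinuousOn v (K ∩ {z | z.im ≤ c}) ∧
      (∀ z ∈ K ∩ {z | c ≤ z.im}, Complex.exp (u z) = q z) ∧
      (∀ z ∈ K ∩ {z | z.im ≤ c}, Complex.exp (v z) = q z) ∧ Complex.exp κ = 1 ∧
      (∀ z ∈ A, z.re ≤ -M - 1 + j * η → w z = v z - u z) ∧
      (∀ z ∈ A, -M - 1 + j * η - η ≤ z.re → v z - u z = κ) := by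
    intro j
    induction j with
    | zero =>
      refine ⟨_, 0, 0, 0, ExpRational.exp 0 continuousOn_const, continuousOn_const,
        continuousOn_const, fun _ _ ↦ rfl, fun _ _ ↦ rfl, Complex.exp_zero, fun z hz h ↦ ?_,
        fun z hz _ ↦ by simp⟩
      have := (hre z hz).1
      simp at h
      linarith
    | succ j ih =>
      obtain ⟨q, u, v, κ, hq, hu, hv, hu', hv', hκ, h1, h2⟩ := ih
      set t := -M - 1 + j * η with ht
      have ht' : -M - 1 + ((j + 1 : ℕ) : ℝ) * η = t + η := by push_cast; ring
      rw [ht', add_sub_cancel_right]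
      by_cases hcell : ∃ z1 ∈ A, t < z1.re ∧ z1.re ≤ t + η
      swap
      · push Not at hcell
        refine ⟨q, u, v, κ, hq, hu, hv, hu', hv', hκ, fun z hz h ↦ h1 z hz ?_,
          fun z hz h ↦ h2 z hz (by linarith)⟩
        by_contra hcon
        linarith [hcell z hz (not_le.1 hcon)]
      obtain ⟨z1, hz1, hz2, hz3⟩ := hcell
      by_cases hbase : ∃ z0 ∈ A, t - η ≤ z0.re ∧ z0.re ≤ t
      · obtain ⟨z0, hz0, hz4, hz5⟩ := hbase
        refine ⟨q, u, v, κ, hq, hu, hv, hu', hv', hκ, fun z hz h ↦ ?_,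
          fun z hz h ↦ h2 z hz (by linarith)⟩
        rcases le_or_gt z.re t with h3 | h3
        · exact h1 z hz h3
        · rw [hloc z hz z0 hz0 (by rw [abs_lt]; constructor <;> linarith), h1 z0 hz0 hz5,
            h2 z0 hz0 hz4, h2 z hz (by linarith)]
      push Not at hbase
      obtain ⟨k, hk⟩ := Complex.exp_eq_exp_iff_exists_int.1 ((hw1 z1 hz1).trans hκ.symm)
      set p : ℂ := ⟨t - η / 2, c⟩ with hp
      have hpK : p ∉ K := by
        intro h
        have := hbase p ⟨h, rfl⟩ (by simp [hp]; linarith)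
        simp [hp] at this
        linarith
      have hne : ∀ z ∈ K, z - p ≠ 0 := fun z hz ↦ sub_ne_zero.2 fun h ↦ hpK (h ▸ hz)
      have hleft : ∀ z ∈ A, z.re ≤ t → logDown (z - p) - logUp (z - p) =
          -(2 * Real.pi * Complex.I) := fun z hz h ↦ by
        refine logDown_sub_logUp_of_neg (by simp [hp, show z.im = c from hz.2]) ?_
        have : z.re < t - η := by
          by_contra hcon
          linarith [hbase z hz (not_lt.1 hcon)]
        simp [hp]; linarith
      have hright : ∀ z ∈ A, t ≤ z.re → logDown (z - p) - logUp (z - p) = 0 := fun z hz h ↦ by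
        refine logDown_sub_logUp_of_pos (by simp [hp, show z.im = c from hz.2]) ?_
        simp [hp]; linarith
      refine ⟨fun z ↦ q z * (z - p) ^ k, fun z ↦ u z + k * logUp (z - p),
        fun z ↦ v z + k * logDown (z - p) + k * (2 * Real.pi * Complex.I), w z1,
        hq.mul (ExpRational.zpow_sub hpK k), ?_, ?_, fun z hz ↦ ?_, fun z hz ↦ ?_, hw1 z1 hz1,
        fun z hz h ↦ ?_, fun z hz h ↦ ?_⟩
      · refine hu.add (continuousOn_const.mul (continuousOn_logUp.comp (by fun_prop) ?_))
        rintro z ⟨hz, hz'⟩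
        exact ⟨by simpa [hp] using hz', hne z hz⟩
      · refine (hv.add (continuousOn_const.mul (continuousOn_logDown.comp (by fun_prop) ?_))).add
          continuousOn_const
        rintro z ⟨hz, hz'⟩
        exact ⟨by simpa [hp] using hz', hne z hz⟩
      · simp only [Complex.exp_add, hu' z hz, Complex.exp_int_mul, exp_logUp (hne z hz.1)]
      · simp only [Complex.exp_add, hv' z hz, Complex.exp_int_mul, exp_logDown (hne z hz.1),
          Complex.exp_two_pi_mul_I, one_zpow, mul_one]
      · rcases le_or_gt z.re t with h3 | h3
        · linear_combination h1 z hz h3 - k * hleft z hz h3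
        · rw [hloc z hz z1 hz1 (by rw [abs_lt]; constructor <;> linarith)]
          linear_combination hk - h2 z hz (by linarith) - k * hright z hz h3.le
      · linear_combination -hk + h2 z hz (by linarith) + k * hright z hz h
  obtain ⟨j, hj⟩ := exists_nat_gt ((2 * M + 1) / η)
  rw [div_lt_iff₀ hηpos] at hj
  obtain ⟨q, u, v, κ, hq, hu, hv, hu', hv', hκ, h1, h2⟩ := key j
  exact ⟨q, u, v, hq, hu, hv, hu', hv', fun z hz ↦ h1 z hz (by linarith [(hre z hz).2])⟩

/-- Every nowhere vanishing continuous function on a compact plane set is, up to an exponential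
factor, a product of integer powers of `z - p` with `p` off the set. -/
theorem expRational_of_ne_zero {K : Set ℂ} (hK : IsCompact K) {h : ℂ → ℂ}
    (hh : ContinuousOn h K) (h0 : ∀ z ∈ K, h z ≠ 0) : ExpRational K h := by
  obtain ⟨δ, hδ, hstrip⟩ := exists_log_strip hK hh h0
  obtain ⟨M, hM⟩ := hK.isBounded.exists_norm_le
  have him : ∀ z ∈ K, -M ≤ z.im ∧ z.im ≤ M := fun z hz ↦
    abs_le.1 ((Complex.abs_im_le_norm z).trans (hM z hz))
  have key : ∀ j : ℕ, ∃ q u v : ℂ → ℂ, ExpRational K q ∧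
      ContinuousOn u (K ∩ {z | -M - 1 + j * δ ≤ z.im}) ∧
      (∀ z ∈ K ∩ {z | -M - 1 + j * δ ≤ z.im}, Complex.exp (u z) = q z) ∧
      ContinuousOn v (K ∩ {z | z.im ≤ -M - 1 + j * δ}) ∧
      (∀ z ∈ K ∩ {z | z.im ≤ -M - 1 + j * δ}, Complex.exp (v z) * q z = h z) := by
    intro j
    induction j with
    | zero =>
      have : K ∩ {z | z.im ≤ -M - 1 + (0 : ℕ) * δ} = ∅ := by
        ext z
        simp only [mem_inter_iff, mem_ofPred_eq, mem_empty_iff_false, iff_false, not_and, not_le]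
        intro hz
        have := (him z hz).1
        simp
        linarith
      refine ⟨_, 0, 0, ExpRational.exp 0 continuousOn_const, continuousOn_const,
        fun _ _ ↦ rfl, continuousOn_const, fun z hz ↦ ?_⟩
      rw [this] at hz
      exact hz.elim
    | succ j ih =>
      obtain ⟨q, u, v, hq, hu, hu', hv, hv'⟩ := ih
      set t := -M - 1 + j * δ with ht
      have ht' : -M - 1 + ((j + 1 : ℕ) : ℝ) * δ = t + δ := by push_cast; ring
      rw [ht']
      obtain ⟨s, hs, hs'⟩ := hstrip t
      obtain ⟨hqc, hq0⟩ := hq.continuousOn_and_ne_zero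
      -- on the line `v` and `s - u` are two logarithms of `h / q`
      obtain ⟨p, u₁, v₁, hp, hu₁, hv₁, hu₁', hv₁', hw⟩ :=
        exists_expRational_of_line hK t (w := fun z ↦ v z - (s z - u z))
        ((hv.mono fun z hz ↦ ⟨hz.1, hz.2.le⟩).sub
          ((hs.mono fun z hz ↦ ⟨hz.1, hz.2.ge, by rw [hz.2]; linarith⟩).sub
          (hu.mono fun z hz ↦ ⟨hz.1, hz.2.ge⟩))) (by
          rintro z ⟨hz, hz'⟩
          have e1 := hv' z ⟨hz, le_of_eq hz'⟩
          have e2 := hs' z ⟨hz, ge_of_eq hz', (le_of_eq hz').trans (by linarith)⟩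
          have e3 := hu' z ⟨hz, ge_of_eq hz'⟩
          rw [Complex.exp_sub, Complex.exp_sub, e2, e3, ← e1, mul_div_cancel_right₀ _ (hq0 z hz),
            div_self (Complex.exp_ne_zero _)])
      have hpc := hp.continuousOn_and_ne_zero
      classical
      set K1 := K ∩ {z : ℂ | z.im ≤ t} with hK1
      set K2 := K ∩ {z : ℂ | t ≤ z.im ∧ z.im ≤ t + δ} with hK2
      have hK1c : IsClosed K1 := hK.isClosed.inter (isClosed_le Complex.continuous_im continuous_const)
      have hK2c : IsClosed K2 := hK.isClosed.inter
        ((isClosed_le continuous_const Complex.continuous_im).inter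
          (isClosed_le Complex.continuous_im continuous_const))
      have hsub : K ∩ {z | z.im ≤ t + δ} ⊆ K1 ∪ K2 := by
        rintro z ⟨hz, hz'⟩
        rcases le_total z.im t with h | h
        · exact Or.inl ⟨hz, h⟩
        · exact Or.inr ⟨hz, h, hz'⟩
      set V : ℂ → ℂ := fun z ↦ if z.im ≤ t then v z - v₁ z else s z - u z - u₁ z with hV
      have hV1 : EqOn V (fun z ↦ v z - v₁ z) K1 := fun z hz ↦ if_pos hz.2
      have hV2 : EqOn V (fun z ↦ s z - u z - u₁ z) K2 := by
        rintro z ⟨hz, hz', hz''⟩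
        simp only [hV]
        split_ifs with h
        · have := hw z ⟨hz, le_antisymm h hz'⟩
          linear_combination this
        · rfl
      refine ⟨fun z ↦ q z * p z, fun z ↦ u z + u₁ z, V, hq.mul hp, ?_, ?_, ?_, ?_⟩
      · have : K ∩ {z : ℂ | t + δ ≤ z.im} ⊆ K ∩ {z : ℂ | t ≤ z.im} := fun z hz ↦
          ⟨hz.1, (by linarith : t ≤ t + δ).trans hz.2⟩
        exact (hu.mono this).add (hu₁.mono this)
      · rintro z ⟨hz, hz'⟩
        have h3 : t ≤ z.im := (by linarith : t ≤ t + δ).trans hz'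
        rw [Complex.exp_add, hu' z ⟨hz, h3⟩, hu₁' z ⟨hz, h3⟩]
      · refine ContinuousOn.mono (ContinuousOn.union_of_isClosed ?_ ?_ hK1c hK2c) hsub
        · exact (hv.sub hv₁).congr hV1
        · exact ((hs.sub (hu.mono fun z hz ↦ ⟨hz.1, hz.2.1⟩)).sub
            (hu₁.mono fun z hz ↦ ⟨hz.1, hz.2.1⟩)).congr hV2
      · intro z hz
        have hp0 := hpc.2 z hz.1
        have hq0 := hq0 z hz.1
        rcases hsub hz with h | h
        · rw [hV1 h]
          simp only []
          rw [Complex.exp_sub, hv₁' z h, ← hv' z h]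
          field_simp
        · rw [hV2 h]
          simp only []
          rw [Complex.exp_sub, Complex.exp_sub, hu₁' z ⟨h.1, h.2.1⟩, hu' z ⟨h.1, h.2.1⟩, hs' z h]
          field_simp
  obtain ⟨j, hj⟩ := exists_nat_gt ((2 * M + 1) / δ)
  rw [div_lt_iff₀ hδ] at hj
  obtain ⟨q, u, v, hq, hu, hu', hv, hv'⟩ := key j
  have hle : ∀ z ∈ K, z ∈ K ∩ {z : ℂ | z.im ≤ -M - 1 + j * δ} := fun z hz ↦
    ⟨hz, by have := (him z hz).2; simp only [mem_ofPred_eq]; linarith⟩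
  exact ((ExpRational.exp v (hv.mono hle)).mul hq).congr fun z hz ↦ hv' z (hle z hz)

end

section

/-- A closed curve in four sides: `B` then `R`, against `L` then `T`. -/
structure Quad where
  B : ℝ → ℂ
  R : ℝ → ℂ
  T : ℝ → ℂ
  L : ℝ → ℂ
  contB : ContinuousOn B (Icc 0 1)
  contR : ContinuousOn R (Icc 0 1)
  contT : ContinuousOn T (Icc 0 1)
  contL : ContinuousOn L (Icc 0 1)
  B_zero : B 0 = L 0
  B_one : B 1 = R 0
  T_zero : T 0 = L 1
  T_one : T 1 = R 1

namespace Quad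

def trace (Q : Quad) : Set ℂ :=
  Q.B '' Icc 0 1 ∪ Q.R '' Icc 0 1 ∪ Q.T '' Icc 0 1 ∪ Q.L '' Icc 0 1

/-- Variation of `log h` around the quad. -/
def qvar (Q : Quad) (h : ℂ → ℂ) : ℂ :=
  lvar (fun s ↦ h (Q.B s)) 0 1 + lvar (fun s ↦ h (Q.R s)) 0 1
    - lvar (fun s ↦ h (Q.T s)) 0 1 - lvar (fun s ↦ h (Q.L s)) 0 1

/-- `2πi` times the winding number. -/
def wind (Q : Quad) (p : ℂ) : ℂ := Q.qvar (fun z ↦ z - p)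

variable (Q : Quad) {K : Set ℂ} {h g : ℂ → ℂ}

lemma mapsTo_B : MapsTo Q.B (Icc 0 1) Q.trace := fun _ hs ↦
  Or.inl (Or.inl (Or.inl (mem_image_of_mem _ hs)))
lemma mapsTo_R : MapsTo Q.R (Icc 0 1) Q.trace := fun _ hs ↦
  Or.inl (Or.inl (Or.inr (mem_image_of_mem _ hs)))
lemma mapsTo_T : MapsTo Q.T (Icc 0 1) Q.trace := fun _ hs ↦
  Or.inl (Or.inr (mem_image_of_mem _ hs))
lemma mapsTo_L : MapsTo Q.L (Icc 0 1) Q.trace := fun _ hs ↦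
  Or.inr (mem_image_of_mem _ hs)

lemma trace_subset_iff {A : Set ℂ} : Q.trace ⊆ A ↔ MapsTo Q.B (Icc 0 1) A ∧
    MapsTo Q.R (Icc 0 1) A ∧ MapsTo Q.T (Icc 0 1) A ∧ MapsTo Q.L (Icc 0 1) A := by
  simp only [trace, union_subset_iff, and_assoc, mapsTo_iff_image_subset]

lemma isCompact_trace : IsCompact Q.trace :=
  (((isCompact_Icc.image_of_continuousOn Q.contB).union
    (isCompact_Icc.image_of_continuousOn Q.contR)).union
    (isCompact_Icc.image_of_continuousOn Q.contT)).union
    (isCompact_Icc.image_of_continuousOn Q.contL)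

lemma isClosed_trace : IsClosed Q.trace := Q.isCompact_trace.isClosed

lemma qvar_congr (hg : EqOn h g Q.trace) : Q.qvar h = Q.qvar g := by
  unfold qvar
  rw [lvar_congr (fun s hs ↦ hg (Q.mapsTo_B hs)), lvar_congr (fun s hs ↦ hg (Q.mapsTo_R hs)),
    lvar_congr (fun s hs ↦ hg (Q.mapsTo_T hs)), lvar_congr (fun s hs ↦ hg (Q.mapsTo_L hs))]

lemma qvar_exp {u : ℂ → ℂ} (hu : ContinuousOn u Q.trace) :
    Q.qvar (fun z ↦ Complex.exp (u z)) = 0 := by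
  unfold qvar
  have key : ∀ {X : ℝ → ℂ}, ContinuousOn X (Icc 0 1) → MapsTo X (Icc 0 1) Q.trace →
      lvar (fun s ↦ Complex.exp (u (X s))) 0 1 = u (X 1) - u (X 0) := fun hX hm ↦
    lvar_eq zero_le_one (hu.comp hX hm) (fun _ _ ↦ rfl)
  rw [key Q.contB Q.mapsTo_B, key Q.contR Q.mapsTo_R, key Q.contT Q.mapsTo_T,
    key Q.contL Q.mapsTo_L]
  simp only [Q.B_zero, Q.B_one, Q.T_zero, Q.T_one]
  ring

lemma qvar_mul (hh : ContinuousOn h Q.trace) (hh0 : ∀ z ∈ Q.trace, h z ≠ 0)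
    (hg : ContinuousOn g Q.trace) (hg0 : ∀ z ∈ Q.trace, g z ≠ 0) :
    Q.qvar (fun z ↦ h z * g z) = Q.qvar h + Q.qvar g := by
  have key : ∀ {X : ℝ → ℂ}, ContinuousOn X (Icc 0 1) → MapsTo X (Icc 0 1) Q.trace →
      lvar (fun s ↦ h (X s) * g (X s)) 0 1 =
        lvar (fun s ↦ h (X s)) 0 1 + lvar (fun s ↦ g (X s)) 0 1 := fun hX hm ↦
    lvar_mul zero_le_one (hh.comp hX hm) (fun t ht ↦ hh0 _ (hm ht)) (hg.comp hX hm)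
      (fun t ht ↦ hg0 _ (hm ht))
  unfold qvar
  rw [key Q.contB Q.mapsTo_B, key Q.contR Q.mapsTo_R, key Q.contT Q.mapsTo_T,
    key Q.contL Q.mapsTo_L]
  ring

lemma sub_ne_zero_of_notMem {A : Set ℂ} {p : ℂ} (hp : p ∉ A) : ∀ z ∈ A, z - p ≠ 0 :=
  fun _ hz ↦ sub_ne_zero.2 fun h ↦ hp (h ▸ hz)

theorem qvar_eq_zero (hK : IsCompact K) (hQ : Q.trace ⊆ K) (hw : ∀ p ∉ K, Q.wind p = 0)
    (hh : ContinuousOn h K) (h0 : ∀ z ∈ K, h z ≠ 0) : Q.qvar h = 0 := by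
  have := expRational_of_ne_zero hK hh h0
  clear hh h0
  induction this with
  | exp u hu => exact Q.qvar_exp (hu.mono hQ)
  | sub p hp => exact hw p hp
  | inv_sub p hp =>
    have hne := sub_ne_zero_of_notMem hp
    have h1 := Q.qvar_mul (h := fun z ↦ z - p) (g := fun z ↦ (z - p)⁻¹) (by fun_prop)
      (fun z hz ↦ hne z (hQ hz)) (ContinuousOn.inv₀ (by fun_prop) (fun z hz ↦ hne z (hQ hz)))
      (fun z hz ↦ inv_ne_zero (hne z (hQ hz)))
    have h2 : Q.qvar (fun z ↦ (z - p) * (z - p)⁻¹) = 0 := by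
      rw [← Q.qvar_exp (u := 0) continuousOn_const]
      exact Q.qvar_congr fun z hz ↦ by simp [mul_inv_cancel₀ (hne z (hQ hz))]
    have h3 : Q.qvar (fun z ↦ z - p) = 0 := hw p hp
    rw [h2, h3, zero_add] at h1
    exact h1.symm
  | mul hf hg ih1 ih2 =>
    have hf := hf.continuousOn_and_ne_zero
    have hg := hg.continuousOn_and_ne_zero
    rw [Q.qvar_mul (hf.1.mono hQ) (fun z hz ↦ hf.2 z (hQ hz)) (hg.1.mono hQ)
      (fun z hz ↦ hg.2 z (hQ hz)), ih1, ih2, add_zero]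
  | congr _ h ih => exact (Q.qvar_congr (h.symm.mono hQ)).trans ih

lemma exists_wind_ne_zero (hh : ContinuousOn h Q.trace) (h0 : ∀ z ∈ Q.trace, h z ≠ 0)
    (hne : Q.qvar h ≠ 0) : ∃ p ∉ Q.trace, Q.wind p ≠ 0 := by
  by_contra! hcon
  exact hne (Q.qvar_eq_zero Q.isCompact_trace subset_rfl hcon hh h0)

lemma wind_eq_of_path {γ : ℝ → ℂ} {a b : ℝ} (hab : a ≤ b) (hγ : ContinuousOn γ (Icc a b))
    (hd : ∀ t ∈ Icc a b, γ t ∉ Q.trace) : Q.wind (γ a) = Q.wind (γ b) := by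
  have key : ∀ {X : ℝ → ℂ}, ContinuousOn X (Icc 0 1) → MapsTo X (Icc 0 1) Q.trace →
      lvar (fun s ↦ X s - γ a) 0 1 + lvar (fun t ↦ X 1 - γ t) a b =
        lvar (fun s ↦ X s - γ b) 0 1 + lvar (fun t ↦ X 0 - γ t) a b := fun {X} hX hm ↦
    lvar_square (D := fun s t ↦ X s - γ t) zero_le_one hab
      ((hX.comp continuousOn_fst fun p hp ↦ hp.1).sub
        (hγ.comp continuousOn_snd fun p hp ↦ hp.2))
      fun s hs t ht ↦ sub_ne_zero_of_notMem (hd t ht) _ (hm hs)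
  have hB := key Q.contB Q.mapsTo_B
  have hR := key Q.contR Q.mapsTo_R
  have hT := key Q.contT Q.mapsTo_T
  have hL := key Q.contL Q.mapsTo_L
  rw [Q.B_zero, Q.B_one] at hB
  rw [Q.T_zero, Q.T_one] at hT
  unfold wind qvar
  linear_combination hB + hR - hT - hL

lemma wind_eq_of_joinedIn {p q : ℂ} (h : JoinedIn Q.traceᶜ p q) : Q.wind p = Q.wind q := by
  obtain ⟨γ, hγ⟩ := h
  have := Q.wind_eq_of_path (γ := γ.extend) zero_le_one γ.continuous_extend.continuousOn
    (fun t ht ↦ by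
      have : γ.extend t = γ ⟨t, ht⟩ := γ.extend_apply ht
      rw [this]; exact hγ _)
  simpa using this

lemma isOpen_wind (P : ℂ → Prop) : IsOpen {p | p ∉ Q.trace ∧ P (Q.wind p)} := by
  rw [Metric.isOpen_iff]
  rintro p ⟨hp, hP⟩
  obtain ⟨ε, hε, hb⟩ := Metric.isOpen_iff.1 Q.isClosed_trace.isOpen_compl p hp
  refine ⟨ε, hε, fun q hq ↦ ⟨hb hq, ?_⟩⟩
  have hpc : IsPathConnected (Metric.ball p ε) :=
    (convex_ball p ε).isPathConnected ⟨p, Metric.mem_ball_self hε⟩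
  rwa [Q.wind_eq_of_joinedIn ((hpc.joinedIn q hq p (Metric.mem_ball_self hε)).mono hb)]

lemma wind_eq_zero_of_norm_le {e : ℂ} (he : e ∉ Q.trace) (hle : ∀ z ∈ Q.trace, ‖z‖ ≤ ‖e‖) :
    Q.wind e = 0 := by
  have he0 : e ≠ 0 := by
    rintro rfl
    have h1 := Q.mapsTo_B (left_mem_Icc.2 zero_le_one)
    have h2 := hle _ h1
    rw [norm_zero, norm_le_zero_iff] at h2
    exact he (h2 ▸ h1)
  have hre : ∀ z ∈ Q.trace, 0 < (1 - z / e).re := by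
    intro z hz
    have h1 : ‖z / e‖ ≤ 1 := by
      rw [norm_div]; exact div_le_one_of_le₀ (hle z hz) (norm_nonneg _)
    have h2 : z / e ≠ 1 := by
      rw [Ne, div_eq_one_iff_eq he0]; rintro rfl; exact he hz
    have h3 := (le_abs_self _).trans ((Complex.abs_re_le_norm (z / e)).trans h1)
    rcases h3.lt_or_eq with h | h
    · simpa using h
    · exfalso
      apply h2
      have h4 : ‖z / e‖ ^ 2 ≤ 1 := by nlinarith [norm_nonneg (z / e)]
      rw [Complex.sq_norm, Complex.normSq_apply, h] at h4
      have h5 : (z / e).im = 0 := by nlinarith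
      exact Complex.ext h (by simpa using h5)
  rw [wind, Q.qvar_congr (g := fun z ↦ Complex.exp (Complex.log (-e) + Complex.log (1 - z / e)))]
  · refine Q.qvar_exp (continuousOn_const.add (ContinuousOn.clog (by fun_prop) fun z hz ↦ ?_))
    exact Complex.mem_slitPlane_iff.2 (Or.inl (hre z hz))
  · intro z hz
    simp only []
    rw [Complex.exp_add, Complex.exp_log (neg_ne_zero.2 he0), Complex.exp_log]
    · field_simp; ring
    · intro h; have := hre z hz; rw [h] at this; simp at this

/-- The curve together with all points it winds around. -/
def hull : Set ℂ := Q.trace ∪ {p | Q.wind p ≠ 0}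

lemma trace_subset_hull : Q.trace ⊆ Q.hull := subset_union_left

lemma isCompact_hull : IsCompact Q.hull := by
  have hc : IsClosed Q.hull := by
    rw [← isOpen_compl_iff]
    convert Q.isOpen_wind (fun w ↦ w = 0) using 1
    ext p; simp [hull]
  obtain ⟨M, hM⟩ := Q.isCompact_trace.isBounded.exists_norm_le
  refine Metric.isCompact_of_isClosed_isBounded hc
    (isBounded_iff_forall_norm_le.2 ⟨M, fun p hp ↦ ?_⟩)
  rcases hp with hp | hp
  · exact hM p hp
  · by_contra hcon
    rw [not_le] at hcon
    exact hp (Q.wind_eq_zero_of_norm_le (fun h ↦ (hM p h).not_gt hcon)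
      (fun z hz ↦ (hM z hz).trans hcon.le))

/-- The image of a quad under a map continuous on its trace. -/
def map (Φ : ℂ → ℂ) (hΦ : ContinuousOn Φ Q.trace) : Quad where
  B := Φ ∘ Q.B
  R := Φ ∘ Q.R
  T := Φ ∘ Q.T
  L := Φ ∘ Q.L
  contB := hΦ.comp Q.contB Q.mapsTo_B
  contR := hΦ.comp Q.contR Q.mapsTo_R
  contT := hΦ.comp Q.contT Q.mapsTo_T
  contL := hΦ.comp Q.contL Q.mapsTo_L
  B_zero := congrArg Φ Q.B_zero
  B_one := congrArg Φ Q.B_one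
  T_zero := congrArg Φ Q.T_zero
  T_one := congrArg Φ Q.T_one

end Quad

lemma exists_leftInvOn_continuousOn {X Y : Type*} [TopologicalSpace X] [TopologicalSpace Y]
    [T2Space Y] {s : Set X} {f : X → Y} (hs : IsCompact s) (hf : ContinuousOn f s)
    (hi : InjOn f s) (hne : s.Nonempty) :
    ∃ g : Y → X, ContinuousOn g (f '' s) ∧ ∀ x ∈ s, g (f x) = x := by
  have : Nonempty X := hne.to_type
  refine ⟨invFunOn f s, ?_, fun x hx ↦ hi.leftInvOn_invFunOn hx⟩
  rw [continuousOn_iff_isClosed]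
  intro t ht
  refine ⟨f '' (s ∩ t), ((hs.inter_right ht).image_of_continuousOn
    (hf.mono inter_subset_left)).isClosed, ?_⟩
  ext y
  constructor
  · rintro ⟨h1, x, hx, rfl⟩
    rw [mem_preimage, hi.leftInvOn_invFunOn hx] at h1
    exact ⟨mem_image_of_mem _ ⟨hx, h1⟩, mem_image_of_mem _ hx⟩
  · rintro ⟨⟨x, ⟨hx, hxt⟩, rfl⟩, h2⟩
    refine ⟨?_, h2⟩
    rw [mem_preimage, hi.leftInvOn_invFunOn hx]
    exact hxt

/-- The quad of two arcs with common endpoints. -/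
def biarc (B T : ℝ → ℂ) (hB : ContinuousOn B (Icc 0 1)) (hT : ContinuousOn T (Icc 0 1))
    (h0 : B 0 = T 0) (h1 : B 1 = T 1) : Quad where
  B := B
  R := fun _ ↦ B 1
  T := T
  L := fun _ ↦ B 0
  contB := hB
  contR := continuousOn_const
  contT := hT
  contL := continuousOn_const
  B_zero := rfl
  B_one := rfl
  T_zero := h0.symm
  T_one := h1.symm

lemma biarc_trace {B T : ℝ → ℂ} (hB : ContinuousOn B (Icc 0 1)) (hT : ContinuousOn T (Icc 0 1))
    (h0 : B 0 = T 0) (h1 : B 1 = T 1) :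
    (biarc B T hB hT h0 h1).trace = B '' Icc 0 1 ∪ T '' Icc 0 1 := by
  have e0 : B 0 ∈ B '' Icc 0 1 := mem_image_of_mem _ (left_mem_Icc.2 zero_le_one)
  have e1 : B 1 ∈ B '' Icc 0 1 := mem_image_of_mem _ (right_mem_Icc.2 zero_le_one)
  apply Subset.antisymm
  · rw [Quad.trace_subset_iff]
    exact ⟨fun s hs ↦ Or.inl (mem_image_of_mem _ hs), fun s hs ↦ Or.inl e1,
      fun s hs ↦ Or.inr (mem_image_of_mem _ hs), fun s hs ↦ Or.inl e0⟩
  · refine union_subset ?_ ?_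
    · exact mapsTo_iff_image_subset.1 (biarc B T hB hT h0 h1).mapsTo_B
    · exact mapsTo_iff_image_subset.1 (biarc B T hB hT h0 h1).mapsTo_T

/-- A Jordan curve winds around some point of its complement. -/
theorem exists_wind_biarc_ne_zero {B T : ℝ → ℂ} (hB : ContinuousOn B (Icc 0 1))
    (hT : ContinuousOn T (Icc 0 1)) (h0 : B 0 = T 0) (h1 : B 1 = T 1)
    (hBi : InjOn B (Icc 0 1)) (hTi : InjOn T (Icc 0 1))
    (hd : ∀ s ∈ Icc (0 : ℝ) 1, ∀ t ∈ Icc (0 : ℝ) 1, B s = T t → s = t ∧ (s = 0 ∨ s = 1)) :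
    ∃ p ∉ B '' Icc 0 1 ∪ T '' Icc 0 1, (biarc B T hB hT h0 h1).wind p ≠ 0 := by
  rw [← biarc_trace hB hT h0 h1]
  have hne : (Icc (0 : ℝ) 1).Nonempty := ⟨0, left_mem_Icc.2 zero_le_one⟩
  obtain ⟨b, hb, hb'⟩ := exists_leftInvOn_continuousOn isCompact_Icc hB hBi hne
  obtain ⟨t, ht, ht'⟩ := exists_leftInvOn_continuousOn isCompact_Icc hT hTi hne
  classical
  set h : ℂ → ℂ := fun z ↦ if z ∈ B '' Icc 0 1 then Complex.exp (b z * (Real.pi * Complex.I))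
    else Complex.exp (-(t z * (Real.pi * Complex.I))) with hh
  have hhB : EqOn h (fun z ↦ Complex.exp (b z * (Real.pi * Complex.I))) (B '' Icc 0 1) :=
    fun z hz ↦ if_pos hz
  have hhT : EqOn h (fun z ↦ Complex.exp (-(t z * (Real.pi * Complex.I)))) (T '' Icc 0 1) := by
    rintro _ ⟨s, hs, rfl⟩
    by_cases hz : T s ∈ B '' Icc 0 1
    · rw [hhB hz]
      simp only []
      obtain ⟨r, hr, hrs⟩ := hz
      obtain ⟨rfl, h01⟩ := hd r hr s hs hrs
      rw [ht' r hs, ← hrs, hb' r hr]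
      rcases h01 with rfl | rfl
      · simp
      · simp [Complex.exp_neg, Complex.exp_pi_mul_I]
    · exact if_neg hz
  refine (biarc B T hB hT h0 h1).exists_wind_ne_zero (h := h) ?_ (fun z _ ↦ ?_) ?_
  · rw [biarc_trace]
    refine ContinuousOn.union_of_isClosed ?_ ?_
      (isCompact_Icc.image_of_continuousOn hB).isClosed
      (isCompact_Icc.image_of_continuousOn hT).isClosed
    · exact ContinuousOn.congr (by fun_prop) hhB
    · exact ContinuousOn.congr (by fun_prop) hhT
  · simp only [hh]; split_ifs <;> exact Complex.exp_ne_zero _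
  · have e1 : lvar (fun s ↦ h (B s)) 0 1 = Real.pi * Complex.I := by
      rw [lvar_eq (u := fun s ↦ s * (Real.pi * Complex.I)) zero_le_one (by fun_prop)
        (fun s hs ↦ by simp only [hhB (mem_image_of_mem _ hs), hb' s hs])]
      simp
    have e2 : lvar (fun s ↦ h (T s)) 0 1 = -(Real.pi * Complex.I) := by
      rw [lvar_eq (u := fun s ↦ -(s * (Real.pi * Complex.I))) zero_le_one (by fun_prop)
        (fun s hs ↦ by simp only [hhT (mem_image_of_mem _ hs), ht' s hs])]
      simp
    have hz : ∀ z, h z ≠ 0 := fun z ↦ by simp only [hh]; split_ifs <;> exact Complex.exp_ne_zero _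
    change lvar (fun s ↦ h (B s)) 0 1 + lvar (fun s ↦ h (B 1)) 0 1 - lvar (fun s ↦ h (T s)) 0 1
      - lvar (fun s ↦ h (B 0)) 0 1 ≠ 0
    rw [e1, e2, lvar_const (hz _) zero_le_one, lvar_const (hz _) zero_le_one]
    have : (Real.pi : ℂ) ≠ 0 := by exact_mod_cast Real.pi_ne_zero
    have h2 : (2 : ℂ) * (Real.pi * Complex.I) ≠ 0 := by simp [this]
    convert h2 using 1; ring

end

lemma zero_mem_I : (0 : ℝ) ∈ Icc (0 : ℝ) 1 := left_mem_Icc.2 zero_le_one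
lemma one_mem_I : (1 : ℝ) ∈ Icc (0 : ℝ) 1 := right_mem_Icc.2 zero_le_one

/-- The boundary of the image of the unit square. -/
def rectQuad (k : ℝ × ℝ → ℂ) (hk : ContinuousOn k (Icc 0 1 ×ˢ Icc 0 1)) : Quad where
  B := fun s ↦ k (s, 0)
  R := fun s ↦ k (1, s)
  T := fun s ↦ k (s, 1)
  L := fun s ↦ k (0, s)
  contB := hk.comp (by fun_prop) fun s hs ↦ ⟨hs, zero_mem_I⟩
  contR := hk.comp (by fun_prop) fun s hs ↦ ⟨one_mem_I, hs⟩
  contT := hk.comp (by fun_prop) fun s hs ↦ ⟨hs, one_mem_I⟩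
  contL := hk.comp (by fun_prop) fun s hs ↦ ⟨zero_mem_I, hs⟩
  B_zero := rfl
  B_one := rfl
  T_zero := rfl
  T_one := rfl

lemma rectQuad_trace {k : ℝ × ℝ → ℂ} (hk : ContinuousOn k (Icc 0 1 ×ˢ Icc 0 1)) :
    (rectQuad k hk).trace =
      k '' {x | x ∈ Icc (0 : ℝ) 1 ×ˢ Icc (0 : ℝ) 1 ∧ x ∉ Ioo (0 : ℝ) 1 ×ˢ Ioo (0 : ℝ) 1} := by
  apply Subset.antisymm
  · rw [Quad.trace_subset_iff]
    refine ⟨fun s hs ↦ ⟨(s, 0), ⟨⟨hs, zero_mem_I⟩, fun h ↦ ?_⟩, rfl⟩,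
      fun s hs ↦ ⟨(1, s), ⟨⟨one_mem_I, hs⟩, fun h ↦ ?_⟩, rfl⟩,
      fun s hs ↦ ⟨(s, 1), ⟨⟨hs, one_mem_I⟩, fun h ↦ ?_⟩, rfl⟩,
      fun s hs ↦ ⟨(0, s), ⟨⟨zero_mem_I, hs⟩, fun h ↦ ?_⟩, rfl⟩⟩
    · exact lt_irrefl _ h.2.1
    · exact lt_irrefl _ h.1.2
    · exact lt_irrefl _ h.2.2
    · exact lt_irrefl _ h.1.1
  · rintro _ ⟨⟨x, y⟩, ⟨⟨hx, hy⟩, h⟩, rfl⟩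
    simp only at hx hy
    by_cases h1 : x = 0
    · subst h1; exact (rectQuad k hk).mapsTo_L hy
    by_cases h2 : x = 1
    · subst h2; exact (rectQuad k hk).mapsTo_R hy
    by_cases h3 : y = 0
    · subst h3; exact (rectQuad k hk).mapsTo_B hx
    by_cases h4 : y = 1
    · subst h4; exact (rectQuad k hk).mapsTo_T hx
    exact (h ⟨⟨hx.1.lt_of_ne' h1, hx.2.lt_of_ne h2⟩, ⟨hy.1.lt_of_ne' h3, hy.2.lt_of_ne h4⟩⟩).elim

lemma rectQuad_qvar {k : ℝ × ℝ → ℂ} (hk : ContinuousOn k (Icc 0 1 ×ˢ Icc 0 1)) {h : ℂ → ℂ}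
    (hh : ContinuousOn h (k '' Icc 0 1 ×ˢ Icc 0 1)) (h0 : ∀ z ∈ k '' Icc 0 1 ×ˢ Icc 0 1, h z ≠ 0) :
    (rectQuad k hk).qvar h = 0 := by
  have := lvar_square (D := fun s t ↦ h (k (s, t))) (a := 0) (b := 1) (c := 0) (d := 1)
    zero_le_one zero_le_one (hh.comp hk (mapsTo_image _ _))
    (fun s hs t ht ↦ h0 _ (mem_image_of_mem _ ⟨hs, ht⟩))
  unfold Quad.qvar rectQuad
  linear_combination this

lemma rectQuad_wind_of_notMem {k : ℝ × ℝ → ℂ} (hk : ContinuousOn k (Icc 0 1 ×ˢ Icc 0 1)) {p : ℂ}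
    (hp : p ∉ k '' Icc 0 1 ×ˢ Icc 0 1) : (rectQuad k hk).wind p = 0 :=
  rectQuad_qvar hk (by fun_prop) (Quad.sub_ne_zero_of_notMem hp)

lemma lvar_quarter_turn {c j : ℂ} (hc : c ≠ 0) (him : j.im ≠ 0) {f : ℝ → ℂ}
    (hf : ∀ t ∈ Icc (0 : ℝ) 1, f t = c * (1 + t * (j - 1))) : lvar f 0 1 = Complex.log j := by
  have hslit : ∀ t : ℝ, 1 + t * (j - 1) ∈ Complex.slitPlane := fun t ↦ by
    rw [Complex.mem_slitPlane_iff]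
    rcases eq_or_ne t 0 with rfl | h
    · simp
    · right; simp [h, him]
  rw [lvar_eq (u := fun t ↦ Complex.log c + Complex.log (1 + t * (j - 1))) zero_le_one
    (continuousOn_const.add (ContinuousOn.clog (by fun_prop) fun t _ ↦ hslit t)) (fun t ht ↦ ?_)]
  · simp
  · rw [Complex.exp_add, Complex.exp_log hc, Complex.exp_log (Complex.slitPlane_ne_zero (hslit t)),
      hf t ht]

theorem rectQuad_wind_ne_zero {k : ℝ × ℝ → ℂ} (hk : ContinuousOn k (Icc 0 1 ×ˢ Icc 0 1))
    (hi : InjOn k (Icc 0 1 ×ˢ Icc 0 1)) {x : ℝ × ℝ} (hx : x ∈ Ioo (0 : ℝ) 1 ×ˢ Ioo (0 : ℝ) 1) :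
    (rectQuad k hk).wind (k x) ≠ 0 := by
  set Sq := Icc (0 : ℝ) 1 ×ˢ Icc (0 : ℝ) 1 with hSq
  obtain ⟨g, hg, hg'⟩ := exists_leftInvOn_continuousOn (isCompact_Icc.prod isCompact_Icc) hk hi
    ⟨(0, 0), zero_mem_I, zero_mem_I⟩
  have htr := rectQuad_trace hk
  have htrs : (rectQuad k hk).trace ⊆ k '' Sq := htr.subset.trans (image_mono fun x hx ↦ hx.1)
  set σ : ℝ × ℝ → ℂ := fun x ↦ ((x.1 - 1 / 2 : ℝ) : ℂ) + ((x.2 - 1 / 2 : ℝ) : ℂ) * Complex.I with hσ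
  have hσc : Continuous σ := by fun_prop
  have hσre : ∀ x, (σ x).re = x.1 - 1 / 2 := fun x ↦ by simp [hσ]
  have hσim : ∀ x, (σ x).im = x.2 - 1 / 2 := fun x ↦ by simp [hσ]
  obtain ⟨p, hp, hpw⟩ := (rectQuad k hk).exists_wind_ne_zero (h := fun z ↦ σ (g z))
    (hσc.comp_continuousOn (hg.mono htrs)) (by
      rw [htr]
      rintro _ ⟨y, ⟨hy, hy'⟩, rfl⟩ h0
      rw [hg' y hy] at h0
      have e1 : y.1 = 1 / 2 := by have := hσre y; rw [h0] at this; simp at this; linarith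
      have e2 : y.2 = 1 / 2 := by have := hσim y; rw [h0] at this; simp at this; linarith
      exact hy' ⟨by rw [e1]; norm_num, by rw [e2]; norm_num⟩) (by
      have e1 : lvar (fun s ↦ σ (g (k (s, 0)))) 0 1 = Complex.log (Complex.I) := by
        refine lvar_quarter_turn (c := σ (0, 0)) (fun h ↦ ?_) (by simp) fun s hs ↦ ?_
        · have := hσre (0, 0); rw [h] at this; norm_num at this
        · rw [hg' _ ⟨hs, zero_mem_I⟩]; apply Complex.ext <;> simp [hσ] <;> ring
      have e2 : lvar (fun s ↦ σ (g (k (1, s)))) 0 1 = Complex.log (Complex.I) := by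
        refine lvar_quarter_turn (c := σ (1, 0)) (fun h ↦ ?_) (by simp) fun s hs ↦ ?_
        · have := hσre (1, 0); rw [h] at this; norm_num at this
        · rw [hg' _ ⟨one_mem_I, hs⟩]; apply Complex.ext <;> simp [hσ] <;> ring
      have e3 : lvar (fun s ↦ σ (g (k (s, 1)))) 0 1 = Complex.log (-Complex.I) := by
        refine lvar_quarter_turn (c := σ (0, 1)) (fun h ↦ ?_) (by simp) fun s hs ↦ ?_
        · have := hσre (0, 1); rw [h] at this; norm_num at this
        · rw [hg' _ ⟨hs, one_mem_I⟩]; apply Complex.ext <;> simp [hσ] <;> ring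
      have e4 : lvar (fun s ↦ σ (g (k (0, s)))) 0 1 = Complex.log (-Complex.I) := by
        refine lvar_quarter_turn (c := σ (0, 0)) (fun h ↦ ?_) (by simp) fun s hs ↦ ?_
        · have := hσre (0, 0); rw [h] at this; norm_num at this
        · rw [hg' _ ⟨zero_mem_I, hs⟩]; apply Complex.ext <;> simp [hσ] <;> ring
      change lvar (fun s ↦ σ (g (k (s, 0)))) 0 1 + lvar (fun s ↦ σ (g (k (1, s)))) 0 1
        - lvar (fun s ↦ σ (g (k (s, 1)))) 0 1 - lvar (fun s ↦ σ (g (k (0, s)))) 0 1 ≠ 0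
      rw [e1, e2, e3, e4, Complex.log_I, Complex.log_neg_I]
      have : (Real.pi : ℂ) ≠ 0 := by exact_mod_cast Real.pi_ne_zero
      have h2 : (2 : ℂ) * (Real.pi * Complex.I) ≠ 0 := by simp [this]
      convert h2 using 1; ring)
  have hpk : p ∈ k '' Sq := by
    by_contra hcon
    exact hpw (rectQuad_wind_of_notMem hk hcon)
  obtain ⟨y, hy, rfl⟩ := hpk
  have hyint : y ∈ Ioo (0 : ℝ) 1 ×ˢ Ioo (0 : ℝ) 1 := by
    by_contra hcon
    exact hp (htr ▸ ⟨y, ⟨hy, hcon⟩, rfl⟩)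
  have hconv : Convex ℝ (Ioo (0 : ℝ) 1 ×ˢ Ioo (0 : ℝ) 1) := (convex_Ioo _ _).prod (convex_Ioo _ _)
  have hsub : Ioo (0 : ℝ) 1 ×ˢ Ioo (0 : ℝ) 1 ⊆ Sq := prod_mono Ioo_subset_Icc_self Ioo_subset_Icc_self
  obtain ⟨γ, hγ⟩ := (hconv.isPathConnected ⟨x, hx⟩).joinedIn x hx y hyint
  have := (rectQuad k hk).wind_eq_of_path (γ := fun t ↦ k (γ.extend t)) zero_le_one
    (hk.comp γ.continuous_extend.continuousOn fun t ht ↦ by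
      rw [γ.extend_apply ht]; exact hsub (hγ _)) (fun t ht ↦ by
      rw [htr, γ.extend_apply ht]
      rintro ⟨z, ⟨hz, hz'⟩, hzk⟩
      exact hz' (hi hz (hsub (hγ _)) hzk ▸ hγ _))
  simp only [Path.extend_zero, Path.extend_one] at this
  rwa [this]

/-- Variation of `log D` around the boundary of a rectangle. -/
def bvar (D : ℝ → ℝ → ℂ) (a b c d : ℝ) : ℂ :=
  lvar (fun s ↦ D s c) a b + lvar (fun t ↦ D b t) c d
    - lvar (fun s ↦ D s d) a b - lvar (fun t ↦ D a t) c d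

lemma bvar_eq_zero {D : ℝ → ℝ → ℂ} {a b c d : ℝ} (hab : a ≤ b) (hcd : c ≤ d)
    (hD : ContinuousOn (uncurry D) (Icc a b ×ˢ Icc c d))
    (h0 : ∀ s ∈ Icc a b, ∀ t ∈ Icc c d, D s t ≠ 0) : bvar D a b c d = 0 := by
  have := lvar_square hab hcd hD h0
  unfold bvar
  linear_combination this

lemma continuousOn_row {D : ℝ → ℝ → ℂ} {A B : Set ℝ} (hD : ContinuousOn (uncurry D) (A ×ˢ B))
    {t : ℝ} (ht : t ∈ B) : ContinuousOn (fun s ↦ D s t) A :=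
  hD.comp (f := fun s ↦ (s, t)) (by fun_prop) fun _ hs ↦ ⟨hs, ht⟩

lemma continuousOn_col {D : ℝ → ℝ → ℂ} {A B : Set ℝ} (hD : ContinuousOn (uncurry D) (A ×ˢ B))
    {s : ℝ} (hs : s ∈ A) : ContinuousOn (fun t ↦ D s t) B :=
  hD.comp (f := fun t ↦ (s, t)) (by fun_prop) fun _ ht ↦ ⟨hs, ht⟩

/-- The boundary variation localizes around an isolated zero. -/
lemma bvar_localize {D : ℝ → ℝ → ℂ} {a b c d s₀ t₀ s₁ s₂ t₁ t₂ : ℝ}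
    (hD : ContinuousOn (uncurry D) (Icc a b ×ˢ Icc c d))
    (h0 : ∀ s ∈ Icc a b, ∀ t ∈ Icc c d, D s t = 0 → s = s₀ ∧ t = t₀)
    (hs₁ : a ≤ s₁) (hs₁' : s₁ < s₀) (hs₂ : s₀ < s₂) (hs₂' : s₂ ≤ b)
    (ht₁ : c ≤ t₁) (ht₁' : t₁ < t₀) (ht₂ : t₀ < t₂) (ht₂' : t₂ ≤ d) :
    bvar D a b c d = bvar D s₁ s₂ t₁ t₂ := by
  have hc : c ∈ Icc c d := ⟨le_rfl, by linarith⟩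
  have hd : d ∈ Icc c d := ⟨by linarith, le_rfl⟩
  have row : ∀ t ∈ Icc c d, t ≠ t₀ → lvar (fun s ↦ D s t) a b =
      lvar (fun s ↦ D s t) a s₁ + lvar (fun s ↦ D s t) s₁ s₂ + lvar (fun s ↦ D s t) s₂ b := by
    intro t ht htt
    have h1 := continuousOn_row hD ht
    have h2 : ∀ s ∈ Icc a b, D s t ≠ 0 := fun s hs h ↦ htt (h0 s hs t ht h).2
    have h3 : Icc a s₂ ⊆ Icc a b := Icc_subset_Icc_right hs₂'
    rw [lvar_concat (by linarith) hs₂' h1 h2, lvar_concat hs₁ (by linarith) (h1.mono h3)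
      fun s hs ↦ h2 s (h3 hs)]
  have col : ∀ s ∈ Icc a b, s ≠ s₀ → lvar (fun t ↦ D s t) c d =
      lvar (fun t ↦ D s t) c t₁ + lvar (fun t ↦ D s t) t₁ t₂ + lvar (fun t ↦ D s t) t₂ d := by
    intro s hs hss
    have h1 := continuousOn_col hD hs
    have h2 : ∀ t ∈ Icc c d, D s t ≠ 0 := fun t ht h ↦ hss (h0 s hs t ht h).1
    have h3 : Icc c t₂ ⊆ Icc c d := Icc_subset_Icc_right ht₂'
    rw [lvar_concat (by linarith) ht₂' h1 h2, lvar_concat ht₁ (by linarith) (h1.mono h3)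
      fun s hs ↦ h2 s (h3 hs)]
  have zero : ∀ a' b' c' d' : ℝ, a ≤ a' → a' ≤ b' → b' ≤ b → c ≤ c' → c' ≤ d' → d' ≤ d →
      (s₀ ∉ Icc a' b' ∨ t₀ ∉ Icc c' d') → bvar D a' b' c' d' = 0 := by
    intro a' b' c' d' h1 h2 h3 h4 h5 h6 h7
    have e1 : Icc a' b' ⊆ Icc a b := Icc_subset_Icc h1 h3
    have e2 : Icc c' d' ⊆ Icc c d := Icc_subset_Icc h4 h6
    refine bvar_eq_zero h2 h5 (hD.mono (prod_mono e1 e2)) fun s hs t ht h ↦ ?_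
    obtain ⟨rfl, rfl⟩ := h0 s (e1 hs) t (e2 ht) h
    exact h7.elim (· hs) (· ht)
  have z1 := zero a s₁ c d le_rfl hs₁ (by linarith) le_rfl (by linarith) le_rfl
    (Or.inl fun h ↦ by linarith [h.2])
  have z2 := zero s₂ b c d (by linarith) hs₂' le_rfl le_rfl (by linarith) le_rfl
    (Or.inl fun h ↦ by linarith [h.1])
  have z3 := zero s₁ s₂ c t₁ hs₁ (by linarith) hs₂' le_rfl ht₁ (by linarith)
    (Or.inr fun h ↦ by linarith [h.2])
  have z4 := zero s₁ s₂ t₂ d hs₁ (by linarith) hs₂' (by linarith) ht₂' le_rfl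
    (Or.inr fun h ↦ by linarith [h.1])
  have r1 := row c hc (by linarith)
  have r2 := row d hd (by linarith)
  have c1 := col s₁ ⟨hs₁, by linarith⟩ (by linarith)
  have c2 := col s₂ ⟨by linarith, hs₂'⟩ (by linarith)
  unfold bvar at *
  linear_combination r1 - r2 + z1 + z2 + z3 + z4 + c2 - c1

lemma lvar_affine {f : ℝ → ℂ} {a b : ℝ} (hab : a ≤ b) (hf : ContinuousOn f (Icc a b))
    (h0 : ∀ t ∈ Icc a b, f t ≠ 0) : lvar (fun x ↦ f (a + x * (b - a))) 0 1 = lvar f a b := by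
  obtain ⟨u, hu, hu'⟩ := exists_log_Icc hab hf h0
  have hm : MapsTo (fun x : ℝ ↦ a + x * (b - a)) (Icc 0 1) (Icc a b) := fun x hx ↦
    ⟨by nlinarith [hx.1], by nlinarith [hx.2]⟩
  rw [lvar_eq hab hu hu', lvar_eq (u := fun x ↦ u (a + x * (b - a))) zero_le_one
    (hu.comp (by fun_prop) hm) fun t ht ↦ hu' _ (hm ht)]
  simp

namespace Quad

lemma sum_bvar (Q : Quad) {ρ : ℝ → ℂ} {a b : ℝ}
    (ha : ρ a ∉ Q.trace) (hb : ρ b ∉ Q.trace) :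
    bvar (fun s t ↦ ρ t - Q.B s) 0 1 a b + bvar (fun s t ↦ ρ t - Q.R s) 0 1 a b
      - bvar (fun s t ↦ ρ t - Q.T s) 0 1 a b - bvar (fun s t ↦ ρ t - Q.L s) 0 1 a b
      = Q.wind (ρ a) - Q.wind (ρ b) := by
  have key : ∀ {X : ℝ → ℂ}, ContinuousOn X (Icc 0 1) → MapsTo X (Icc 0 1) Q.trace →
      bvar (fun s t ↦ ρ t - X s) 0 1 a b = lvar (fun s ↦ X s - ρ a) 0 1 +
        lvar (fun t ↦ ρ t - X 1) a b - lvar (fun s ↦ X s - ρ b) 0 1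
        - lvar (fun t ↦ ρ t - X 0) a b := fun {X} hX hm ↦ by
    have h1 := lvar_sub_comm zero_le_one hX (continuousOn_const (c := ρ a))
      (fun t ht h ↦ ha (by rw [← h]; exact hm ht))
    have h2 := lvar_sub_comm zero_le_one hX (continuousOn_const (c := ρ b))
      (fun t ht h ↦ hb (by rw [← h]; exact hm ht))
    unfold bvar
    rw [h1, h2]
  rw [key Q.contB Q.mapsTo_B, key Q.contR Q.mapsTo_R, key Q.contT Q.mapsTo_T,
    key Q.contL Q.mapsTo_L, Q.B_zero, Q.B_one, Q.T_zero, Q.T_one]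
  unfold wind qvar
  ring

end Quad

/-- Two arcs crossing transversely at exactly one interior point have nonzero crossing number. -/
theorem bvar_ne_zero_of_transverse {α ρ : ℝ → ℂ} (hα : ContinuousOn α (Icc 0 1))
    (hρ : ContinuousOn ρ (Icc 0 1)) (hαi : InjOn α (Icc 0 1)) (hρi : InjOn ρ (Icc 0 1))
    {s₀ t₀ : ℝ} (hs₀ : s₀ ∈ Ioo (0 : ℝ) 1) (ht₀ : t₀ ∈ Ioo (0 : ℝ) 1)
    (h : ∀ s ∈ Icc (0 : ℝ) 1, ∀ t ∈ Icc (0 : ℝ) 1, α s = ρ t → s = s₀ ∧ t = t₀)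
    (heq : α s₀ = ρ t₀) {ε : ℝ} (hε : 0 < ε) {k : ℝ × ℝ → ℂ}
    (hk : ContinuousOn k (Icc (-ε) ε ×ˢ Icc (-ε) ε)) (hki : InjOn k (Icc (-ε) ε ×ˢ Icc (-ε) ε))
    (hαk : ∀ᶠ s in 𝓝 s₀, ∃ r ∈ Icc (-ε) ε, α s = k (r, 0))
    (hρk : ∀ᶠ t in 𝓝 t₀, ∃ q ∈ Icc (-ε) ε, ρ t = k (0, q)) :
    bvar (fun s t ↦ ρ t - α s) 0 1 0 1 ≠ 0 := by
  set Bx := Icc (-ε) ε ×ˢ Icc (-ε) ε with hBx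
  have hz : (0 : ℝ) ∈ Icc (-ε) ε := ⟨by linarith, hε.le⟩
  obtain ⟨g, hg, hg'⟩ := exists_leftInvOn_continuousOn (isCompact_Icc.prod isCompact_Icc) hk hki
    ⟨(0, 0), hz, hz⟩
  obtain ⟨δ, hδ, hb1, hb2, hb3, hb4⟩ : ∃ δ > 0, (∀ s ∈ Icc (s₀ - δ) (s₀ + δ), s ∈ Ioo (0 : ℝ) 1) ∧
      (∀ t ∈ Icc (t₀ - δ) (t₀ + δ), t ∈ Ioo (0 : ℝ) 1) ∧
      (∀ s ∈ Icc (s₀ - δ) (s₀ + δ), ∃ r ∈ Icc (-ε) ε, α s = k (r, 0)) ∧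
      (∀ t ∈ Icc (t₀ - δ) (t₀ + δ), ∃ q ∈ Icc (-ε) ε, ρ t = k (0, q)) := by
    obtain ⟨δ1, h1, h1'⟩ := Metric.nhds_basis_closedBall.eventually_iff.1
      (hαk.and (Ioo_mem_nhds hs₀.1 hs₀.2))
    obtain ⟨δ2, h2, h2'⟩ := Metric.nhds_basis_closedBall.eventually_iff.1
      (hρk.and (Ioo_mem_nhds ht₀.1 ht₀.2))
    simp only [Real.closedBall_eq_Icc] at h1' h2'
    have e1 := min_le_left δ1 δ2
    have e2 := min_le_right δ1 δ2
    have f1 : ∀ s ∈ Icc (s₀ - min δ1 δ2) (s₀ + min δ1 δ2), s ∈ Icc (s₀ - δ1) (s₀ + δ1) :=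
      fun s hs ↦ ⟨by linarith [hs.1], by linarith [hs.2]⟩
    have f2 : ∀ s ∈ Icc (t₀ - min δ1 δ2) (t₀ + min δ1 δ2), s ∈ Icc (t₀ - δ2) (t₀ + δ2) :=
      fun s hs ↦ ⟨by linarith [hs.1], by linarith [hs.2]⟩
    exact ⟨min δ1 δ2, lt_min h1 h2, fun s hs ↦ (h1' (f1 s hs)).2, fun s hs ↦ (h2' (f2 s hs)).2,
      fun s hs ↦ (h1' (f1 s hs)).1, fun s hs ↦ (h2' (f2 s hs)).1⟩
  obtain ⟨r, hr⟩ : ∃ r : ℝ → ℝ, r = fun s ↦ (g (α s)).1 := ⟨_, rfl⟩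
  obtain ⟨q, hq⟩ : ∃ q : ℝ → ℝ, q = fun t ↦ (g (ρ t)).2 := ⟨_, rfl⟩
  have hr' : ∀ s ∈ Icc (s₀ - δ) (s₀ + δ), r s ∈ Icc (-ε) ε ∧ α s = k (r s, 0) := fun s hs ↦ by
    obtain ⟨x, hx, hx'⟩ := hb3 s hs
    have : r s = x := by simp only [hr, hx', hg' (x, 0) ⟨hx, hz⟩]
    rw [this]; exact ⟨hx, hx'⟩
  have hq' : ∀ t ∈ Icc (t₀ - δ) (t₀ + δ), q t ∈ Icc (-ε) ε ∧ ρ t = k (0, q t) := fun s hs ↦ by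
    obtain ⟨x, hx, hx'⟩ := hb4 s hs
    have : q s = x := by simp only [hq, hx', hg' (0, x) ⟨hz, hx⟩]
    rw [this]; exact ⟨hx, hx'⟩
  have hsI : Icc (s₀ - δ) (s₀ + δ) ⊆ Icc 0 1 := fun s hs ↦ Ioo_subset_Icc_self (hb1 s hs)
  have htI : Icc (t₀ - δ) (t₀ + δ) ⊆ Icc 0 1 := fun s hs ↦ Ioo_subset_Icc_self (hb2 s hs)
  have hs₀m : s₀ ∈ Icc (s₀ - δ) (s₀ + δ) := ⟨by linarith, by linarith⟩
  have ht₀m : t₀ ∈ Icc (t₀ - δ) (t₀ + δ) := ⟨by linarith, by linarith⟩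
  have hrc : ContinuousOn r (Icc (s₀ - δ) (s₀ + δ)) :=
    hr ▸ continuous_fst.comp_continuousOn (hg.comp (hα.mono hsI) fun s hs ↦ by
      rw [(hr' s hs).2]; exact mem_image_of_mem _ ⟨(hr' s hs).1, hz⟩)
  have hqc : ContinuousOn q (Icc (t₀ - δ) (t₀ + δ)) :=
    hq ▸ continuous_snd.comp_continuousOn (hg.comp (hρ.mono htI) fun s hs ↦ by
      rw [(hq' s hs).2]; exact mem_image_of_mem _ ⟨hz, (hq' s hs).1⟩)
  have hri : InjOn r (Icc (s₀ - δ) (s₀ + δ)) := fun s hs s' hs' hss ↦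
    hαi (hsI hs) (hsI hs') (by rw [(hr' s hs).2, (hr' s' hs').2, hss])
  have hqi : InjOn q (Icc (t₀ - δ) (t₀ + δ)) := fun s hs s' hs' hss ↦
    hρi (htI hs) (htI hs') (by rw [(hq' s hs).2, (hq' s' hs').2, hss])
  obtain ⟨hr0, hq0⟩ : r s₀ = 0 ∧ q t₀ = 0 := by
    have h0 : k (r s₀, 0) = k (0, q t₀) := by
      rw [← (hr' s₀ hs₀m).2, ← (hq' t₀ ht₀m).2, heq]
    have m1 : (r s₀, (0 : ℝ)) ∈ Bx := ⟨(hr' s₀ hs₀m).1, hz⟩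
    have m2 : ((0 : ℝ), q t₀) ∈ Bx := ⟨hz, (hq' t₀ ht₀m).1⟩
    have h1 := hki m1 m2 h0
    exact ⟨congrArg Prod.fst h1, (congrArg Prod.snd h1).symm⟩
  -- three parameters `t₁ < t₀ < t₃ < t₂`
  set t₁ := t₀ - δ with ht₁
  set t₂ := t₀ + δ with ht₂
  set t₃ := t₀ + δ / 2 with ht₃
  have m1 : t₁ ∈ Icc t₁ t₂ := ⟨le_rfl, by linarith⟩
  have m2 : t₂ ∈ Icc t₁ t₂ := ⟨by linarith, le_rfl⟩
  have m3 : t₃ ∈ Icc t₁ t₂ := ⟨by linarith, by linarith⟩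
  obtain ⟨hQ2, hQ3, hQ1⟩ : q t₂ ≠ 0 ∧ q t₃ / q t₂ ∈ Ioo (0 : ℝ) 1 ∧ q t₁ / q t₂ < 0 := by
    rcases hqc.strictMonoOn_of_injOn_Icc' (by linarith) hqi with hm | hm
    · have a1 := hm m1 ht₀m (by linarith)
      have a2 := hm ht₀m m3 (by linarith)
      have a3 := hm m3 m2 (by linarith)
      rw [hq0] at a1 a2
      have a4 : 0 < q t₂ := a2.trans a3
      exact ⟨a4.ne', ⟨div_pos a2 a4, (div_lt_one a4).2 a3⟩, div_neg_of_neg_of_pos a1 a4⟩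
    · have a1 := hm m1 ht₀m (by linarith)
      have a2 := hm ht₀m m3 (by linarith)
      have a3 := hm m3 m2 (by linarith)
      rw [hq0] at a1 a2
      have a4 : q t₂ < 0 := a3.trans a2
      exact ⟨a4.ne, ⟨div_pos_of_neg_of_neg a2 a4, (div_lt_one_of_neg a4).2 a3⟩,
        div_neg_of_pos_of_neg a1 a4⟩
  set S : ℝ → ℝ := fun x ↦ (s₀ - δ) + x * ((s₀ + δ) - (s₀ - δ)) with hS
  have hSm : ∀ x ∈ Icc (0 : ℝ) 1, S x ∈ Icc (s₀ - δ) (s₀ + δ) := fun x hx ↦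
    ⟨by simp only [hS]; nlinarith [hx.1], by simp only [hS]; nlinarith [hx.2]⟩
  have hSinj : ∀ x y, S x = S y → x = y := fun x y hxy ↦ by
    simp only [hS] at hxy
    have : (x - y) * (2 * δ) = 0 := by linarith
    rcases mul_eq_zero.1 this with h' | h' <;> linarith
  have hS0 : S 0 = s₀ - δ := by simp [hS]
  have hS1 : S 1 = s₀ + δ := by simp [hS]
  have hSh : S (1 / 2) = s₀ := by simp only [hS]; ring
  set κ : ℝ × ℝ → ℂ := fun x ↦ k (r (S x.1), x.2 * q t₂) with hκ
  have hyq : ∀ y ∈ Icc (0 : ℝ) 1, y * q t₂ ∈ Icc (-ε) ε := fun y hy ↦ by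
    have h1 := (hq' t₂ m2).1
    constructor
    · rcases le_total 0 (q t₂) with h' | h'
      · nlinarith [hy.1, mul_nonneg hy.1 h']
      · nlinarith [hy.2, h1.1, mul_nonneg (sub_nonneg.2 hy.2) (neg_nonneg.2 h')]
    · rcases le_total 0 (q t₂) with h' | h'
      · nlinarith [hy.2, h1.2, mul_nonneg (sub_nonneg.2 hy.2) h']
      · nlinarith [hy.1, mul_nonneg hy.1 (neg_nonneg.2 h')]
  have hκm : MapsTo (fun x : ℝ × ℝ ↦ (r (S x.1), x.2 * q t₂)) (Icc 0 1 ×ˢ Icc 0 1) Bx :=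
    fun x hx ↦ ⟨(hr' _ (hSm _ hx.1)).1, hyq _ hx.2⟩
  have hκc : ContinuousOn κ (Icc 0 1 ×ˢ Icc 0 1) := by
    refine hk.comp (ContinuousOn.prodMk ?_ (by fun_prop)) hκm
    exact hrc.comp (f := fun x : ℝ × ℝ ↦ S x.1) (by fun_prop) fun x hx ↦ hSm _ hx.1
  have hκi : InjOn κ (Icc 0 1 ×ˢ Icc 0 1) := by
    intro x hx y hy hxy
    have h1 := hki (hκm hx) (hκm hy) hxy
    rw [Prod.mk.injEq] at h1
    exact Prod.ext (hSinj _ _ (hri (hSm _ hx.1) (hSm _ hy.1) h1.1)) (mul_right_cancel₀ hQ2 h1.2)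
  set Qd := rectQuad κ hκc with hQd
  have hρ3 : ρ t₃ = κ (1 / 2, q t₃ / q t₂) := by
    simp only [hκ, hSh, hr0, div_mul_cancel₀ _ hQ2]
    exact (hq' t₃ m3).2
  have hw3 : Qd.wind (ρ t₃) ≠ 0 := by
    rw [hρ3]; exact rectQuad_wind_ne_zero hκc hκi ⟨by norm_num, hQ3⟩
  have hout : ρ t₁ ∉ κ '' Icc 0 1 ×ˢ Icc 0 1 := by
    rintro ⟨x, hx, hxe⟩
    rw [(hq' t₁ m1).2] at hxe
    have h1 := hki (hκm hx) ⟨hz, (hq' t₁ m1).1⟩ hxe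
    have h2 : x.2 = q t₁ / q t₂ := by rw [eq_div_iff hQ2]; exact congrArg Prod.snd h1
    linarith [hx.2.1]
  have hw1 : Qd.wind (ρ t₁) = 0 := rectQuad_wind_of_notMem hκc hout
  have htr := rectQuad_trace hκc
  have h31 : t₁ ≤ t₃ := by linarith
  have hρc3 : ContinuousOn ρ (Icc t₁ t₃) := hρ.mono fun t ht ↦ htI ⟨ht.1, by linarith [ht.2]⟩
  have hn1 : ρ t₁ ∉ Qd.trace := fun hmem ↦ by
    rw [htr] at hmem; exact hout (image_mono (fun x hx ↦ hx.1) hmem)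
  have hn3 : ρ t₃ ∉ Qd.trace := fun hmem ↦ by
    rw [htr] at hmem
    obtain ⟨x, ⟨hx, hx'⟩, hxe⟩ := hmem
    rw [hρ3] at hxe
    have := hκi hx ⟨⟨by norm_num, by norm_num⟩, Ioo_subset_Icc_self hQ3⟩ hxe
    rw [this] at hx'
    exact hx' ⟨by norm_num, hQ3⟩
  have hsum := Qd.sum_bvar hn1 hn3
  have hzero : ∀ X : ℝ → ℂ, ContinuousOn X (Icc 0 1) →
      (∀ s ∈ Icc (0 : ℝ) 1, ∀ t ∈ Icc t₁ t₃, ρ t ≠ X s) →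
      bvar (fun s t ↦ ρ t - X s) 0 1 t₁ t₃ = 0 := fun X hX hne ↦
    bvar_eq_zero zero_le_one h31 ((hρc3.comp continuousOn_snd fun p hp ↦ hp.2).sub
      (hX.comp continuousOn_fst fun p hp ↦ hp.1)) fun s hs t ht ↦ sub_ne_zero.2 (hne s hs t ht)
  have t31 : ∀ t ∈ Icc t₁ t₃, t ∈ Icc t₁ t₂ := fun t ht ↦ ⟨ht.1, by linarith [ht.2]⟩
  have hside : ∀ x ∈ Icc (0 : ℝ) 1, S x ≠ s₀ → ∀ y ∈ Icc (0 : ℝ) 1, ∀ t ∈ Icc t₁ t₃,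
      ρ t ≠ κ (x, y) := by
    intro x hx hne y hy t ht heq'
    rw [(hq' t (t31 t ht)).2] at heq'
    have h1 := hki ⟨hz, (hq' t (t31 t ht)).1⟩ (hκm (show (x, y) ∈ Icc 0 1 ×ˢ Icc 0 1 from ⟨hx, hy⟩)) heq'
    have h2 : 0 = r (S x) := congrArg Prod.fst h1
    exact hne (hri (hSm x hx) hs₀m (by rw [hr0, h2]))
  have zR := hzero Qd.R Qd.contR fun s hs t ht ↦
    hside 1 one_mem_I (by rw [hS1]; linarith) s hs t ht
  have zL := hzero Qd.L Qd.contL fun s hs t ht ↦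
    hside 0 zero_mem_I (by rw [hS0]; linarith) s hs t ht
  have zT := hzero Qd.T Qd.contT fun s hs t ht heq' ↦ by
    rw [(hq' t (t31 t ht)).2] at heq'
    have h1 := hki ⟨hz, (hq' t (t31 t ht)).1⟩ (hκm (show (s, (1 : ℝ)) ∈ Icc 0 1 ×ˢ Icc 0 1 from ⟨hs, one_mem_I⟩)) heq'
    have h2 : q t = 1 * q t₂ := congrArg Prod.snd h1
    rw [one_mul] at h2
    have h3 := hqi (t31 t ht) m2 h2
    linarith [ht.2]
  have hBeq : ∀ s ∈ Icc (0 : ℝ) 1, Qd.B s = α (S s) := fun s hs ↦ by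
    change k (r (S s), 0 * q t₂) = _
    rw [zero_mul, ← (hr' _ (hSm s hs)).2]
  have hDc : ContinuousOn (uncurry fun s t ↦ ρ t - α s) (Icc 0 1 ×ˢ Icc 0 1) :=
    (hρ.comp continuousOn_snd fun p hp ↦ hp.2).sub (hα.comp continuousOn_fst fun p hp ↦ hp.1)
  have hloc := bvar_localize hDc (s₀ := s₀) (t₀ := t₀) (s₁ := s₀ - δ) (s₂ := s₀ + δ) (t₁ := t₁)
    (t₂ := t₃) (fun s hs t ht h' ↦ h s hs t ht (sub_eq_zero.1 h').symm)
    (hb1 _ ⟨le_rfl, by linarith⟩).1.le (by linarith) (by linarith)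
    (hb1 _ ⟨by linarith, le_rfl⟩).2.le (hb2 _ m1).1.le (by linarith) (by linarith) (hb2 _ m3).2.le
  rw [hloc]
  have hB : bvar (fun s t ↦ ρ t - Qd.B s) 0 1 t₁ t₃ =
      bvar (fun s t ↦ ρ t - α s) (s₀ - δ) (s₀ + δ) t₁ t₃ := by
    have hrow : ∀ t ∈ Icc t₁ t₃, t ≠ t₀ → lvar (fun s ↦ ρ t - Qd.B s) 0 1 =
        lvar (fun s ↦ ρ t - α s) (s₀ - δ) (s₀ + δ) := fun t ht hne ↦ by
      rw [lvar_congr (g := fun s ↦ ρ t - α (S s)) fun s hs ↦ by simp only [hBeq s hs]]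
      exact lvar_affine (f := fun s ↦ ρ t - α s) (by linarith)
        (continuousOn_const.sub (hα.mono hsI)) fun s hs h' ↦
          hne (h s (hsI hs) t (htI (t31 t ht)) (sub_eq_zero.1 h').symm).2
    unfold bvar
    beta_reduce
    rw [hrow t₁ ⟨le_rfl, h31⟩ (by linarith), hrow t₃ ⟨h31, le_rfl⟩ (by linarith), hBeq 0 zero_mem_I,
      hBeq 1 one_mem_I, hS0, hS1]
  rw [← hB]
  rw [zR, zT, zL, hw1] at hsum
  intro h0
  rw [h0] at hsum
  exact hw3 (by linear_combination hsum)

namespace Quad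

/-- The displacement along a quad is the crossing number of two of its sides, provided
opposite sides are displaced off each other. -/
theorem displacement_eq_bvar (P P' : Quad)
    (hB : ∀ s ∈ Icc (0 : ℝ) 1, ∀ t ∈ Icc (0 : ℝ) 1, P.B t ≠ P'.B s)
    (hR : ∀ s ∈ Icc (0 : ℝ) 1, ∀ t ∈ Icc (0 : ℝ) 1, P.R t ≠ P'.R s)
    (hT : ∀ s ∈ Icc (0 : ℝ) 1, ∀ t ∈ Icc (0 : ℝ) 1, P.T t ≠ P'.T s)
    (hL : ∀ s ∈ Icc (0 : ℝ) 1, ∀ t ∈ Icc (0 : ℝ) 1, P.L t ≠ P'.L s)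
    (hLT : ∀ s ∈ Icc (0 : ℝ) 1, ∀ t ∈ Icc (0 : ℝ) 1, P.T t ≠ P'.L s)
    (hw : P.wind (P'.B 0) = 0)
    (hn' : P.R 1 ∉ P'.trace) (hw' : P'.wind (P.R 1) = 0) :
    lvar (fun s ↦ P.B s - P'.B s) 0 1 + lvar (fun s ↦ P.R s - P'.R s) 0 1
      - lvar (fun s ↦ P.T s - P'.T s) 0 1 - lvar (fun s ↦ P.L s - P'.L s) 0 1 =
      bvar (fun s t ↦ P.R t - P'.B s) 0 1 0 1 := by
  have diag : ∀ {X X' : ℝ → ℂ}, ContinuousOn X (Icc 0 1) → ContinuousOn X' (Icc 0 1) →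
      (∀ s ∈ Icc (0 : ℝ) 1, ∀ t ∈ Icc (0 : ℝ) 1, X t ≠ X' s) →
      lvar (fun s ↦ X s - X' s) 0 1 =
        lvar (fun t ↦ X t - X' 0) 0 1 + lvar (fun s ↦ X 1 - X' s) 0 1 := fun {X X'} hX hX' hd ↦
    lvar_diag (D := fun s t ↦ X t - X' s) zero_le_one
      ((hX.comp continuousOn_snd fun p hp ↦ hp.2).sub
        (hX'.comp continuousOn_fst fun p hp ↦ hp.1))
      fun s hs t ht ↦ sub_ne_zero.2 (hd s hs t ht)
  have sq := lvar_square (D := fun s t ↦ P.T t - P'.L s) (a := 0) (b := 1) (c := 0) (d := 1)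
    zero_le_one zero_le_one ((P.contT.comp continuousOn_snd fun p hp ↦ hp.2).sub
        (P'.contL.comp continuousOn_fst fun p hp ↦ hp.1))
      fun s hs t ht ↦ sub_ne_zero.2 (hLT s hs t ht)
  have hwsub : ∀ {X : ℝ → ℂ}, ContinuousOn X (Icc 0 1) → MapsTo X (Icc 0 1) P'.trace →
      lvar (fun s ↦ X s - P.R 1) 0 1 = lvar (fun s ↦ P.R 1 - X s) 0 1 := fun {X} hX hm ↦
    lvar_sub_comm zero_le_one hX (continuousOn_const (c := P.R 1))
      fun t ht h ↦ hn' (by rw [← h]; exact hm ht)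
  unfold wind qvar at hw hw'
  rw [hwsub P'.contB P'.mapsTo_B, hwsub P'.contR P'.mapsTo_R, hwsub P'.contT P'.mapsTo_T,
    hwsub P'.contL P'.mapsTo_L] at hw'
  rw [diag P.contB P'.contB hB, diag P.contR P'.contR hR, diag P.contT P'.contT hT,
    diag P.contL P'.contL hL]
  unfold bvar
  simp only [P.T_one, ← P'.T_zero, ← P'.B_zero, ← P'.B_one, ← P.T_zero, P.B_one] at *
  linear_combination hw + hw' - sq

/-- If a loop has vanishing total displacement-obstruction the map has a fixed point. -/
theorem exists_fixedPt (P : Quad) {Φ : ℂ → ℂ} (hΦ : ContinuousOn Φ P.hull)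
    (hB : ∀ s ∈ Icc (0 : ℝ) 1, ∀ t ∈ Icc (0 : ℝ) 1, Φ (P.B t) ≠ P.B s)
    (hR : ∀ s ∈ Icc (0 : ℝ) 1, ∀ t ∈ Icc (0 : ℝ) 1, Φ (P.R t) ≠ P.R s)
    (hT : ∀ s ∈ Icc (0 : ℝ) 1, ∀ t ∈ Icc (0 : ℝ) 1, Φ (P.T t) ≠ P.T s)
    (hL : ∀ s ∈ Icc (0 : ℝ) 1, ∀ t ∈ Icc (0 : ℝ) 1, Φ (P.L t) ≠ P.L s)
    (hLT : ∀ s ∈ Icc (0 : ℝ) 1, ∀ t ∈ Icc (0 : ℝ) 1, Φ (P.T t) ≠ P.L s)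
    (hw : (P.map Φ (hΦ.mono P.trace_subset_hull)).wind (P.B 0) = 0)
    (hn' : Φ (P.R 1) ∉ P.trace) (hw' : P.wind (Φ (P.R 1)) = 0)
    (Q : Quad) (hQB : ∀ s ∈ Icc (0 : ℝ) 1, Q.B s = P.B s)
    (hQR : ∀ s ∈ Icc (0 : ℝ) 1, ∀ t ∈ Icc (0 : ℝ) 1, Φ (P.R t) ≠ Q.R s)
    (hQL : ∀ s ∈ Icc (0 : ℝ) 1, ∀ t ∈ Icc (0 : ℝ) 1, Φ (P.R t) ≠ Q.L s)
    (hQ0 : Φ (P.R 0) ∉ Q.trace) (hQ0' : Q.wind (Φ (P.R 0)) = 0)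
    (hQ1 : Φ (P.R 1) ∉ Q.trace) (hQ1' : Q.wind (Φ (P.R 1)) = 0)
    (hcross : bvar (fun s t ↦ Φ (P.R t) - Q.T s) 0 1 0 1 ≠ 0) :
    ∃ z ∈ P.hull, Φ z = z := by
  by_contra! hcon
  have hΦt := hΦ.mono P.trace_subset_hull
  have hq : P.qvar (fun z ↦ Φ z - z) = 0 :=
    P.qvar_eq_zero P.isCompact_hull P.trace_subset_hull
      (fun p hp ↦ by_contra fun h ↦ hp (Or.inr h)) (hΦ.sub continuousOn_id)
      fun z hz ↦ sub_ne_zero.2 (hcon z hz)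
  have hdisp := (P.map Φ hΦt).displacement_eq_bvar P hB hR hT hL hLT hw hn' hw'
  have hR' : ContinuousOn (fun t ↦ Φ (P.R t)) (Icc 0 1) := hΦt.comp P.contR P.mapsTo_R
  have hzero : ∀ X : ℝ → ℂ, ContinuousOn X (Icc 0 1) →
      (∀ s ∈ Icc (0 : ℝ) 1, ∀ t ∈ Icc (0 : ℝ) 1, Φ (P.R t) ≠ X s) →
      bvar (fun s t ↦ Φ (P.R t) - X s) 0 1 0 1 = 0 := fun X hX hne ↦
    bvar_eq_zero zero_le_one zero_le_one ((hR'.comp continuousOn_snd fun p hp ↦ hp.2).sub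
      (hX.comp continuousOn_fst fun p hp ↦ hp.1)) fun s hs t ht ↦ sub_ne_zero.2 (hne s hs t ht)
  have hsum := Q.sum_bvar (ρ := fun t ↦ Φ (P.R t)) hQ0 hQ1
  simp only [hzero Q.R Q.contR hQR, hzero Q.L Q.contL hQL, hQ0', hQ1'] at hsum
  have hQB' : bvar (fun s t ↦ Φ (P.R t) - Q.B s) 0 1 0 1 =
      bvar (fun s t ↦ Φ (P.R t) - P.B s) 0 1 0 1 := by
    unfold bvar
    beta_reduce
    rw [hQB 0 zero_mem_I, hQB 1 one_mem_I,
      lvar_congr (g := fun s ↦ Φ (P.R 0) - P.B s) fun s hs ↦ by simp only [hQB s hs],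
      lvar_congr (f := fun s ↦ Φ (P.R 1) - Q.B s) (g := fun s ↦ Φ (P.R 1) - P.B s)
        fun s hs ↦ by simp only [hQB s hs]]
  apply hcross
  have e1 : bvar (fun s t ↦ Φ (P.R t) - P.B s) 0 1 0 1 = 0 := hdisp.symm.trans hq
  rw [hQB', e1] at hsum
  linear_combination -hsum

end Quad

section

section Arcs

variable {S : Type} [TopologicalSpace S]

lemma IsArcIn.image {ℓ A : Set S} {x y : S} (h : IsArcIn ℓ A x y) (G : S ≃ₜ S) :
    IsArcIn (G '' ℓ) (G '' A) (G x) (G y) := by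
  obtain ⟨f, hf, hi, hr, a, b, hab, rfl, rfl, rfl⟩ := h
  exact ⟨G ∘ f, G.continuous.comp hf, G.injective.comp hi, by rw [range_comp, hr], a, b, hab, rfl,
    rfl, by rw [image_comp]⟩

lemma IsArcIn.of_param {f : ℝ → S} (hf : Continuous f) (hi : Injective f) {a b : ℝ} (hab : a ≤ b) :
    IsArcIn (range f) (f '' Icc a b) (f a) (f b) :=
  ⟨f, hf, hi, rfl, a, b, hab, rfl, rfl, rfl⟩

lemma IsArcIn.symm {ℓ A : Set S} {x y : S} (h : IsArcIn ℓ A x y) : IsArcIn ℓ A y x := by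
  obtain ⟨f, hf, hi, hr, a, b, hab, rfl, rfl, rfl⟩ := h
  refine ⟨fun t ↦ f (-t), hf.comp continuous_neg, hi.comp neg_injective, ?_, -b, -a, by linarith,
    by simp, by simp, ?_⟩
  · rw [← hr]; exact (Equiv.neg ℝ).surjective.range_comp f
  · rw [show (fun t ↦ f (-t)) = f ∘ Neg.neg from rfl, image_comp, image_neg_eq_neg,
      Set.neg_Icc, neg_neg, neg_neg]

/-- The subarc of a parametrized line between two parameters in either order. -/
lemma IsArcIn.of_param_uIcc {f : ℝ → S} (hf : Continuous f) (hi : Injective f) (a b : ℝ) :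
    IsArcIn (range f) (f '' uIcc a b) (f a) (f b) := by
  rcases le_total a b with h | h
  · rw [uIcc_of_le h]; exact .of_param hf hi h
  · rw [uIcc_of_ge h]; exact (IsArcIn.of_param hf hi h).symm

lemma IsArcIn.iterate {ℓ A : Set S} {x y : S} (h : IsArcIn ℓ A x y) (G : S ≃ₜ S) (n : ℕ) :
    IsArcIn ((⇑G)^[n] '' ℓ) ((⇑G)^[n] '' A) ((⇑G)^[n] x) ((⇑G)^[n] y) := by
  induction n with
  | zero => simpa using h
  | succ n ih =>
    rw [iterate_succ', image_comp, image_comp]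
    exact ih.image G

end Arcs

/-- A family of lines all of whose forward images under `G` are streamlines. -/
def goodLines {S : Type} [TopologicalSpace S] [MeasurableSpace S] {μ : Measure S}
    (T : MeasuredTurbulation μ) (G : S ≃ₜ S) : Set (Set S) :=
  {ℓ | ∀ n : ℕ, (⇑G)^[n] '' ℓ ∈ T.lines}

/-- `G` contracts the streamlines of the turbulation `T`. -/
structure Contracts {S : Type} [MetricSpace S] [MeasurableSpace S] {μ : Measure S}
    (T : MeasuredTurbulation μ) (G : S ≃ₜ S) : Prop where
  tame : T.TameWith dist
  dense : T.DenseStreamlines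
  mp : MeasurePreserving G μ μ
  good_ae : ∀ᵐ x ∂μ, ∃ ℓ ∈ goodLines T G, x ∈ ℓ
  scale : ∃ c : ℝ≥0∞, c < 1 ∧ ∀ ℓ ∈ T.lines, G '' ℓ ∈ T.lines → ∀ A x y, IsArcIn ℓ A x y →
    T.ν (G '' ℓ) (G '' A) = c * T.ν ℓ A

section Basic

variable {S : Type} [MetricSpace S] [MeasurableSpace S] {μ : Measure S}
  {T : MeasuredTurbulation μ} {G : S ≃ₜ S}

lemma MeasuredTurbulation.line_unique (T : MeasuredTurbulation μ) {ℓ ℓ' : Set S}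
    (h : ℓ ∈ T.lines) (h' : ℓ' ∈ T.lines) {x : S} (hx : x ∈ ℓ) (hx' : x ∈ ℓ') : ℓ = ℓ' :=
  by_contra fun hne ↦ (T.lines_disjoint h h' hne).le_bot ⟨hx, hx'⟩

lemma mem_lines_of_good {ℓ : Set S} (h : ℓ ∈ goodLines T G) : ℓ ∈ T.lines := by simpa using h 0

lemma Contracts.scale_iterate (hC : Contracts T G) : ∃ c : ℝ≥0∞, c < 1 ∧ ∀ ℓ ∈ goodLines T G,
    ∀ A x y, IsArcIn ℓ A x y → ∀ n : ℕ,
      T.ν ((⇑G)^[n] '' ℓ) ((⇑G)^[n] '' A) = c ^ n * T.ν ℓ A := by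
  obtain ⟨c, hc, h⟩ := hC.scale
  refine ⟨c, hc, fun ℓ hℓ A x y hA n ↦ ?_⟩
  induction n with
  | zero => simp
  | succ n ih =>
    have h1 := hℓ (n + 1)
    rw [iterate_succ', image_comp] at h1
    rw [iterate_succ', image_comp, image_comp, h _ (hℓ n) h1 _ _ _ (hA.iterate G n), ih, pow_succ',
      mul_assoc]

/-- Arcs of bounded stream measure have uniformly small stream measure after many iterations. -/
lemma Contracts.eventually_ν_lt (hC : Contracts T G) {M : ℝ≥0∞} (hM : M ≠ ⊤) {δ : ℝ≥0∞}
    (hδ : 0 < δ) : ∀ᶠ n : ℕ in atTop, ∀ ℓ ∈ goodLines T G, ∀ A x y, IsArcIn ℓ A x y →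
      T.ν ℓ A ≤ M → T.ν ((⇑G)^[n] '' ℓ) ((⇑G)^[n] '' A) < δ := by
  obtain ⟨c, hc, h⟩ := hC.scale_iterate
  have h0 : Tendsto (fun n : ℕ ↦ c ^ n * M) atTop (𝓝 0) := by
    have := ENNReal.Tendsto.mul_const (ENNReal.tendsto_pow_atTop_nhds_zero_of_lt_one hc)
      (b := M) (Or.inr hM)
    simpa using this
  filter_upwards [h0.eventually_lt_const hδ] with n hn ℓ hℓ A x y hA hAM
  rw [h ℓ hℓ A x y hA n]
  exact lt_of_le_of_lt (by gcongr) hn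

/-- Arcs of bounded stream measure become uniformly short after many iterations. -/
lemma Contracts.eventually_dist_lt (hC : Contracts T G) {M : ℝ≥0∞} (hM : M ≠ ⊤) {ε : ℝ}
    (hε : 0 < ε) : ∀ᶠ n : ℕ in atTop, ∀ ℓ ∈ goodLines T G, ∀ A x y, IsArcIn ℓ A x y →
      T.ν ℓ A ≤ M → dist ((⇑G)^[n] x) ((⇑G)^[n] y) < ε := by
  obtain ⟨δ, hδ, h⟩ := hC.tame ε hε
  filter_upwards [hC.eventually_ν_lt hM (ENNReal.ofReal_pos.2 hδ)] with n hn ℓ hℓ A x y hA hAM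
  exact h _ (hℓ n) _ _ _ (hA.iterate G n) (hn ℓ hℓ A x y hA hAM)

/-- Two points of a good line are forward asymptotic. -/
lemma Contracts.eventually_dist_lt_of_mem (hC : Contracts T G) {ℓ : Set S}
    (hℓ : ℓ ∈ goodLines T G) {x y : S} (hx : x ∈ ℓ) (hy : y ∈ ℓ) {ε : ℝ} (hε : 0 < ε) :
    ∀ᶠ n : ℕ in atTop, dist ((⇑G)^[n] x) ((⇑G)^[n] y) < ε := by
  obtain ⟨f, hf, hi, rfl⟩ := T.lines_immersed ℓ (mem_lines_of_good hℓ)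
  obtain ⟨a, rfl⟩ := hx
  obtain ⟨b, rfl⟩ := hy
  have hA := IsArcIn.of_param_uIcc hf hi a b
  filter_upwards [hC.eventually_dist_lt
    (T.ν_arc_finite _ (mem_lines_of_good hℓ) _ _ _ hA).ne hε] with n hn
  exact hn _ hℓ _ _ _ hA le_rfl

lemma Contracts.ae_recurrent [CompactSpace S] [BorelSpace S] [IsFiniteMeasure μ]
    (hC : Contracts T G) : ∀ᵐ x ∂μ, ∀ s ∈ 𝓝 x, ∃ᶠ n : ℕ in atTop, (⇑G)^[n] x ∈ s :=
  hC.mp.conservative.ae_frequently_mem_of_mem_nhds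

lemma Contracts.transitive [CompactSpace S] [BorelSpace S] [IsFiniteMeasure μ]
    (hC : Contracts T G) (hpos : ∀ U : Set S, IsOpen U → U.Nonempty → 0 < μ U)
    {U V : Set S} (hU : IsOpen U) (hUn : U.Nonempty) (hV : IsOpen V) (hVn : V.Nonempty) :
    ∃ n : ℕ, 0 < n ∧ ((⇑G)^[n] '' V ∩ U).Nonempty := by
  have h1 : ∃ᶠ x in ae μ, x ∈ U := frequently_ae_mem_iff.2 (hpos U hU hUn).ne'
  obtain ⟨x, hxU, hrec, ℓ, hℓ, hxℓ⟩ := (h1.and_eventually (hC.ae_recurrent.and hC.good_ae)).exists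
  obtain ⟨y, hyV, hyℓ⟩ := (hC.dense ℓ (mem_lines_of_good hℓ)).inter_open_nonempty V hV hVn
  obtain ⟨ε, hε, hεU⟩ := Metric.isOpen_iff.1 hU x hxU
  have h2 := hC.eventually_dist_lt_of_mem hℓ hxℓ hyℓ (half_pos hε)
  obtain ⟨n, hn, hn2, hn0⟩ := ((hrec _ (Metric.ball_mem_nhds x (half_pos hε))).and_eventually
    (h2.and (eventually_gt_atTop 0))).exists
  refine ⟨n, hn0, _, mem_image_of_mem _ hyV, hεU ?_⟩
  rw [Metric.mem_ball] at hn ⊢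
  calc dist ((⇑G)^[n] y) x ≤ dist ((⇑G)^[n] y) ((⇑G)^[n] x) + dist ((⇑G)^[n] x) x :=
        dist_triangle _ _ _
    _ < ε / 2 + ε / 2 := by rw [dist_comm ((⇑G)^[n] y)]; exact add_lt_add hn2 hn
    _ = ε := add_halves ε

end Basic

/-- A transitive homeomorphism of an infinite metric space with dense periodic points has sensitive
dependence on initial conditions. -/
lemma sensitive_of_transitive_of_dense_periodic {S : Type} [MetricSpace S] [Nonempty S] {f : S → S}
    (hf : Continuous f) (hinf : ∀ U : Set S, IsOpen U → U.Nonempty → U.Infinite)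
    (htr : ∀ U V : Set S, IsOpen U → U.Nonempty → IsOpen V → V.Nonempty →
      ∃ n : ℕ, 0 < n ∧ (f^[n] '' U ∩ V).Nonempty)
    (hper : ∀ U : Set S, IsOpen U → U.Nonempty → ∃ x ∈ U, ∃ n : ℕ, 1 ≤ n ∧ f^[n] x = x) :
    ∃ ε : ℝ, 0 < ε ∧ ∀ x : S, ∀ U ∈ 𝓝 x, ∃ y ∈ U, ∃ n : ℕ, ε < dist (f^[n] x) (f^[n] y) := by
  have orb_fin : ∀ {q : S} {n : ℕ}, 1 ≤ n → f^[n] q = q → (range fun i ↦ f^[i] q).Finite := by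
    intro q n hn hq
    refine ((finite_lt_nat n).image fun i ↦ f^[i] q).subset ?_
    rintro _ ⟨i, rfl⟩
    exact ⟨i % n, Nat.mod_lt _ hn, IsPeriodicPt.iterate_mod_apply hq i⟩
  obtain ⟨q₁, -, n₁, hn₁, hq₁⟩ := hper univ isOpen_univ univ_nonempty
  have hfin := orb_fin hn₁ hq₁
  have hne : (range fun i ↦ f^[i] q₁)ᶜ.Nonempty := by
    by_contra h
    rw [not_nonempty_iff_eq_empty, compl_empty_iff] at h
    exact hinf univ isOpen_univ univ_nonempty (h ▸ hfin)
  obtain ⟨q₂, hq₂o, n₂, hn₂, hq₂⟩ := hper _ hfin.isClosed.isOpen_compl hne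
  have hfin₂ := orb_fin hn₂ hq₂
  have hdisj : Disjoint (range fun i ↦ f^[i] q₁) (range fun i ↦ f^[i] q₂) := by
    rw [Set.disjoint_left]
    rintro _ ⟨i, rfl⟩ ⟨k, hk⟩
    refine hq₂o ⟨n₂ * k - k + i, ?_⟩
    have hk' : k ≤ n₂ * k := Nat.le_mul_of_pos_left _ hn₂
    change f^[n₂ * k - k + i] q₁ = q₂
    rw [iterate_add_apply]
    change f^[_] ((fun i ↦ f^[i] q₁) i) = q₂
    rw [← hk]
    change f^[_] (f^[k] q₂) = q₂
    rw [← iterate_add_apply, Nat.sub_add_cancel hk']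
    exact IsPeriodicPt.mul_const hq₂ k
  obtain ⟨δ, hδ, hsep⟩ := Metric.exists_pos_forall_lt_edist
    hfin.isCompact hfin₂.isClosed hdisj
  obtain ⟨η, hη, hη8⟩ : ∃ η : ℝ, 0 < η ∧ 8 * η = δ := ⟨δ / 8, by positivity, by ring⟩
  have hsep' : ∀ i k, 8 * η < dist (f^[i] q₁) (f^[k] q₂) := fun i k ↦ by
    have := hsep _ (mem_range_self i) _ (mem_range_self k)
    rw [edist_dist, ← ENNReal.ofReal_coe_nnreal, ENNReal.ofReal_lt_ofReal_iff_of_nonneg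
      (by positivity)] at this
    rw [hη8]; exact this
  have hfar : ∀ x : S, ∃ q, ∀ i, 4 * η ≤ dist x (f^[i] q) := by
    intro x
    by_contra! hcon
    obtain ⟨i, hi⟩ := hcon q₁
    obtain ⟨k, hk⟩ := hcon q₂
    linarith [dist_triangle_left (f^[i] q₁) (f^[k] q₂) x, hsep' i k]
  refine ⟨η, hη, fun x U hU ↦ ?_⟩
  obtain ⟨U', hU'U, hU'o, hxU'⟩ := mem_nhds_iff.1 (inter_mem hU (Metric.ball_mem_nhds x hη))
  obtain ⟨p, hpU, m, hm, hp⟩ := hper U' hU'o ⟨x, hxU'⟩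
  obtain ⟨q, hq⟩ := hfar x
  obtain ⟨k, -, z, ⟨y, hyU, rfl⟩, hyV⟩ := htr U' (⋂ i ∈ Finset.range (m + 1),
    f^[i] ⁻¹' Metric.ball (f^[i] q) η) hU'o ⟨x, hxU'⟩
    (isOpen_biInter_finset fun i _ ↦ Metric.isOpen_ball.preimage (hf.iterate i))
    ⟨q, mem_iInter₂.2 fun i _ ↦ Metric.mem_ball_self hη⟩
  have hdiv := Nat.div_add_mod k m
  have hmod := Nat.mod_lt k hm
  set N := m * (k / m + 1) with hN
  have hNk : N = (m - k % m) + k := by rw [hN, mul_add]; omega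
  have h1 : dist (f^[N] y) (f^[m - k % m] q) < η := by
    have := mem_iInter₂.1 hyV (m - k % m) (Finset.mem_range.2 (by omega))
    rw [hNk, iterate_add_apply]; exact this
  have h2 : f^[N] p = p := IsPeriodicPt.mul_const hp _
  have h3 : dist p x < η := (hU'U hpU).2
  have h4 := hq (m - k % m)
  have h5 : 2 * η < dist p (f^[N] y) := by
    linarith [dist_triangle4 x p (f^[N] y) (f^[m - k % m] q), dist_comm x p]
  rcases lt_or_ge η (dist (f^[N] x) (f^[N] y)) with h | h
  · exact ⟨y, (hU'U hyU).1, N, h⟩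
  · refine ⟨p, (hU'U hpU).1, N, ?_⟩
    rw [h2]
    linarith [dist_triangle_left p (f^[N] y) (f^[N] x)]

end

section

namespace Tartan

section

variable {S : Type} [TopologicalSpace S] [MeasurableSpace S] {μ : Measure S}
  {Ts Tu : MeasuredTurbulation μ}

/-- The tartan with the roles of stable and unstable fibers exchanged. -/
def swap (R : Tartan Ts Tu) : Tartan Tu Ts where
  Rs := R.Ru
  Ru := R.Rs
  borel_s := R.borel_u
  borel_u := R.borel_s
  fibs := R.fibu
  fibu := R.fibs
  fibs_disjoint := R.fibu_disjoint
  fibu_disjoint := R.fibs_disjoint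
  fibs_cover := R.fibu_cover
  fibu_cover := R.fibs_cover
  inter_unique := fun A hA B hB ↦ by rw [inter_comm]; exact R.inter_unique B hB A hA
  oriented := by
    obtain ⟨ords, ordu, h1, h2, h3, h4⟩ := R.oriented
    exact ⟨ordu, ords, h2, h1, h4, h3⟩
  bounded := by
    obtain ⟨L, h1, h2, h3⟩ := R.bounded
    exact ⟨L, h1, h3, h2⟩
  in_disk := by rw [union_comm]; exact R.in_disk

lemma core_swap (R : Tartan Ts Tu) : R.swap.core = R.core := inter_comm _ _

lemma fibs_param (R : Tartan Ts Tu) {A : Set S} (hA : A ∈ R.fibs) : ∃ ℓ ∈ Ts.lines, ∃ f : ℝ → S,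
    Continuous f ∧ Injective f ∧ range f = ℓ ∧ ∃ a b : ℝ, a ≤ b ∧ A = f '' Icc a b := by
  obtain ⟨ords, ordu, h1, -⟩ := R.oriented
  obtain ⟨ℓ, hℓ, f, hf, hi, hr, a, b, hab, h, -⟩ := h1 A hA
  exact ⟨ℓ, hℓ, f, hf, hi, hr, a, b, hab, h⟩

lemma fibs_nonempty (R : Tartan Ts Tu) {A : Set S} (hA : A ∈ R.fibs) : A.Nonempty := by
  obtain ⟨ℓ, -, f, -, -, -, a, b, hab, rfl⟩ := R.fibs_param hA
  exact (nonempty_Icc.2 hab).image f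

lemma measurableSet_fibs [T2Space S] [BorelSpace S] (R : Tartan Ts Tu) {A : Set S}
    (hA : A ∈ R.fibs) : MeasurableSet A := by
  obtain ⟨ℓ, hℓ, f, hf, hi, hr, a, b, hab, rfl⟩ := R.fibs_param hA
  exact (isCompact_Icc.image hf).measurableSet

lemma fibs_isArc (R : Tartan Ts Tu) {A ℓ : Set S} (hA : A ∈ R.fibs) (hℓ : ℓ ∈ Ts.lines)
    (hAℓ : A ⊆ ℓ) : IsArc ℓ A := by
  obtain ⟨p, hp⟩ := R.fibs_nonempty hA
  obtain ⟨ℓ', hℓ', f, hf, hi, hr, a, b, hab, rfl⟩ := R.fibs_param hA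
  have : ℓ = ℓ' := by_contra fun hne ↦ (Ts.lines_disjoint hℓ hℓ' hne).le_bot
    ⟨hAℓ hp, hr ▸ image_subset_range _ _ hp⟩
  exact ⟨f a, f b, f, hf, hi, hr.trans this.symm, a, b, hab, rfl, rfl, rfl⟩

lemma ν_fibs_lt_top (R : Tartan Ts Tu) {A ℓ : Set S} (hA : A ∈ R.fibs) (hℓ : ℓ ∈ Ts.lines)
    (hAℓ : A ⊆ ℓ) : Ts.ν ℓ A < ⊤ := by
  obtain ⟨x, y, h⟩ := R.fibs_isArc hA hℓ hAℓ
  exact Ts.ν_arc_finite ℓ hℓ A x y h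

lemma isFiniteMeasure_fibs (R : Tartan Ts Tu) {A ℓ : Set S} (hA : A ∈ R.fibs) (hℓ : ℓ ∈ Ts.lines)
    (hAℓ : A ⊆ ℓ) (C : Set S) : IsFiniteMeasure ((Ts.ν ℓ).restrict (A ∩ C)) :=
  ⟨by
    rw [Measure.restrict_apply_univ]
    exact (measure_mono inter_subset_left).trans_lt (R.ν_fibs_lt_top hA hℓ hAℓ)⟩

lemma Compatible.swap {R : Tartan Ts Tu} (h : R.Compatible) : R.swap.Compatible := by
  intro A hA B hB ℓ hℓ hAℓ ℓ' hℓ' hBℓ'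
  obtain ⟨ψ, h1, h2, h3, h4, h5, h6⟩ := h B hB A hA ℓ' hℓ' hBℓ' ℓ hℓ hAℓ
  rw [core_swap]
  refine ⟨ψ ∘ Prod.swap, fun x hx y hy B' hB' hxB A' hA' hyA ↦ ?_, ?_, ?_, h4.comp measurable_swap,
    fun E hE hEm ↦ ?_, ?_⟩
  · exact (h1 y hy x hx A' hA' hyA B' hB' hxB).symm
  · rintro ⟨a, b⟩ hab ⟨c, d⟩ hcd he
    have := h2 (show (b, a) ∈ _ from ⟨hab.2, hab.1⟩) (show (d, c) ∈ _ from ⟨hcd.2, hcd.1⟩) he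
    simp only [Prod.mk.injEq] at this ⊢
    exact this.symm
  · rw [image_comp, image_swap_prod, h3]
  · rw [image_comp]
    refine h5 _ ?_ ?_
    · rintro _ ⟨p, hp, rfl⟩; exact (hE hp).symm
    · rw [image_swap_eq_preimage_swap]; exact measurable_swap hEm
  · have i1 := R.isFiniteMeasure_fibs hB hℓ' hBℓ' R.core
    have i2 := R.swap.isFiniteMeasure_fibs hA hℓ hAℓ R.core
    rw [← Measure.map_map h4 measurable_swap, Measure.prod_swap, h6]

/-- The stream measure of the part of a stable fiber covered by a given family of unstable fibers is
bounded below, uniformly over all stable fibers. -/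
lemma Compatible.exists_lower_bound [T2Space S] [BorelSpace S] {R : Tartan Ts Tu} (h : R.Compatible) {𝓥 : Set (Set S)}
    (h𝓥 : 𝓥 ⊆ R.fibu) (hm : MeasurableSet (R.core ∩ ⋃₀ 𝓥)) (hpos : 0 < μ (R.core ∩ ⋃₀ 𝓥)) :
    ∃ κ : ℝ≥0∞, 0 < κ ∧ ∀ A ∈ R.fibs, ∀ ℓ ∈ Ts.lines, A ⊆ ℓ → κ ≤ Ts.ν ℓ (A ∩ ⋃₀ 𝓥) := by
  obtain ⟨p, hp, hp'⟩ := nonempty_of_measure_ne_zero hpos.ne'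
  obtain ⟨B, hB, -⟩ := hp'
  obtain ⟨ℓ', hℓ', f, hf, hi, hr, a, b, hab, hBf⟩ := R.swap.fibs_param (h𝓥 hB)
  have hBℓ' : B ⊆ ℓ' := by rw [hBf, ← hr]; exact image_subset_range _ _
  have hfin := R.swap.ν_fibs_lt_top (h𝓥 hB) hℓ' hBℓ'
  have key : ∀ A ∈ R.fibs, ∀ ℓ ∈ Ts.lines, A ⊆ ℓ →
      μ (R.core ∩ ⋃₀ 𝓥) ≤ Ts.ν ℓ (A ∩ ⋃₀ 𝓥) * Tu.ν ℓ' B := by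
    intro A hA ℓ hℓ hAℓ
    obtain ⟨ψ, h1, h2, h3, h4, h5, h6⟩ := h A hA B (h𝓥 hB) ℓ hℓ hAℓ ℓ' hℓ' hBℓ'
    have i1 := R.isFiniteMeasure_fibs hA hℓ hAℓ R.core
    have i2 := R.swap.isFiniteMeasure_fibs (h𝓥 hB) hℓ' hBℓ' R.core
    have e1 : μ (R.core ∩ ⋃₀ 𝓥) = μ.restrict R.core (R.core ∩ ⋃₀ 𝓥) := by
      rw [Measure.restrict_apply hm, inter_assoc, inter_comm _ R.core, ← inter_assoc, inter_self]
    have hcm : MeasurableSet R.core := R.borel_s.inter R.borel_u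
    have hAm : ∀ᵐ x ∂((Ts.ν ℓ).restrict (A ∩ R.core)).prod ((Tu.ν ℓ').restrict (B ∩ R.core)),
        x ∈ (A ∩ R.core) ×ˢ (B ∩ R.core) := by
      filter_upwards [Measure.quasiMeasurePreserving_fst.ae
        (ae_restrict_mem ((R.measurableSet_fibs hA).inter hcm)),
        Measure.quasiMeasurePreserving_snd.ae
        (ae_restrict_mem ((R.swap.measurableSet_fibs (h𝓥 hB)).inter hcm))] with x h8 h9
      exact ⟨h8, h9⟩
    rw [e1, ← h6, Measure.map_apply h4 hm]
    calc _ ≤ ((Ts.ν ℓ).restrict (A ∩ R.core)).prod ((Tu.ν ℓ').restrict (B ∩ R.core))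
          ((A ∩ ⋃₀ 𝓥) ×ˢ univ) := by
          refine measure_mono_ae ?_
          filter_upwards [hAm] with x hx hxZ
          obtain ⟨B', hB', hxB'⟩ := hxZ.2
          obtain ⟨B'', hB'', hx''⟩ : ∃ B'' ∈ R.fibu, x.1 ∈ B'' := by
            have := hx.1.2.2; rwa [← R.fibu_cover] at this
          obtain ⟨A', hA', hx'⟩ : ∃ A' ∈ R.fibs, x.2 ∈ A' := by
            have := hx.2.2.1; rwa [← R.fibs_cover] at this
          have h7 := (h1 x.1 hx.1 x.2 hx.2 B'' hB'' hx'' A' hA' hx').1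
          have : B' = B'' := by_contra fun hne ↦
            (R.fibu_disjoint (h𝓥 hB') hB'' hne).le_bot ⟨hxB', h7⟩
          exact ⟨⟨hx.1.1, B', hB', this ▸ hx''⟩, mem_univ _⟩
      _ ≤ _ := by
          rw [Measure.prod_prod, Measure.restrict_apply_univ]
          exact mul_le_mul' (Measure.restrict_apply_le _ _) (measure_mono inter_subset_left)
  refine ⟨μ (R.core ∩ ⋃₀ 𝓥) / Tu.ν ℓ' B, ENNReal.div_pos hpos.ne' hfin.ne, fun A hA ℓ hℓ hAℓ ↦ ?_⟩
  exact ENNReal.div_le_of_le_mul (key A hA ℓ hℓ hAℓ)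

end

end Tartan

end

section

/-- Pulling back a measure carried by the image of an embedding of the real line. -/
lemma MeasurableEmbedding.comap_restrict_image {S : Type}
    [MeasurableSpace S] {f : ℝ → S} (hf : MeasurableEmbedding f) {ν : Measure S} {E : Set ℝ} (hE : MeasurableSet E) {Z : Set S} (hZ : f '' E = Z)
    (hfin : IsFiniteMeasure (ν.restrict Z)) (hν : ∀ x, ν {x} = 0) :
    ((ν.restrict Z).comap f).map f = ν.restrict Z ∧
      IsFiniteMeasure ((ν.restrict Z).comap f) ∧ NullSingletonClass ((ν.restrict Z).comap f) ∧
      (ν.restrict Z).comap f Eᶜ = 0 := by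
  subst hZ
  refine ⟨?_, ⟨?_⟩, ⟨fun x ↦ ?_⟩, ?_⟩
  · rw [hf.map_comap, Measure.restrict_restrict hf.measurableSet_range,
      inter_eq_right.2 (image_subset_range _ _)]
  · rw [hf.comap_apply]; exact measure_lt_top _ _
  · rw [hf.comap_apply, image_singleton]
    exact le_antisymm ((Measure.restrict_apply_le _ _).trans (hν _).le) bot_le
  · rw [hf.comap_apply, Measure.restrict_apply (hf.measurableSet_image.2 hE.compl),
      ← image_inter hf.injective, compl_inter_self, image_empty, measure_empty]

/-- A family of parametrized stream arcs of `T` indexed by `E'`, each of which is crossed at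
the points `ψ (x, y)`, `x ∈ E`, in increasing order. -/
structure Rows {S : Type} [TopologicalSpace S] [MeasurableSpace S] {μ : Measure S}
    (T : MeasuredTurbulation μ) (E E' : Set ℝ) (p : Measure ℝ) (ψ : ℝ × ℝ → S) where
  h : ℝ → ℝ → S
  a : ℝ → ℝ
  b : ℝ → ℝ
  α : ℝ → ℝ → ℝ
  cont : ∀ y ∈ E', Continuous (h y)
  inj : ∀ y ∈ E', Injective (h y)
  mem : ∀ y ∈ E', range (h y) ∈ T.lines
  disj : ∀ y ∈ E', ∀ y' ∈ E', ∀ s ∈ Icc (a y) (b y), ∀ s' ∈ Icc (a y') (b y'),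
    h y s = h y' s' → y = y'
  α_mem : ∀ y ∈ E', ∀ x ∈ E, α y x ∈ Icc (a y) (b y)
  α_mono : ∀ y ∈ E', StrictMonoOn (α y) E
  h_α : ∀ y ∈ E', ∀ x ∈ E, h y (α y x) = ψ (x, y)
  bdd : ∃ L : ℝ≥0∞, L ≠ ⊤ ∧ ∀ y ∈ E', T.ν (range (h y)) (h y '' Icc (a y) (b y)) ≤ L
  zone : ∀ x₁ ∈ E, ∀ x₂ ∈ E, 0 < p (Ioo x₁ x₂) → ∃ κ : ℝ≥0∞, 0 < κ ∧
    ∀ y ∈ E', κ ≤ T.ν (range (h y)) (h y '' Icc (α y x₁) (α y x₂))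

/-- A parametrized compatible tartan. -/
structure Grid {S : Type} [TopologicalSpace S] [MeasurableSpace S] {μ : Measure S}
    (Ts Tu : MeasuredTurbulation μ) where
  Ex : Set ℝ
  Ey : Set ℝ
  px : Measure ℝ
  py : Measure ℝ
  ψ : ℝ × ℝ → S
  core : Set S
  measurable_Ex : MeasurableSet Ex
  measurable_Ey : MeasurableSet Ey
  px_fin : IsFiniteMeasure px
  py_fin : IsFiniteMeasure py
  px_na : NullSingletonClass px
  py_na : NullSingletonClass py
  px_compl : px Exᶜ = 0
  py_compl : py Eyᶜ = 0
  measurable_core : MeasurableSet core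
  measurable_ψ : Measurable ψ
  image_ψ : ψ '' (Ex ×ˢ Ey) = core
  map_ψ : Measure.map ψ (px.prod py) = μ.restrict core
  rows : Rows Ts Ex Ey px ψ
  cols : Rows Tu Ey Ex py (ψ ∘ Prod.swap)
  cross : ∀ y ∈ Ey, ∀ x ∈ Ex, ∀ s ∈ Icc (rows.a y) (rows.b y), ∀ t ∈ Icc (cols.a x) (cols.b x),
    rows.h y s = cols.h x t → s = rows.α y x ∧ t = cols.α x y

namespace Tartan

section

variable {S : Type} [TopologicalSpace S] [MeasurableSpace S] {μ : Measure S}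
  {Ts Tu : MeasuredTurbulation μ}

lemma exists_rows [T2Space S] [BorelSpace S] (R : Tartan Ts Tu) (hR : R.Compatible)
    {ords : Set S → S → S → Prop}
    (h1 : ∀ A ∈ R.fibs, ∃ ℓ ∈ Ts.lines, ∃ f : ℝ → S, Continuous f ∧ Function.Injective f ∧
        Set.range f = ℓ ∧ ∃ a b : ℝ, a ≤ b ∧ A = f '' Set.Icc a b ∧
        ∀ s ∈ Set.Icc a b, ∀ t ∈ Set.Icc a b, (ords A (f s) (f t) ↔ s ≤ t))
    (h3 : ∀ A ∈ R.fibs, ∀ A' ∈ R.fibs, ∀ B ∈ R.fibu, ∀ B' ∈ R.fibu,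
      ∀ p ∈ A ∩ B, ∀ q ∈ A ∩ B', ∀ p' ∈ A' ∩ B, ∀ q' ∈ A' ∩ B',
        (ords A p q ↔ ords A' p' q'))
    {Ex Ey : Set ℝ} {px : Measure ℝ} {ψ : ℝ × ℝ → S} {fs fu : ℝ → Set S}
    (hfs : ∀ y ∈ Ey, fs y ∈ R.fibs) (hfu : ∀ x ∈ Ex, fu x ∈ R.fibu) (hinj : InjOn fs Ey)
    (hψ : ∀ x ∈ Ex, ∀ y ∈ Ey, ψ (x, y) ∈ fs y ∩ fu x) {𝔰 : Set S} (h𝔰 : 𝔰 ∈ R.fibs) {q : ℝ → S}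
    (hq : ∀ x ∈ Ex, q x ∈ 𝔰 ∩ fu x)
    (hord : ∀ x ∈ Ex, ∀ x' ∈ Ex, (ords 𝔰 (q x) (q x') ↔ x ≤ x'))
    (hzm : ∀ x₁ x₂, MeasurableSet (R.core ∩ ⋃₀ (fu '' (Ioo x₁ x₂ ∩ Ex))))
    (hzp : ∀ x₁ x₂, 0 < px (Ioo x₁ x₂) → 0 < μ (R.core ∩ ⋃₀ (fu '' (Ioo x₁ x₂ ∩ Ex)))) :
    ∃ r : Rows Ts Ex Ey px ψ, ∀ y ∈ Ey, r.h y '' Icc (r.a y) (r.b y) = fs y := by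
  have hex : ∀ y ∈ Ey, ∃ (f : ℝ → S) (a b : ℝ) (α : ℝ → ℝ), Continuous f ∧ Injective f ∧
      range f ∈ Ts.lines ∧ fs y = f '' Icc a b ∧ (∀ x ∈ Ex, α x ∈ Icc a b) ∧ StrictMonoOn α Ex ∧
      ∀ x ∈ Ex, f (α x) = ψ (x, y) := by
    intro y hy
    obtain ⟨ℓ, hℓ, f, hf, hi, hr, a, b, hab, hA, ho⟩ := h1 (fs y) (hfs y hy)
    have : ∀ x : ℝ, ∃ t : ℝ, x ∈ Ex → t ∈ Icc a b ∧ f t = ψ (x, y) := by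
      intro x
      by_cases hx : x ∈ Ex
      · have := (hψ x hx y hy).1
        rw [hA] at this
        obtain ⟨t, ht, h⟩ := this
        exact ⟨t, fun _ ↦ ⟨ht, h⟩⟩
      · exact ⟨0, fun h ↦ (hx h).elim⟩
    choose α hα using this
    have hle : ∀ x ∈ Ex, ∀ x' ∈ Ex, (α x ≤ α x' ↔ x ≤ x') := by
      intro x hx x' hx'
      rw [← hord x hx x' hx', ← ho _ (hα x hx).1 _ (hα x' hx').1, (hα x hx).2, (hα x' hx').2]
      exact h3 _ (hfs y hy) _ h𝔰 _ (hfu x hx) _ (hfu x' hx') _ (hψ x hx y hy) _ (hψ x' hx' y hy) _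
        (hq x hx) _ (hq x' hx')
    refine ⟨f, a, b, α, hf, hi, hr ▸ hℓ, hA, fun x hx ↦ (hα x hx).1, fun x hx x' hx' hlt ↦ ?_,
      fun x hx ↦ (hα x hx).2⟩
    rw [← not_le, hle x' hx' x hx, not_le]; exact hlt
  have : Nonempty S := ⟨(R.fibs_nonempty h𝔰).some⟩
  choose! h a b α hc hi hm hA hαm hαs hαe using hex
  obtain ⟨L, hL, hLs, -⟩ := R.bounded
  have sub : ∀ y ∈ Ey, fs y ⊆ range (h y) := fun y hy ↦ by
    rw [hA y hy]; exact image_subset_range (h y) _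
  refine ⟨⟨h, a, b, α, hc, hi, hm, fun y hy y' hy' s hs s' hs' he ↦ ?_, hαm, hαs, hαe,
    ⟨L, hL.ne, fun y hy ↦ ?_⟩, fun x₁ hx₁ x₂ hx₂ hpos ↦ ?_⟩, fun y hy ↦ (hA y hy).symm⟩
  · by_contra hne
    refine (R.fibs_disjoint (hfs y hy) (hfs y' hy') fun h' ↦ hne (hinj hy hy' h')).le_bot
      (show h y s ∈ fs y ∩ fs y' from ⟨?_, ?_⟩)
    · rw [hA y hy]; exact mem_image_of_mem _ hs
    · rw [hA y' hy', he]; exact mem_image_of_mem _ hs'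
  · rw [← hA y hy]
    exact hLs _ (hfs y hy) _ (hm y hy) (sub y hy)
  · obtain ⟨κ, hκ, hb⟩ := hR.exists_lower_bound (𝓥 := fu '' (Ioo x₁ x₂ ∩ Ex))
      (by rintro _ ⟨x, hx, rfl⟩; exact hfu x hx.2) (hzm x₁ x₂) (hzp x₁ x₂ hpos)
    refine ⟨κ, hκ, fun y hy ↦ (hb _ (hfs y hy) _ (hm y hy) (sub y hy)).trans (measure_mono ?_)⟩
    rintro z ⟨hz, _, ⟨x, hx, rfl⟩, hzx⟩
    have : z = ψ (x, y) := (R.inter_unique _ (hfs y hy) _ (hfu x hx.2)).unique ⟨hz, hzx⟩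
      (hψ x hx.2 y hy)
    rw [this, ← hαe y hy x hx.2]
    exact mem_image_of_mem _ ⟨(hαs y hy hx₁ hx.2 hx.1.1).le, (hαs y hy hx.2 hx₂ hx.1.2).le⟩

end

section

variable {S : Type} [MetricSpace S] [CompactSpace S] [MeasurableSpace S] [BorelSpace S]
  {μ : Measure S} {Ts Tu : MeasuredTurbulation μ}

lemma exists_grid (R : Tartan Ts Tu) (hR : R.Compatible) (hpos : 0 < μ R.core) :
    ∃ G : Grid Ts Tu, G.core = R.core ∧
      (∀ y ∈ G.Ey, G.rows.h y '' Icc (G.rows.a y) (G.rows.b y) ∈ R.fibs) ∧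
      (∀ x ∈ G.Ex, G.cols.h x '' Icc (G.cols.a x) (G.cols.b x) ∈ R.fibu) := by
  have hcm : MeasurableSet R.core := R.borel_s.inter R.borel_u
  obtain ⟨p, hp⟩ := nonempty_of_measure_ne_zero hpos.ne'
  obtain ⟨𝔰, h𝔰, hps⟩ : ∃ A ∈ R.fibs, p ∈ A := by have := hp.1; rwa [← R.fibs_cover] at this
  obtain ⟨𝔲, h𝔲, hpu⟩ : ∃ A ∈ R.fibu, p ∈ A := by have := hp.2; rwa [← R.fibu_cover] at this
  obtain ⟨ords, ordu, o1, o2, o3, o4⟩ := R.oriented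
  obtain ⟨ℓ, hℓ, f, hf, hfi, hfr, a, b, hab, hA, hAo⟩ := o1 𝔰 h𝔰
  obtain ⟨ℓ', hℓ', g, hg, hgi, hgr, c, d, hcd, hB, hBo⟩ := o2 𝔲 h𝔲
  have hsℓ : 𝔰 ⊆ ℓ := by rw [hA, ← hfr]; exact image_subset_range _ _
  have huℓ : 𝔲 ⊆ ℓ' := by rw [hB, ← hgr]; exact image_subset_range _ _
  obtain ⟨ψ, p1, p2, p3, p4, p5, p6⟩ := hR 𝔰 h𝔰 𝔲 h𝔲 ℓ hℓ hsℓ ℓ' hℓ' huℓ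
  set Ex : Set ℝ := {x | x ∈ Icc a b ∧ f x ∈ R.core} with hEx
  set Ey : Set ℝ := {y | y ∈ Icc c d ∧ g y ∈ R.core} with hEy
  have i1 := R.isFiniteMeasure_fibs h𝔰 hℓ hsℓ R.core
  have i2 := R.swap.isFiniteMeasure_fibs h𝔲 hℓ' huℓ R.core
  have ef := hf.measurableEmbedding hfi
  have eg := hg.measurableEmbedding hgi
  have fEx : f '' Ex = 𝔰 ∩ R.core := by
    rw [hA]; ext z; constructor
    · rintro ⟨x, hx, rfl⟩; exact ⟨mem_image_of_mem _ hx.1, hx.2⟩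
    · rintro ⟨⟨x, hx, rfl⟩, h⟩; exact ⟨x, ⟨hx, h⟩, rfl⟩
  have gEy : g '' Ey = 𝔲 ∩ R.core := by
    rw [hB]; ext z; constructor
    · rintro ⟨x, hx, rfl⟩; exact ⟨mem_image_of_mem _ hx.1, hx.2⟩
    · rintro ⟨⟨x, hx, rfl⟩, h⟩; exact ⟨x, ⟨hx, h⟩, rfl⟩
  have mEx : MeasurableSet Ex := measurableSet_Icc.inter (hf.measurable hcm)
  have mEy : MeasurableSet Ey := measurableSet_Icc.inter (hg.measurable hcm)
  set ms := (Ts.ν ℓ).restrict (𝔰 ∩ R.core) with hms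
  set mu := (Tu.ν ℓ').restrict (𝔲 ∩ R.core) with hmu
  obtain ⟨mapx, fin1, na1, cx⟩ := ef.comap_restrict_image mEx fEx i1 (Ts.ν_nonatomic ℓ hℓ)
  obtain ⟨mapy, fin2, na2, cy⟩ := eg.comap_restrict_image mEy gEy i2 (Tu.ν_nonatomic ℓ' hℓ')
  have hfu : ∀ x ∈ Ex, ∃ B ∈ R.fibu, f x ∈ B := fun x hx ↦ by
    have := hx.2.2; rwa [← R.fibu_cover] at this
  have hfs : ∀ y ∈ Ey, ∃ A ∈ R.fibs, g y ∈ A := fun x hx ↦ by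
    have := hx.2.1; rwa [← R.fibs_cover] at this
  choose! fu hfu hfu' using hfu
  choose! fs hfs hfs' using hfs
  have fmem : ∀ x ∈ Ex, f x ∈ 𝔰 ∩ R.core := fun x hx ↦ fEx ▸ mem_image_of_mem _ hx
  have gmem : ∀ x ∈ Ey, g x ∈ 𝔲 ∩ R.core := fun x hx ↦ gEy ▸ mem_image_of_mem _ hx
  have fuinj : InjOn fu Ex := fun x hx x' hx' he ↦ hfi <|
    (R.inter_unique _ h𝔰 _ (hfu x hx)).unique ⟨(fmem x hx).1, hfu' x hx⟩
      ⟨(fmem x' hx').1, he ▸ hfu' x' hx'⟩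
  have fsinj : InjOn fs Ey := fun x hx x' hx' he ↦ hgi <|
    (R.inter_unique _ (hfs x hx) _ h𝔲).unique ⟨hfs' x hx, (gmem x hx).1⟩
      ⟨he ▸ hfs' x' hx', (gmem x' hx').1⟩
  set Ψ : ℝ × ℝ → S := ψ ∘ Prod.map f g with hΨ
  have mΨ : Measurable Ψ := p4.comp (hf.measurable.prodMap hg.measurable)
  have hψ : ∀ x ∈ Ex, ∀ y ∈ Ey, Ψ (x, y) ∈ fs y ∩ fu x := fun x hx y hy ↦
    (p1 _ (fmem x hx) _ (gmem y hy) _ (hfu x hx) (hfu' x hx) _ (hfs y hy) (hfs' y hy)).symm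
  have hcore : Ψ '' (Ex ×ˢ Ey) = R.core := by
    rw [hΨ, image_comp, prodMap_image_prod, fEx, gEy, p3]
  have Ψinj : InjOn Ψ (Ex ×ˢ Ey) := by
    rintro ⟨x, y⟩ ⟨hx, hy⟩ ⟨x', y'⟩ ⟨hx', hy'⟩ he
    have := p2 (show (f x, g y) ∈ _ from ⟨fmem x hx, gmem y hy⟩)
      (show (f x', g y') ∈ _ from ⟨fmem x' hx', gmem y' hy'⟩) he
    simp only [Prod.mk.injEq] at this
    rw [hfi this.1, hgi this.2]
  have hmap : ((ms.comap f).prod (mu.comap g)).map Ψ = μ.restrict R.core := by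
    rw [hΨ, ← Measure.map_map p4 (hf.measurable.prodMap hg.measurable),
      ← Measure.map_prod_map _ _ hf.measurable hg.measurable, mapx, mapy, p6]
  have fux : ∀ I : Set ℝ, R.core ∩ ⋃₀ (fu '' (I ∩ Ex)) = Ψ '' ((I ∩ Ex) ×ˢ Ey) := by
    intro I
    ext z; constructor
    · rintro ⟨hz, _, ⟨x, hx, rfl⟩, hzx⟩
      rw [← hcore] at hz
      obtain ⟨⟨x', y⟩, ⟨hx', hy⟩, rfl⟩ := hz
      have : fu x = fu x' := by_contra fun hne ↦
        (R.fibu_disjoint (hfu x hx.2) (hfu x' hx') hne).le_bot ⟨hzx, (hψ x' hx' y hy).2⟩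
      have := fuinj hx.2 hx' this
      subst this
      exact ⟨_, ⟨hx, hy⟩, rfl⟩
    · rintro ⟨⟨x, y⟩, ⟨hx, hy⟩, rfl⟩
      exact ⟨hcore ▸ mem_image_of_mem _ ⟨hx.2, hy⟩, _, ⟨x, hx, rfl⟩, (hψ x hx.2 y hy).2⟩
  have fsx : ∀ I : Set ℝ, R.core ∩ ⋃₀ (fs '' (I ∩ Ey)) = Ψ '' (Ex ×ˢ (I ∩ Ey)) := by
    intro I
    ext z; constructor
    · rintro ⟨hz, _, ⟨y, hy, rfl⟩, hzx⟩
      rw [← hcore] at hz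
      obtain ⟨⟨x, y'⟩, ⟨hx, hy'⟩, rfl⟩ := hz
      have : fs y = fs y' := by_contra fun hne ↦
        (R.fibs_disjoint (hfs y hy.2) (hfs y' hy') hne).le_bot ⟨hzx, (hψ x hx y' hy').1⟩
      have := fsinj hy.2 hy' this
      subst this
      exact ⟨_, ⟨hx, hy⟩, rfl⟩
    · rintro ⟨⟨x, y⟩, ⟨hx, hy⟩, rfl⟩
      exact ⟨hcore ▸ mem_image_of_mem _ ⟨hx, hy.2⟩, _, ⟨y, hy, rfl⟩, (hψ x hx y hy.2).1⟩
  have immΨ : ∀ Z ⊆ Ex ×ˢ Ey, MeasurableSet Z → MeasurableSet (Ψ '' Z) := fun Z hZ hm ↦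
    hm.image_of_measurable_injOn mΨ (Ψinj.mono hZ)
  have μΨ : ∀ Z ⊆ Ex ×ˢ Ey, MeasurableSet Z →
      (ms.comap f).prod (mu.comap g) Z ≤ μ (Ψ '' Z) := by
    intro Z hZ hm
    calc _ ≤ (ms.comap f).prod (mu.comap g) (Ψ ⁻¹' (Ψ '' Z)) := measure_mono (subset_preimage_image _ _)
      _ = μ.restrict R.core (Ψ '' Z) := by rw [← hmap, Measure.map_apply mΨ (immΨ Z hZ hm)]
      _ ≤ _ := Measure.restrict_apply_le _ _
  have huniv : (ms.comap f) univ * (mu.comap g) univ ≠ 0 := by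
    rw [← Measure.prod_prod, univ_prod_univ, ← preimage_univ (f := Ψ),
      ← Measure.map_apply mΨ .univ, hmap, Measure.restrict_apply_univ]
    exact hpos.ne'
  have hEx' : (ms.comap f) Ex ≠ 0 := fun h ↦ left_ne_zero_of_mul huniv <| by
    rw [← union_compl_self Ex]; exact measure_union_null h cx
  have hEy' : (mu.comap g) Ey ≠ 0 := fun h ↦ right_ne_zero_of_mul huniv <| by
    rw [← union_compl_self Ey]; exact measure_union_null h cy
  have pex : ∀ I : Set ℝ, ms.comap f I ≤ ms.comap f (I ∩ Ex) := fun I ↦ by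
    conv_lhs => rw [← inter_union_compl I Ex]
    refine (measure_union_le _ _).trans ?_
    rw [measure_mono_null inter_subset_right cx, add_zero]
  have pey : ∀ I : Set ℝ, mu.comap g I ≤ mu.comap g (I ∩ Ey) := fun I ↦ by
    conv_lhs => rw [← inter_union_compl I Ey]
    refine (measure_union_le _ _).trans ?_
    rw [measure_mono_null inter_subset_right cy, add_zero]
  obtain ⟨r, hr⟩ := R.exists_rows hR o1 o3 (ψ := Ψ) (px := ms.comap f) hfs hfu fsinj hψ h𝔰 (q := f)
    (fun x hx ↦ ⟨(fmem x hx).1, hfu' x hx⟩) (fun x hx x' hx' ↦ hAo _ hx.1 _ hx'.1)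
    (fun x₁ x₂ ↦ by
      rw [fux]
      exact immΨ _ (prod_mono inter_subset_right subset_rfl) ((measurableSet_Ioo.inter mEx).prod mEy))
    (fun x₁ x₂ h ↦ by
      rw [fux]
      refine lt_of_lt_of_le ?_ (μΨ _ (prod_mono inter_subset_right subset_rfl)
        ((measurableSet_Ioo.inter mEx).prod mEy))
      rw [Measure.prod_prod]
      exact ENNReal.mul_pos (h.trans_le (pex _)).ne' hEy')
  obtain ⟨k, hk⟩ := R.swap.exists_rows hR.swap o2 o4 (ψ := Ψ ∘ Prod.swap) (px := mu.comap g)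
    (fs := fu) (fu := fs) (Ex := Ey) (Ey := Ex) hfu hfs fuinj
    (fun x hx y hy ↦ (hψ y hy x hx).symm) h𝔲 (q := g)
    (fun x hx ↦ ⟨(gmem x hx).1, hfs' x hx⟩) (fun x hx x' hx' ↦ hBo _ hx.1 _ hx'.1)
    (fun x₁ x₂ ↦ by
      rw [core_swap, fsx]
      exact immΨ _ (prod_mono subset_rfl inter_subset_right) (mEx.prod (measurableSet_Ioo.inter mEy)))
    (fun x₁ x₂ h ↦ by
      rw [core_swap, fsx]
      refine lt_of_lt_of_le ?_ (μΨ _ (prod_mono subset_rfl inter_subset_right)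
        (mEx.prod (measurableSet_Ioo.inter mEy)))
      rw [Measure.prod_prod]
      exact ENNReal.mul_pos hEx' (h.trans_le (pey _)).ne')
  refine ⟨⟨Ex, Ey, ms.comap f, mu.comap g, Ψ, R.core, mEx, mEy, fin1, fin2, na1, na2, cx, cy, hcm,
    mΨ, hcore, hmap, r, k, fun y hy x hx s hs t ht he ↦ ?_⟩, rfl, fun y hy ↦ ?_, fun x hx ↦ ?_⟩
  · have e1 : r.h y s ∈ fs y ∩ fu x := ⟨hr y hy ▸ mem_image_of_mem _ hs,
      he ▸ hk x hx ▸ mem_image_of_mem _ ht⟩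
    have e2 := (R.inter_unique _ (hfs y hy) _ (hfu x hx)).unique e1 (hψ x hx y hy)
    exact ⟨r.inj y hy (by rw [e2, r.h_α y hy x hx]),
      k.inj x hx (by rw [← he, e2, k.h_α x hx y hy]; rfl)⟩
  · exact (hr y hy).symm ▸ hfs y hy
  · exact (hk x hx).symm ▸ hfu x hx

end

end Tartan

end

section

namespace Grid

section

variable {S : Type} [MetricSpace S] [MeasurableSpace S]
  {μ : Measure S} {Ts Tu : MeasuredTurbulation μ}

/-- The grid with the roles of rows and columns exchanged. -/
def swap (G : Grid Ts Tu) : Grid Tu Ts where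
  Ex := G.Ey
  Ey := G.Ex
  px := G.py
  py := G.px
  ψ := G.ψ ∘ Prod.swap
  core := G.core
  measurable_Ex := G.measurable_Ey
  measurable_Ey := G.measurable_Ex
  px_fin := G.py_fin
  py_fin := G.px_fin
  px_na := G.py_na
  py_na := G.px_na
  px_compl := G.py_compl
  py_compl := G.px_compl
  measurable_core := G.measurable_core
  measurable_ψ := G.measurable_ψ.comp measurable_swap
  image_ψ := by rw [image_comp, image_swap_prod, G.image_ψ]
  map_ψ := by
    have := G.px_fin
    have := G.py_fin
    rw [← Measure.map_map G.measurable_ψ measurable_swap, Measure.prod_swap, G.map_ψ]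
  rows := G.cols
  cols := G.rows
  cross := fun y hy x hx s hs t ht he ↦ (G.cross x hx y hy t ht s hs he.symm).symm

variable (G : Grid Ts Tu)

lemma ae_mem : ∀ᵐ z ∂G.px.prod G.py, z.1 ∈ G.Ex ∧ z.2 ∈ G.Ey := by
  have := G.px_fin
  have := G.py_fin
  filter_upwards [Measure.quasiMeasurePreserving_fst.ae
    (mem_ae_iff.2 G.px_compl : ∀ᵐ x ∂G.px, x ∈ G.Ex),
    Measure.quasiMeasurePreserving_snd.ae (mem_ae_iff.2 G.py_compl : ∀ᵐ x ∂G.py, x ∈ G.Ey)]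
    with z h1 h2
  exact ⟨h1, h2⟩

lemma ψ_mem {x y : ℝ} (hx : x ∈ G.Ex) (hy : y ∈ G.Ey) : G.ψ (x, y) ∈ G.core :=
  G.image_ψ ▸ mem_image_of_mem _ ⟨hx, hy⟩

lemma core_measure : G.px univ * G.py univ = μ G.core := by
  have := G.px_fin
  have := G.py_fin
  rw [← Measure.prod_prod, univ_prod_univ, ← preimage_univ (f := G.ψ),
    ← Measure.map_apply G.measurable_ψ .univ, G.map_ψ, Measure.restrict_apply_univ]

lemma measure_core_inter {A : Set S} (hA : MeasurableSet A) :
    μ (A ∩ G.core) = G.px.prod G.py (G.ψ ⁻¹' A) := by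
  rw [← Measure.map_apply G.measurable_ψ hA, G.map_ψ, Measure.restrict_apply hA]

end

section

variable {S : Type} [MetricSpace S] [CompactSpace S] [MeasurableSpace S] [BorelSpace S]
  {μ : Measure S} {Ts Tu : MeasuredTurbulation μ} (G : Grid Ts Tu)

/-- A streamline meets the core of a grid in a null set. -/
lemma measure_line_inter_core {ℓ : Set S} (hℓ : ℓ ∈ Ts.lines) : μ (ℓ ∩ G.core) = 0 := by
  have := G.px_fin
  have := G.py_fin
  have := G.px_na
  have := G.py_na
  rcases eq_or_ne (μ G.core) 0 with h0 | h0
  · exact measure_mono_null inter_subset_right h0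
  have hx0 : G.px univ ≠ 0 := fun h ↦ h0 (by rw [← G.core_measure, h, zero_mul])
  have hEx : G.px G.Ex ≠ 0 := fun h ↦ hx0 <| by
    rw [← union_compl_self G.Ex]; exact measure_union_null h G.px_compl
  obtain ⟨f, hf, hi, hr⟩ := Ts.lines_immersed ℓ hℓ
  have hm : MeasurableSet ℓ := hr ▸ (hf.measurableEmbedding hi).measurableSet_range
  obtain ⟨x₁, hx₁, x₂, hx₂, hne⟩ : G.Ex.Nontrivial := by
    by_contra h
    exact hEx ((not_nontrivial_iff.1 h).measure_zero _)
  set D := {y | y ∈ G.Ey ∧ range (G.rows.h y) = ℓ} with hD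
  have hDc : D.Countable := by
    have hσ : SigmaFinite (Ts.ν ℓ) := by
      refine ⟨⟨⟨fun n : ℕ ↦ ℓᶜ ∪ f '' Icc (-n) n, fun _ ↦ trivial, fun n ↦ ?_, ?_⟩⟩⟩
      · refine (measure_union_le _ _).trans_lt ?_
        rw [Ts.ν_supported ℓ hℓ, zero_add, ← hr]
        have hn : (-n : ℝ) ≤ n := by linarith [Nat.cast_nonneg (α := ℝ) n]
        exact Ts.ν_arc_finite _ (hr ▸ hℓ) _ _ _ (.of_param hf hi hn)
      · rw [eq_univ_iff_forall]
        intro z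
        by_cases hz : z ∈ ℓ
        · rw [← hr] at hz
          obtain ⟨t, rfl⟩ := hz
          obtain ⟨n, hn⟩ := exists_nat_ge |t|
          exact mem_iUnion.2 ⟨n, Or.inr (mem_image_of_mem _ (abs_le.1 hn))⟩
        · exact mem_iUnion.2 ⟨0, Or.inl hz⟩
    set As : D → Set S := fun y ↦ G.rows.h y '' Icc (G.rows.a y) (G.rows.b y) with hAs
    have hcount := Measure.countable_meas_pos_of_disjoint_iUnion (μ := Ts.ν ℓ) (As := As)
      (fun y ↦ (isCompact_Icc.image (G.rows.cont y y.2.1)).measurableSet) (by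
        intro y y' hyy
        refine Set.disjoint_left.2 ?_
        rintro z ⟨s, hs, rfl⟩ ⟨s', hs', he⟩
        exact hyy (Subtype.ext (G.rows.disj _ y.2.1 _ y'.2.1 _ hs _ hs' he.symm)))
    have hall : {i : D | 0 < Ts.ν ℓ (As i)} = univ := by
      refine eq_univ_of_forall fun y ↦ ?_
      have h1 := G.rows.α_mem y y.2.1 x₁ hx₁
      have h2 := G.rows.α_mem y y.2.1 x₂ hx₂
      have h3 := (G.rows.α_mono y y.2.1).injOn.ne hx₁ hx₂ hne
      have hlt : G.rows.a y < G.rows.b y := by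
        by_contra hge
        exact h3 (by linarith [h1.1, h1.2, h2.1, h2.2])
      have := Ts.ν_arc_pos _ (G.rows.mem y y.2.1) _ _ _
        (.of_param (G.rows.cont y y.2.1) (G.rows.inj y y.2.1) hlt.le)
        ((G.rows.inj y y.2.1).ne hlt.ne)
      rw [y.2.2] at this
      exact this
    rw [hall] at hcount
    exact countable_coe_iff.1 (countable_univ_iff.1 hcount)
  rw [G.measure_core_inter hm]
  have hsub : ∀ᵐ z ∂G.px.prod G.py, z ∈ G.ψ ⁻¹' ℓ → z ∈ univ ×ˢ D := by
    filter_upwards [G.ae_mem] with z hz hzℓ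
    refine ⟨mem_univ _, hz.2, Ts.line_unique (G.rows.mem _ hz.2) hℓ (x := G.ψ z) ?_ hzℓ⟩
    have := G.rows.h_α z.2 hz.2 z.1 hz.1
    exact ⟨_, this⟩
  refine le_antisymm ((measure_mono_ae (t := univ ×ˢ D) hsub).trans ?_) bot_le
  rw [Measure.prod_prod, hDc.measure_zero, mul_zero]

end

end Grid

section

variable {S : Type} [MetricSpace S] [CompactSpace S] [MeasurableSpace S] [BorelSpace S]
  {μ : Measure S} {Ts Tu : MeasuredTurbulation μ}

lemma FullPair.swap (h : FullPair Ts Tu) : FullPair Tu Ts := by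
  obtain ⟨⟨R, hR, h1⟩, h2⟩ := h
  refine ⟨⟨fun i ↦ (R i).swap, fun i ↦ (hR i).swap, by simpa [Tartan.core_swap] using h1⟩,
    fun U hU hn ↦ ?_⟩
  obtain ⟨R, a, b, c⟩ := h2 U hU hn
  exact ⟨R.swap, a.swap, by rwa [Tartan.core_swap], by
    rw [union_comm]; exact c⟩

lemma FullPair.measure_line [IsProbabilityMeasure μ] (h : FullPair Ts Tu) {ℓ : Set S}
    (hℓ : ℓ ∈ Ts.lines) : μ ℓ = 0 := by
  obtain ⟨⟨R, hR, h1⟩, -⟩ := h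
  have hm : MeasurableSet (⋃ i, (R i).core) :=
    .iUnion fun i ↦ (R i).borel_s.inter (R i).borel_u
  have h2 : μ (⋃ i, (R i).core)ᶜ = 0 := (prob_compl_eq_zero_iff hm).2 h1
  have h3 : ∀ i, μ (ℓ ∩ (R i).core) = 0 := by
    intro i
    rcases eq_or_ne (μ (R i).core) 0 with h0 | h0
    · exact measure_mono_null inter_subset_right h0
    · obtain ⟨G, hG, -⟩ := (R i).exists_grid (hR i) (pos_iff_ne_zero.2 h0)
      rw [← hG]
      exact G.measure_line_inter_core hℓ
  refine measure_mono_null (t := (⋃ i, ℓ ∩ (R i).core) ∪ (⋃ i, (R i).core)ᶜ) ?_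
    (measure_union_null (measure_iUnion_null h3) h2)
  rw [← inter_iUnion]
  intro z hz
  by_cases hz' : z ∈ ⋃ i, (R i).core
  · exact Or.inl ⟨hz, hz'⟩
  · exact Or.inr hz'

end

end

section

section

variable {S : Type} [TopologicalSpace S]

/-- A connected set avoiding the trace of a quad in a planar chart and meeting its hull is contained
in the hull. -/
lemma Quad.subset_image_hull [T2Space S] (Q : Quad) {k : ℂ → S} (hk : IsOpenEmbedding k) {X : Set S}
    (hX : IsPreconnected X) (hd : Disjoint X (k '' Q.trace)) (hm : (X ∩ k '' Q.hull).Nonempty) :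
    X ⊆ k '' Q.hull := by
  have hsub : {p | p ∉ Q.trace ∧ Q.wind p ≠ 0} ⊆ Q.hull := fun p hp ↦ Or.inr hp.2
  have hXV : X ∩ k '' Q.hull ⊆ k '' {p | p ∉ Q.trace ∧ Q.wind p ≠ 0} := by
    rintro _ ⟨hz, p, hp, rfl⟩
    have hpt : p ∉ Q.trace := fun h ↦ hd.le_bot ⟨hz, mem_image_of_mem _ h⟩
    exact mem_image_of_mem _ ⟨hpt, hp.resolve_left hpt⟩
  refine (hX.subset_left_of_subset_union
    (hk.isOpenMap _ (Q.isOpen_wind (fun w ↦ w ≠ 0)))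
    (Q.isCompact_hull.image hk.continuous).isClosed.isOpen_compl
    (disjoint_compl_right.mono_left (image_mono hsub)) (fun z hz ↦ ?_) ?_).trans (image_mono hsub)
  · by_cases hz' : z ∈ k '' Q.hull
    · exact Or.inl (hXV ⟨hz, hz'⟩)
    · exact Or.inr hz'
  · obtain ⟨z, hz⟩ := hm
    exact ⟨z, hz.1, hXV hz⟩

lemma _root_.Topology.IsOpenEmbedding.exists_leftInverse {X Y : Type*} [TopologicalSpace X] [Nonempty X]
    [TopologicalSpace Y] {k : X → Y} (hk : IsOpenEmbedding k) :
    ∃ j : Y → X, ContinuousOn j (range k) ∧ (∀ z ∈ range k, k (j z) = z) ∧ ∀ p, j (k p) = p := by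
  have hl := leftInverse_invFun hk.injective
  refine ⟨invFun k, ?_, fun z hz ↦ invFun_eq hz, hl⟩
  rintro _ ⟨w, rfl⟩
  refine ContinuousAt.continuousWithinAt ?_
  rw [← hk.continuousAt_iff, hl.comp_eq_id]
  exact continuousAt_id

lemma exists_chart_of_notMem_bdry {x : S} (hx : x ∉ ManifoldBdry S) :
    ∃ k : ℂ → S, IsOpenEmbedding k ∧ x ∈ range k := by
  simp only [ManifoldBdry, mem_ofPred_eq, not_not] at hx
  obtain ⟨U, hU, hxU, ⟨e⟩⟩ := hx
  refine ⟨Subtype.val ∘ e.symm ∘ Complex.equivRealProdCLM.toHomeomorph,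
    hU.isOpenEmbedding_subtypeVal.comp (e.symm.isOpenEmbedding.comp
      Complex.equivRealProdCLM.toHomeomorph.isOpenEmbedding), ?_⟩
  refine ⟨Complex.equivRealProdCLM.toHomeomorph.symm (e ⟨x, hxU⟩), ?_⟩
  simp

/-- Two distinct arcs with the same endpoints on an immersed line contain two arcs which
only meet at their endpoints. -/
lemma exists_bigon [T2Space S] {f g : ℝ → S} (hf : Continuous f) (hfi : Injective f)
    (hg : Continuous g) {a b a' b' t₀ : ℝ} (ht₀ : t₀ ∈ Icc a' b')
    (hfa : f a = g a') (hfb : f b = g b') (hab : a ≤ b) (ht : g t₀ ∉ f '' Icc a b) :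
    ∃ p q s t, s < t ∧ f p = g s ∧ f q = g t ∧ ∀ r ∈ Icc s t, ∀ u ∈ uIcc p q, g r = f u →
      (r = s ∧ u = p) ∨ (r = t ∧ u = q) := by
  have hA : IsClosed (f '' Icc a b) := (isCompact_Icc.image hf).isClosed
  have ha' : g a' ∈ f '' Icc a b := ⟨a, left_mem_Icc.2 hab, hfa⟩
  have hb' : g b' ∈ f '' Icc a b := ⟨b, right_mem_Icc.2 hab, hfb⟩
  have hc : IsClosed (g ⁻¹' (f '' Icc a b)) := hA.preimage hg
  obtain ⟨s, hs⟩ := ((isCompact_Icc (a := a') (b := t₀)).inter_right hc).exists_isGreatest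
    ⟨a', left_mem_Icc.2 ht₀.1, ha'⟩
  obtain ⟨t, ht'⟩ := ((isCompact_Icc (a := t₀) (b := b')).inter_right hc).exists_isLeast
    ⟨b', right_mem_Icc.2 ht₀.2, hb'⟩
  obtain ⟨p, hp, hps⟩ := hs.1.2
  obtain ⟨q, hq, hqt⟩ := ht'.1.2
  have hst₀ : s < t₀ := lt_of_le_of_ne hs.1.1.2 fun h ↦ ht (h ▸ hs.1.2)
  have htt₀ : t₀ < t := lt_of_le_of_ne ht'.1.1.1 fun h ↦ ht (h.symm ▸ ht'.1.2)
  refine ⟨p, q, s, t, hst₀.trans htt₀, hps, hqt, fun r hr u hu he ↦ ?_⟩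
  have hrA : g r ∈ f '' Icc a b := ⟨u, uIcc_subset_Icc hp hq hu, he.symm⟩
  rcases le_total r t₀ with h | h
  · have hrs : r = s := le_antisymm (hs.2 ⟨⟨hs.1.1.1.trans hr.1, h⟩, hrA⟩) hr.1
    exact Or.inl ⟨hrs, hfi (by rw [← he, hrs, hps])⟩
  · have hrs : r = t := le_antisymm hr.2 (ht'.2 ⟨⟨h, hr.2.trans ht'.1.1.2⟩, hrA⟩)
    exact Or.inr ⟨hrs, hfi (by rw [← he, hrs, hqt])⟩

end

/-- The arcs of the line `ℓ` are determined by their endpoints. -/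
def UniqueArcs {S : Type} [TopologicalSpace S] (ℓ : Set S) : Prop :=
  ∀ A A' x y, IsArcIn ℓ A x y → IsArcIn ℓ A' x y → A = A'

section

variable {S : Type} [MetricSpace S] [CompactSpace S] [MeasurableSpace S] [BorelSpace S]
  {μ : Measure S} [IsProbabilityMeasure μ] {T : MeasuredTurbulation μ} {G : S ≃ₜ S}

lemma MeasuredTurbulation.ae_mem_lines (T : MeasuredTurbulation μ) : ∀ᵐ x ∂μ, ∃ ℓ ∈ T.lines, x ∈ ℓ :=
  (prob_compl_eq_zero_iff T.domain_borel).2 T.domain_full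

/-- A closed disc in a planar chart whose boundary is contained in a streamline has empty
interior. -/
lemma MeasuredTurbulation.wind_eq_zero_of_trace_subset (T : MeasuredTurbulation μ)
    (hdense : T.DenseStreamlines) (hnull : ∀ ℓ ∈ T.lines, μ ℓ = 0) (hμ : IsOUMeasure μ)
    {k : ℂ → S} (hk : IsOpenEmbedding k) (Q : Quad) {ℓ : Set S} (hℓ : ℓ ∈ T.lines)
    (hQ : k '' Q.trace ⊆ ℓ) {p : ℂ} (hp : p ∉ Q.trace) : Q.wind p = 0 := by
  by_contra hw
  set V := {p | p ∉ Q.trace ∧ Q.wind p ≠ 0} with hV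
  have hVpos : 0 < μ (k '' V) := hμ.openPos _ (hk.isOpenMap _ (Q.isOpen_wind (fun w ↦ w ≠ 0)))
    ⟨_, mem_image_of_mem _ ⟨hp, hw⟩⟩
  have hfr : ∃ᶠ x in ae μ, x ∈ k '' V := frequently_ae_mem_iff.2 hVpos.ne'
  obtain ⟨x, hxV, ⟨ℓ₂, hℓ₂, hx⟩, hxℓ⟩ := (hfr.and_eventually (T.ae_mem_lines.and
    (measure_eq_zero_iff_ae_notMem.1 (hnull ℓ hℓ)))).exists
  have hne : ℓ₂ ≠ ℓ := fun h ↦ hxℓ (h ▸ hx)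
  obtain ⟨f, hf, -, hr⟩ := T.lines_immersed ℓ₂ hℓ₂
  have hsub := Q.subset_image_hull hk (X := ℓ₂) (hr ▸ isPreconnected_range hf)
    ((T.lines_disjoint hℓ₂ hℓ hne).mono_right hQ)
    ⟨x, hx, image_mono (fun p hp ↦ Or.inr hp.2) hxV⟩
  have huniv : k '' Q.hull = univ := by
    rw [← univ_subset_iff, ← (hdense ℓ₂ hℓ₂).closure_eq]
    exact closure_minimal hsub (Q.isCompact_hull.image hk.continuous).isClosed
  have : Q.hull = univ := by
    rw [← preimage_image_eq Q.hull hk.injective, huniv, preimage_univ]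
  exact noncompact_univ ℂ (this ▸ Q.isCompact_hull)

/-- Almost every streamline of a contracted turbulation has unique arcs. -/
lemma Contracts.ae_uniqueArcs (hC : Contracts T G) (hnull : ∀ ℓ ∈ T.lines, μ ℓ = 0)
    (hμ : IsOUMeasure μ) : ∀ᵐ x ∂μ, ∀ ℓ ∈ T.lines, x ∈ ℓ → UniqueArcs ℓ := by
  have hb : ∀ᵐ x ∂μ, x ∉ ManifoldBdry S := measure_eq_zero_iff_ae_notMem.1 hμ.boundaryNull
  filter_upwards [hb, hC.ae_recurrent, hC.good_ae] with x hxb hrec ⟨ℓ', hℓ', hxℓ'⟩ ℓ hℓ hx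
  obtain rfl := T.line_unique (mem_lines_of_good hℓ') hℓ hxℓ' hx
  suffices key : ∀ A A' y z, IsArcIn ℓ' A y z → IsArcIn ℓ' A' y z → A' ⊆ A from
    fun A A' y z h h' ↦ (key A' A y z h' h).antisymm (key A A' y z h h')
  rintro A A' y z ⟨f, hf, hfi, hfr, a, b, hab, rfl, rfl, rfl⟩
    ⟨g, hg, hgi, hgr, a', b', hab', hga, hgb, rfl⟩
  rintro _ ⟨t₀, ht₀, rfl⟩
  by_contra hnot
  have arcF : ∀ u v, IsArcIn ℓ' (f '' uIcc u v) (f u) (f v) := fun u v ↦ by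
    rw [← hfr]; exact .of_param_uIcc hf hfi u v
  have arcG : ∀ u v, u ≤ v → IsArcIn ℓ' (g '' Icc u v) (g u) (g v) := fun u v h ↦ by
    rw [← hgr]; exact .of_param hg hgi h
  obtain ⟨p, q, s, t, hst, hps, hqt, hmeet⟩ := exists_bigon hf hfi hg ht₀ hga.symm
    hgb.symm hab hnot
  have hpq : p ≠ q := fun h ↦ hst.ne (hgi (by rw [← hps, ← hqt, h]))
  obtain ⟨k, hk, hxk⟩ := exists_chart_of_notMem_bdry hxb
  obtain ⟨ε, hε, hεk⟩ := Metric.isOpen_iff.1 hk.isOpen_range x hxk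
  -- all points of the bigon stay uniformly close to the orbit of `x`
  set M := T.ν ℓ' (f '' uIcc p q) + T.ν ℓ' (g '' Icc s t) with hMd
  have hM : M ≠ ⊤ := by
    refine ENNReal.add_ne_top.2 ⟨?_, ?_⟩
    · exact (T.ν_arc_finite _ hℓ _ _ _ (arcF p q)).ne
    · exact (T.ν_arc_finite _ hℓ _ _ _ (arcG s t hst.le)).ne
  have h1 := hC.eventually_dist_lt hM (by positivity : 0 < ε / 3)
  have hfp : f p ∈ ℓ' := hfr ▸ mem_range_self p
  have h2 := hC.eventually_dist_lt_of_mem hℓ' hfp hx (by positivity : 0 < ε / 3)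
  obtain ⟨n, hn, hn1, hn2⟩ := ((hrec _ (Metric.ball_mem_nhds x
    (by positivity : 0 < ε / 3))).and_eventually (h1.and h2)).exists
  have hclose : ∀ w, dist ((⇑G)^[n] w) ((⇑G)^[n] (f p)) < ε / 3 → (⇑G)^[n] w ∈ range k := by
    intro w hw
    refine hεk ?_
    rw [Metric.mem_ball] at hn ⊢
    linarith [dist_triangle4 ((⇑G)^[n] w) ((⇑G)^[n] (f p)) ((⇑G)^[n] x) x]
  have hF : ∀ u ∈ uIcc p q, (⇑G)^[n] (f u) ∈ range k := by
    intro u hu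
    refine hclose _ (hn1 _ hℓ' _ _ _ (arcF u p) ?_)
    refine (measure_mono (image_mono ?_)).trans le_self_add
    exact uIcc_subset_uIcc hu left_mem_uIcc
  have hGG : ∀ r ∈ Icc s t, (⇑G)^[n] (g r) ∈ range k := by
    intro r hr
    refine hclose _ ?_
    rw [hps, dist_comm]
    refine hn1 _ hℓ' _ _ _ (arcG s r hr.1) ?_
    exact (measure_mono (image_mono (Icc_subset_Icc_right hr.2))).trans le_add_self
  have hGn : Continuous (⇑G)^[n] := G.continuous.iterate n
  have hGi : Injective (⇑G)^[n] := G.injective.iterate n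
  obtain ⟨j, hjc, hjl, -⟩ := hk.exists_leftInverse
  set B : ℝ → ℂ := fun v ↦ j ((⇑G)^[n] (f (p + v * (q - p)))) with hB
  set C : ℝ → ℂ := fun v ↦ j ((⇑G)^[n] (g (s + v * (t - s)))) with hCd
  have mB : ∀ v ∈ Icc (0 : ℝ) 1, p + v * (q - p) ∈ uIcc p q := by
    intro v hv
    rw [← segment_eq_uIcc, segment_eq_image']
    exact ⟨v, hv, rfl⟩
  have mC : ∀ v ∈ Icc (0 : ℝ) 1, s + v * (t - s) ∈ Icc s t := by
    intro v hv
    constructor <;> nlinarith [hv.1, hv.2]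
  have kB : ∀ v ∈ Icc (0 : ℝ) 1, k (B v) = (⇑G)^[n] (f (p + v * (q - p))) :=
    fun v hv ↦ hjl _ (hF _ (mB v hv))
  have kC : ∀ v ∈ Icc (0 : ℝ) 1, k (C v) = (⇑G)^[n] (g (s + v * (t - s))) :=
    fun v hv ↦ hjl _ (hGG _ (mC v hv))
  have cB : ContinuousOn B (Icc 0 1) := hjc.comp (by fun_prop) fun v hv ↦ hF _ (mB v hv)
  have cC : ContinuousOn C (Icc 0 1) := hjc.comp (by fun_prop) fun v hv ↦ hGG _ (mC v hv)
  have h0 : B 0 = C 0 := by simp [hB, hCd, hps]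
  have h1' : B 1 = C 1 := by simp [hB, hCd, hqt]
  have eB : ∀ v v', p + v * (q - p) = p + v' * (q - p) → v = v' := fun v v' h ↦
    mul_right_cancel₀ (sub_ne_zero.2 hpq.symm) (add_left_cancel h)
  have eC : ∀ v v', s + v * (t - s) = s + v' * (t - s) → v = v' := fun v v' h ↦
    mul_right_cancel₀ (sub_ne_zero.2 hst.ne') (add_left_cancel h)
  have iB : InjOn B (Icc 0 1) := fun v hv v' hv' h ↦ eB _ _ (hfi (hGi (by
    rw [← kB v hv, ← kB v' hv', h])))
  have iC : InjOn C (Icc 0 1) := fun v hv v' hv' h ↦ eC _ _ (hgi (hGi (by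
    rw [← kC v hv, ← kC v' hv', h])))
  obtain ⟨w, hw, hw0⟩ := exists_wind_biarc_ne_zero cB cC h0 h1' iB iC (by
    intro v hv v' hv' he
    have h3 : g (s + v' * (t - s)) = f (p + v * (q - p)) := by
      apply hGi
      rw [← kB v hv, ← kC v' hv', he]
    rcases hmeet _ (mC v' hv') _ (mB v hv) h3 with ⟨e1, e2⟩ | ⟨e1, e2⟩
    · have e3 : v' = 0 := by
        have : v' * (t - s) = 0 := by linarith
        exact (mul_eq_zero.1 this).resolve_right (sub_ne_zero.2 hst.ne')
      have e4 : v = 0 := by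
        have : v * (q - p) = 0 := by linarith
        exact (mul_eq_zero.1 this).resolve_right (sub_ne_zero.2 hpq.symm)
      exact ⟨by rw [e3, e4], Or.inl e4⟩
    · have e3 : v' = 1 := by
        have : (v' - 1) * (t - s) = 0 := by linarith
        linarith [(mul_eq_zero.1 this).resolve_right (sub_ne_zero.2 hst.ne')]
      have e4 : v = 1 := by
        have : (v - 1) * (q - p) = 0 := by linarith
        linarith [(mul_eq_zero.1 this).resolve_right (sub_ne_zero.2 hpq.symm)]
      exact ⟨by rw [e3, e4], Or.inr e4⟩)
  refine hw0 (T.wind_eq_zero_of_trace_subset hC.dense hnull hμ hk _ (hℓ' n) ?_ (by rwa [biarc_trace]))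
  rw [biarc_trace]
  rintro _ ⟨_, ⟨v, hv, rfl⟩ | ⟨v, hv, rfl⟩, rfl⟩
  · rw [kB v hv]
    exact mem_image_of_mem _ (hfr ▸ mem_range_self _)
  · rw [kC v hv]
    exact mem_image_of_mem _ (hgr ▸ mem_range_self _)

end

end

section

section

/-- A quantitative form of Poincaré recurrence. -/
lemma exists_le_measure_inter_preimage_iterate {X : Type*} [MeasurableSpace X] {μ : Measure X}
    [IsFiniteMeasure μ] {f : X → X} (hf : MeasurePreserving f μ μ) {K : Set X}
    (hK : MeasurableSet K) (h0 : μ K ≠ 0) :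
    ∃ c : ℝ≥0∞, 0 < c ∧ ∀ N : ℕ, ∃ n ≥ N, c ≤ μ (K ∩ (f^[n]) ⁻¹' K) := by
  have h0' : μ K / 2 ≠ 0 := (ENNReal.half_pos h0).ne'
  obtain ⟨m, hm0, hm⟩ := ENNReal.exists_nat_pos_mul_gt h0' (measure_ne_top μ univ)
  have hmR : (m : ℝ≥0∞) ≠ 0 := by exact_mod_cast hm0.ne'
  refine ⟨μ K / 2 / m, ENNReal.div_pos h0' (ENNReal.natCast_ne_top m), fun N ↦ ?_⟩
  by_contra! hcon
  set D : Set X := ⋃ d ∈ Finset.Ioo 0 m, K ∩ (f^[(N + 1) * d]) ⁻¹' K with hD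
  have hDm : MeasurableSet D := Finset.measurableSet_biUnion _ fun d _ ↦
    hK.inter ((hf.measurable.iterate _) hK)
  have hDle : μ D ≤ μ K / 2 := by
    refine (measure_biUnion_finset_le _ _).trans ?_
    refine (Finset.sum_le_card_nsmul _ _ (μ K / 2 / m) fun d hd ↦ ?_).trans ?_
    · refine (hcon _ ?_).le
      have := (Finset.mem_Ioo.1 hd).1
      nlinarith
    · rw [nsmul_eq_mul, Nat.card_Ioo]
      calc ((m - 0 - 1 : ℕ) : ℝ≥0∞) * (μ K / 2 / m) ≤ m * (μ K / 2 / m) := by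
            gcongr; omega
        _ = μ K / 2 := ENNReal.mul_div_cancel hmR (ENNReal.natCast_ne_top m)
  have hKD : μ K / 2 ≤ μ (K \ D) := by
    refine le_trans ?_ (le_measure_sdiff (μ := μ))
    refine le_trans ?_ (tsub_le_tsub_left hDle _)
    rw [ENNReal.sub_half (measure_ne_top μ K)]
  obtain ⟨x, hx, d, hd, hxd⟩ := (hf.iterate (N + 1)).exists_mem_iterate_mem_of_measure_univ_lt_mul_measure
    (hK.diff hDm).nullMeasurableSet (n := m) (hm.trans_le (mul_le_mul_right hKD _))
  rw [← iterate_mul] at hxd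
  exact hx.2 (mem_biUnion (Finset.mem_Ioo.2 hd) ⟨hx.1, hxd.1⟩)

variable {S : Type} [MetricSpace S] [CompactSpace S] [MeasurableSpace S] [BorelSpace S]
  {μ : Measure S} [IsProbabilityMeasure μ]

/-- The Hopf argument: asymptotic points visit a measurable set simultaneously most of the time. -/
lemma eventually_measure_separated_lt {Θ : Type*} [MeasurableSpace Θ] {ρ : Measure Θ}
    {H : S ≃ₜ S} (hH : MeasurePreserving H μ μ) {p q : Θ → S} (hp : Measurable p)
    (hq : Measurable q) {C : ℝ≥0∞} (hC : C ≠ ⊤) (hpC : ρ.map p ≤ C • μ) (hqC : ρ.map q ≤ C • μ)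
    (hd : ∀ ε > 0, ∀ᶠ n : ℕ in atTop, ∀ᵐ θ ∂ρ, dist ((⇑H)^[n] (p θ)) ((⇑H)^[n] (q θ)) < ε)
    {A : Set S} (hA : MeasurableSet A) {δ : ℝ≥0∞} (hδ : 0 < δ) :
    ∀ᶠ n : ℕ in atTop, ρ {θ | (⇑H)^[n] (p θ) ∈ A ∧ (⇑H)^[n] (q θ) ∉ A} < δ := by
  obtain ⟨e, he0, he⟩ : ∃ e : ℝ≥0∞, e ≠ 0 ∧ C * e + C * e < δ := by
    have ht : Tendsto (fun e : ℝ≥0∞ ↦ C * e + C * e) (𝓝[>] 0) (𝓝 (C * 0 + C * 0)) :=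
      ((ENNReal.Tendsto.const_mul tendsto_id (Or.inr hC)).add
        (ENNReal.Tendsto.const_mul tendsto_id (Or.inr hC))).mono_left nhdsWithin_le_nhds
    have h1 := (ht.eventually (gt_mem_nhds (by simpa using hδ))).and self_mem_nhdsWithin
    obtain ⟨e, h2, h3⟩ := h1.exists
    exact ⟨e, (show 0 < e from h3).ne', h2⟩
  obtain ⟨K, hKA, hK, hKe⟩ := hA.exists_isCompact_sdiff_lt (measure_ne_top μ A) he0
  obtain ⟨O, hAO, hO, -, hOe⟩ := hA.exists_isOpen_sdiff_lt (measure_ne_top μ A) he0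
  obtain ⟨ε, hε, hKO⟩ := hK.exists_thickening_subset_open hO (hKA.trans hAO)
  have hmeas : ∀ {r : Θ → S} (n : ℕ), Measurable r → ρ.map r ≤ C • μ → ∀ {B : Set S},
      MeasurableSet B → ρ {θ | (⇑H)^[n] (r θ) ∈ B} ≤ C * μ B := by
    intro r n hr hrC B hB
    have h1 : MeasurableSet ((⇑H)^[n] ⁻¹' B) := (hH.iterate n).measurable hB
    calc ρ {θ | (⇑H)^[n] (r θ) ∈ B} = ρ.map r ((⇑H)^[n] ⁻¹' B) := (Measure.map_apply hr h1).symm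
      _ ≤ (C • μ) ((⇑H)^[n] ⁻¹' B) := hrC _
      _ = C * μ B := by
        rw [Measure.smul_apply, smul_eq_mul, (hH.iterate n).measure_preimage hB.nullMeasurableSet]
  filter_upwards [hd ε hε] with n hn
  refine lt_of_le_of_lt ?_ he
  calc ρ {θ | (⇑H)^[n] (p θ) ∈ A ∧ (⇑H)^[n] (q θ) ∉ A}
      ≤ ρ ({θ | (⇑H)^[n] (p θ) ∈ A \ K} ∪ {θ | (⇑H)^[n] (q θ) ∈ O \ A}) := by
        refine measure_mono_ae ?_
        filter_upwards [hn] with θ hθ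
        rintro ⟨h1, h2⟩
        by_cases h3 : (⇑H)^[n] (p θ) ∈ K
        · refine Or.inr ⟨hKO ?_, h2⟩
          rw [Metric.mem_thickening_iff]
          exact ⟨_, h3, by rwa [dist_comm]⟩
        · exact Or.inl ⟨h1, h3⟩
    _ ≤ C * μ (A \ K) + C * μ (O \ A) := (measure_union_le _ _).trans
        (add_le_add (hmeas n hp hpC (hA.diff hK.measurableSet))
          (hmeas n hq hqC (hO.measurableSet.diff hA)))
    _ ≤ C * e + C * e := by gcongr

end

namespace Grid

variable {S : Type} [MetricSpace S] [CompactSpace S] [MeasurableSpace S] [BorelSpace S]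
  {μ : Measure S} [IsProbabilityMeasure μ] {Ts Tu : MeasuredTurbulation μ} (G : Grid Ts Tu)

lemma injOn_ψ : InjOn G.ψ (G.Ex ×ˢ G.Ey) := by
  rintro ⟨x, y⟩ ⟨hx, hy⟩ ⟨x', y'⟩ ⟨hx', hy'⟩ h
  simp only at hx hy hx' hy'
  rw [← G.rows.h_α y hy x hx, ← G.rows.h_α y' hy' x' hx'] at h
  obtain rfl := G.rows.disj y hy y' hy' _ (G.rows.α_mem y hy x hx) _ (G.rows.α_mem y' hy' x' hx') h
  rw [(G.rows.α_mono y hy).injOn hx hx' (G.rows.inj y hy h)]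

lemma measurableSet_image {Z : Set (ℝ × ℝ)} (hZ : MeasurableSet Z) (hs : Z ⊆ G.Ex ×ˢ G.Ey) :
    MeasurableSet (G.ψ '' Z) :=
  hZ.image_of_measurable_injOn G.measurable_ψ (G.injOn_ψ.mono hs)

lemma ae_of_ae {P : S → Prop} (hP : ∀ᵐ z ∂μ, P z) : ∀ᵐ z ∂G.px.prod G.py, P (G.ψ z) := by
  have h : ∀ᵐ z ∂Measure.map G.ψ (G.px.prod G.py), P z := by
    rw [G.map_ψ]; exact ae_restrict_of_ae hP
  exact ae_of_ae_map G.measurable_ψ.aemeasurable h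

lemma measure_image_le {Z : Set (ℝ × ℝ)} (hZ : MeasurableSet Z) (hs : Z ⊆ G.Ex ×ˢ G.Ey) :
    μ (G.ψ '' Z) ≤ G.px.prod G.py Z := by
  have hc : G.ψ '' Z ⊆ G.core := by rw [← G.image_ψ]; exact image_mono hs
  rw [← inter_eq_left.2 hc, G.measure_core_inter (G.measurableSet_image hZ hs)]
  refine measure_mono_ae ?_
  filter_upwards [G.ae_mem] with z hz hz'
  obtain ⟨w, hw, he⟩ := hz'
  rwa [G.injOn_ψ (hs hw) ⟨hz.1, hz.2⟩ he] at hw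

/-- Row fibers of a grid are contracted. -/
lemma eventually_dist_lt {H : S ≃ₜ S} (hC : Contracts Ts H) {ε : ℝ} (hε : 0 < ε) :
    ∀ᶠ n : ℕ in atTop, ∀ᵐ θ ∂(G.px.prod G.py).prod G.px,
      dist ((⇑H)^[n] (G.ψ θ.1)) ((⇑H)^[n] (G.ψ (θ.2, θ.1.2))) < ε := by
  have := G.px_fin
  have := G.py_fin
  obtain ⟨L, hL, hLb⟩ := G.rows.bdd
  filter_upwards [hC.eventually_dist_lt hL hε] with n hn
  have h1 := Measure.quasiMeasurePreserving_fst (μ := G.px.prod G.py) (ν := G.px).ae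
    (G.ae_mem.and (G.ae_of_ae hC.good_ae))
  have h2 := Measure.quasiMeasurePreserving_snd (μ := G.px.prod G.py) (ν := G.px).ae
    (mem_ae_iff.2 G.px_compl : ∀ᵐ x ∂G.px, x ∈ G.Ex)
  filter_upwards [h1, h2] with ⟨⟨x, y⟩, x'⟩ ⟨⟨hx, hy⟩, ℓ, hℓ, hxℓ⟩ hx'
  simp only at *
  rw [← G.rows.h_α y hy x hx] at hxℓ ⊢
  rw [← G.rows.h_α y hy x' hx']
  obtain rfl := Ts.line_unique (mem_lines_of_good hℓ) (G.rows.mem y hy) hxℓ (mem_range_self _)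
  refine hn _ hℓ _ _ _ (.of_param_uIcc (G.rows.cont y hy) (G.rows.inj y hy) _ _) ?_
  refine (measure_mono (image_mono ?_)).trans (hLb y hy)
  exact uIcc_subset_Icc (G.rows.α_mem y hy x hx) (G.rows.α_mem y hy x' hx')

/-- Most points of the grid which visit `A` at a late time do so together with most of their
row. -/
lemma eventually_section_lt {H : S ≃ₜ S} (hC : Contracts Ts H) {A : Set S} (hA : MeasurableSet A)
    {η δ : ℝ≥0∞} (hη : η ≠ 0) (hδ : 0 < δ) : ∀ᶠ n : ℕ in atTop,
      G.px.prod G.py {z | (⇑H)^[n] (G.ψ z) ∈ A ∧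
        η ≤ G.px {x' | (⇑H)^[n] (G.ψ (x', z.2)) ∉ A}} < δ := by
  have := G.px_fin
  have := G.py_fin
  have hp : Measurable fun θ : (ℝ × ℝ) × ℝ ↦ G.ψ θ.1 := G.measurable_ψ.comp measurable_fst
  have hsw : Measurable fun θ : (ℝ × ℝ) × ℝ ↦ (θ.2, θ.1.2) := by fun_prop
  have hq : Measurable fun θ : (ℝ × ℝ) × ℝ ↦ G.ψ (θ.2, θ.1.2) := G.measurable_ψ.comp hsw
  have hle : μ.restrict G.core ≤ μ := Measure.restrict_le_self
  have m1 : ((G.px.prod G.py).prod G.px).map (fun θ ↦ G.ψ θ.1) ≤ G.px univ • μ := by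
    rw [show (fun θ : (ℝ × ℝ) × ℝ ↦ G.ψ θ.1) = G.ψ ∘ Prod.fst from rfl,
      ← Measure.map_map G.measurable_ψ measurable_fst, Measure.map_fst_prod, Measure.map_smul,
      G.map_ψ]
    gcongr
  have m2 : ((G.px.prod G.py).prod G.px).map (fun θ ↦ G.ψ (θ.2, θ.1.2)) ≤ G.px univ • μ := by
    have h1 : ((G.px.prod G.py).prod G.px).map (fun θ ↦ (θ.2, θ.1.2))
        = G.px univ • G.px.prod G.py := by
      rw [show (fun θ : (ℝ × ℝ) × ℝ ↦ (θ.2, θ.1.2)) =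
        Prod.swap ∘ (Prod.map Prod.snd id) from rfl, ← Measure.map_map measurable_swap
        (by fun_prop), ← Measure.map_prod_map _ _ measurable_snd measurable_id, Measure.map_id,
        Measure.map_snd_prod, Measure.prod_smul_left, Measure.map_smul, Measure.prod_swap]
    rw [show (fun θ : (ℝ × ℝ) × ℝ ↦ G.ψ (θ.2, θ.1.2)) = G.ψ ∘ fun θ ↦ (θ.2, θ.1.2) from rfl,
      ← Measure.map_map G.measurable_ψ hsw, h1, Measure.map_smul, G.map_ψ]
    gcongr
  have key := eventually_measure_separated_lt hC.mp hp hq (measure_ne_top G.px univ) m1 m2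
    (fun ε hε ↦ G.eventually_dist_lt hC hε) hA (ENNReal.mul_pos hη hδ.ne')
  filter_upwards [key] with n hn
  have hHn : Measurable (⇑H)^[n] := (hC.mp.iterate n).measurable
  have hDm : MeasurableSet {θ : (ℝ × ℝ) × ℝ | (⇑H)^[n] (G.ψ θ.1) ∈ A ∧
      (⇑H)^[n] (G.ψ (θ.2, θ.1.2)) ∉ A} :=
    ((hHn.comp hp) hA).inter ((hHn.comp hq) hA).compl
  rw [Measure.prod_apply hDm] at hn
  have h2 := mul_meas_ge_le_lintegral (μ := G.px.prod G.py)
    (measurable_measure_prodMk_left (ν := G.px) hDm) η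
  refine lt_of_mul_lt_mul_left' ((lt_of_le_of_lt ?_ hn) : η * _ < η * δ)
  refine le_trans (mul_le_mul_right (measure_mono ?_) η) h2
  rintro z ⟨hz, hz'⟩
  refine hz'.trans (measure_mono fun x' hx' ↦ ?_)
  exact ⟨hz, hx'⟩

end Grid

end

section

section

variable {S : Type} [MetricSpace S] [CompactSpace S] [MeasurableSpace S] [BorelSpace S]
  {μ : Measure S} [IsProbabilityMeasure μ] {Ts Tu : MeasuredTurbulation μ}

lemma iterate_mem_iff {X : Type*} {f : X → X} {A : Set X} (h : ∀ x, f x ∈ A ↔ x ∈ A) (n : ℕ) (x : X) :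
    f^[n] x ∈ A ↔ x ∈ A := by
  induction n with
  | zero => rfl
  | succ n ih => rw [iterate_succ_apply', h, ih]

lemma exists_mem_of_measure_compl_lt {p : Measure ℝ} {E I : Set ℝ} (hE : p Eᶜ = 0) {P : ℝ → Prop}
    (h : p {x | ¬ P x} < p I) : ∃ x ∈ I, x ∈ E ∧ P x := by
  by_contra! hcon
  refine h.not_ge ((measure_mono_ae ?_))
  filter_upwards [mem_ae_iff.2 hE] with x hx hI
  exact hcon x hI hx

/-- A point of the grid whose column at time `n` contains points which are in the grid at time `0`
both in the upper zone `J₅` and in the lower zone `J₁`. -/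
structure Grid.Returns (G : Grid Ts Tu) (F : S ≃ₜ S) (Ω : Set S) (n : ℕ) (I₃ J₁ J₃ J₅ : Set ℝ)
    (x y : ℝ) where
  x₁ : ℝ
  y₁ : ℝ
  u : ℝ
  l : ℝ
  hx : x ∈ G.Ex
  hy : y ∈ G.Ey
  hx₁ : x₁ ∈ G.Ex
  hy₁ : y₁ ∈ G.Ey
  hx₁I : x₁ ∈ I₃
  hy₁J : y₁ ∈ J₃
  map_eq : (⇑F)^[n] (G.ψ (x, y)) = G.ψ (x₁, y₁)
  mem_Ω : G.ψ (x, y) ∈ Ω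
  hu : u ∈ G.Ey
  hl : l ∈ G.Ey
  huJ : u ∈ J₅
  hlJ : l ∈ J₁
  u_mem : (⇑F.symm)^[n] (G.ψ (x₁, u)) ∈ G.core ∩ Ω
  l_mem : (⇑F.symm)^[n] (G.ψ (x₁, l)) ∈ G.core ∩ Ω

theorem Grid.exists_returns (G : Grid Ts Tu) {F : S ≃ₜ S} (hs : Contracts Ts F)
    (hu : Contracts Tu F.symm) {Ω : Set S} (hΩ : MeasurableSet Ω) (hΩ0 : μ Ωᶜ = 0)
    (hinv : ∀ x, F x ∈ Ω ↔ x ∈ Ω) {I₁ I₃ I₅ J₁ J₃ J₅ : Set ℝ} (mI₃ : MeasurableSet I₃)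
    (mJ₃ : MeasurableSet J₃) (h1 : 0 < G.px I₁) (h3 : 0 < G.px I₃) (h5 : 0 < G.px I₅)
    (k1 : 0 < G.py J₁) (k3 : 0 < G.py J₃) (k5 : 0 < G.py J₅) {P : ℕ → Prop}
    (hP : ∀ᶠ n in atTop, P n) :
    ∃ n, P n ∧ ∃ y ∈ J₃, ∃ xa ∈ I₁, ∃ xb ∈ I₅,
      Nonempty (G.Returns F Ω n I₃ J₁ J₃ J₅ xa y) ∧ Nonempty (G.Returns F Ω n I₃ J₁ J₃ J₅ xb y) := by
  have := G.px_fin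
  have := G.py_fin
  set Z₃ : Set (ℝ × ℝ) := (I₃ ∩ G.Ex) ×ˢ (J₃ ∩ G.Ey) with hZ₃
  have hZ₃m : MeasurableSet Z₃ := (mI₃.inter G.measurable_Ex).prod (mJ₃.inter G.measurable_Ey)
  have hZ₃s : Z₃ ⊆ G.Ex ×ˢ G.Ey := prod_mono inter_subset_right inter_subset_right
  set K : Set S := G.ψ '' Z₃ ∩ Ω with hK
  have hKm : MeasurableSet K := (G.measurableSet_image hZ₃m hZ₃s).inter hΩ
  have hΩψ : ∀ᵐ z ∂G.px.prod G.py, G.ψ z ∈ Ω := G.ae_of_ae (mem_ae_iff.2 hΩ0)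
  have hK0 : μ K ≠ 0 := by
    have hKc : K ⊆ G.core := inter_subset_left.trans (by rw [← G.image_ψ]; exact image_mono hZ₃s)
    rw [← inter_eq_left.2 hKc, G.measure_core_inter hKm]
    refine ((ENNReal.mul_pos h3.ne' k3.ne').trans_le ?_).ne'
    rw [← Measure.prod_prod]
    refine measure_mono_ae ?_
    filter_upwards [G.ae_mem, hΩψ] with z hz hzΩ hz'
    exact ⟨mem_image_of_mem _ ⟨⟨hz'.1, hz.1⟩, ⟨hz'.2, hz.2⟩⟩, hzΩ⟩
  obtain ⟨c, hc0, hc⟩ := exists_le_measure_inter_preimage_iterate hs.mp hKm hK0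
  set A : Set S := G.core ∩ Ω with hA
  have hAm : MeasurableSet A := G.measurable_core.inter hΩ
  obtain ⟨η, hη0, hη1, hη5⟩ : ∃ η : ℝ≥0∞, 0 < η ∧ η + η < G.px I₁ ∧ η + η < G.px I₅ := by
    have hm : min (G.px I₁) (G.px I₅) ≠ 0 := (lt_min h1 h5).ne'
    have hmt : min (G.px I₁) (G.px I₅) ≠ ⊤ := ((min_le_left _ _).trans_lt (measure_lt_top _ _)).ne
    obtain ⟨η, h6, h7⟩ := exists_between (ENNReal.half_pos hm)
    have h8 : η + η < min (G.px I₁) (G.px I₅) := by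
      conv_rhs => rw [← ENNReal.add_halves (min (G.px I₁) (G.px I₅))]
      exact ENNReal.add_lt_add h7 h7
    exact ⟨η, h6, h8.trans_le (min_le_left _ _), h8.trans_le (min_le_right _ _)⟩
  obtain ⟨θ, hθ0, hθ1, hθ5⟩ : ∃ θ : ℝ≥0∞, 0 < θ ∧ θ < G.py J₁ ∧ θ < G.py J₅ := by
    obtain ⟨θ, h6, h7⟩ := exists_between (lt_min k1 k5)
    exact ⟨θ, h6, h7.trans_le (min_le_left _ _), h7.trans_le (min_le_right _ _)⟩
  obtain ⟨e, he0, he⟩ : ∃ e : ℝ≥0∞, 0 < e ∧ G.px univ * e < c / 2 := by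
    have ht : Tendsto (fun e : ℝ≥0∞ ↦ G.px univ * e) (𝓝[>] 0) (𝓝 (G.px univ * 0)) :=
      (ENNReal.Tendsto.const_mul tendsto_id (Or.inr (measure_ne_top _ _))).mono_left
        nhdsWithin_le_nhds
    obtain ⟨e, h2, h3⟩ := ((ht.eventually_lt_const (u := c / 2)
      (by rw [mul_zero]; exact ENNReal.half_pos hc0.ne')).and self_mem_nhdsWithin).exists
    exact ⟨e, h3, h2⟩
  have ev1 := G.eventually_section_lt hs hKm hη0.ne' (ENNReal.half_pos hc0.ne')
  have ev2 := G.swap.eventually_section_lt hu hAm hθ0.ne' (ENNReal.mul_pos hη0.ne' he0.ne')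
  obtain ⟨N, hN⟩ := eventually_atTop.1 (ev1.and (ev2.and hP))
  obtain ⟨n, hnN, hn⟩ := hc N
  obtain ⟨hn1, hn2, hnP⟩ := hN n hnN
  refine ⟨n, hnP, ?_⟩
  have hFn : Measurable (⇑F)^[n] := (hs.mp.iterate n).measurable
  have hFn' : Measurable (⇑F.symm)^[n] := (hu.mp.iterate n).measurable
  -- the points of the grid whose column is bad at time `n`
  set Z : Set (ℝ × ℝ) := {z | (⇑F.symm)^[n] (G.ψ z) ∈ A ∧
    θ ≤ G.py {y' | (⇑F.symm)^[n] (G.ψ (z.1, y')) ∉ A}} ∩ G.Ex ×ˢ G.Ey with hZ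
  have hZm : MeasurableSet Z := by
    have hD : MeasurableSet {z : ℝ × ℝ | (⇑F.symm)^[n] (G.ψ z) ∉ A} :=
      ((hFn'.comp G.measurable_ψ) hAm).compl
    have hD' := (measurable_measure_prodMk_left (ν := G.py) hD).comp
      (measurable_fst : Measurable (Prod.fst : ℝ × ℝ → ℝ))
    exact (((hFn'.comp G.measurable_ψ) hAm).inter (measurableSet_le measurable_const hD')).inter
      (G.measurable_Ex.prod G.measurable_Ey)
  have hZs : Z ⊆ G.Ex ×ˢ G.Ey := inter_subset_right
  have hBm := G.measurableSet_image hZm hZs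
  set B : Set S := G.ψ '' Z with hB
  have hBle : μ B < η * e := by
    refine (G.measure_image_le hZm hZs).trans_lt ?_
    rw [← Measure.prod_swap, Measure.map_apply measurable_swap hZm]
    exact lt_of_le_of_lt (measure_mono fun w hw ↦ hw.1) hn2
  set Y : Set ℝ := {y | η ≤ G.px {x' | (⇑F)^[n] (G.ψ (x', y)) ∈ B}} with hY
  have hYle : G.py Y < e := by
    have hD : MeasurableSet {z : ℝ × ℝ | (⇑F)^[n] (G.ψ z) ∈ B} :=
      (hFn.comp G.measurable_ψ) hBm
    have h6 : G.px.prod G.py {z : ℝ × ℝ | (⇑F)^[n] (G.ψ z) ∈ B} ≤ μ B := by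
      have h7 := G.measure_core_inter (hFn hBm)
      rw [← (hs.mp.iterate n).measure_preimage hBm.nullMeasurableSet]
      exact h7.symm.le.trans (measure_mono inter_subset_left)
    rw [Measure.prod_apply_symm hD] at h6
    refine lt_of_mul_lt_mul_left' (lt_of_le_of_lt ?_ (h6.trans_lt hBle) : η * _ < η * e)
    exact mul_meas_ge_le_lintegral (measurable_measure_prodMk_right hD) η
  obtain ⟨⟨x, y⟩, ⟨hxE, hyE⟩, hxy1, hxy2, hxy3⟩ : ∃ z : ℝ × ℝ, (z.1 ∈ G.Ex ∧ z.2 ∈ G.Ey) ∧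
      G.ψ z ∈ K ∩ (⇑F)^[n] ⁻¹' K ∧ ¬ η ≤ G.px {x' | (⇑F)^[n] (G.ψ (x', z.2)) ∉ K} ∧ z.2 ∉ Y := by
    by_contra! hcon
    have h6 : c ≤ G.px.prod G.py (G.ψ ⁻¹' (K ∩ (⇑F)^[n] ⁻¹' K)) := by
      rw [← G.measure_core_inter (hKm.inter (hFn hKm))]
      refine hn.trans (measure_mono (subset_inter subset_rfl fun z hz ↦ ?_))
      obtain ⟨⟨w, hw, rfl⟩, -⟩ := hz.1
      exact G.ψ_mem hw.1.2 hw.2.2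
    refine h6.not_gt ?_
    calc G.px.prod G.py (G.ψ ⁻¹' (K ∩ (⇑F)^[n] ⁻¹' K))
        ≤ G.px.prod G.py ({z | (⇑F)^[n] (G.ψ z) ∈ K ∧
          η ≤ G.px {x' | (⇑F)^[n] (G.ψ (x', z.2)) ∉ K}} ∪ univ ×ˢ Y) := by
          refine measure_mono_ae ?_
          filter_upwards [G.ae_mem] with z hz hz'
          by_cases h : η ≤ G.px {x' | (⇑F)^[n] (G.ψ (x', z.2)) ∉ K}
          · exact Or.inl ⟨hz'.2, h⟩
          · exact Or.inr ⟨trivial, hcon z hz hz' (not_le.1 h)⟩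
      _ ≤ _ + G.px univ * G.py Y := (measure_union_le _ _).trans (by rw [Measure.prod_prod])
      _ < c / 2 + c / 2 := ENNReal.add_lt_add hn1 ((mul_le_mul_right hYle.le _).trans_lt he)
      _ = c := ENNReal.add_halves c
  simp only at hxE hyE hxy2 hxy3
  have hyJ : y ∈ J₃ := by
    obtain ⟨⟨z, hz, he⟩, -⟩ := hxy1.1
    have := G.injOn_ψ (hZ₃s hz) ⟨hxE, hyE⟩ he
    rw [this] at hz
    exact hz.2.1
  have hΩn : ∀ z, (⇑F)^[n] z ∈ Ω ↔ z ∈ Ω := by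
    exact iterate_mem_iff hinv n
  have key : ∀ I, η + η < G.px I → ∃ x' ∈ I, Nonempty (G.Returns F Ω n I₃ J₁ J₃ J₅ x' y) := by
    intro I hI
    obtain ⟨x', hxI, hx', hx'K, hx'B⟩ := exists_mem_of_measure_compl_lt G.px_compl (I := I)
      (P := fun x' ↦ (⇑F)^[n] (G.ψ (x', y)) ∈ K ∧ (⇑F)^[n] (G.ψ (x', y)) ∉ B) (by
        refine lt_of_le_of_lt ?_ hI
        refine (measure_mono ?_).trans ((measure_union_le _ _).trans
          (add_le_add (not_le.1 hxy2).le (not_le.1 hxy3).le))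
        intro x' hx'
        by_cases h : (⇑F)^[n] (G.ψ (x', y)) ∈ K
        · exact Or.inr (by_contra fun h' ↦ hx' ⟨h, h'⟩)
        · exact Or.inl h)
    obtain ⟨⟨⟨x₁, y₁⟩, hz, hze⟩, hzΩ⟩ := hx'K
    have hxΩ : G.ψ (x', y) ∈ Ω := (hΩn _).1 hzΩ
    have hback : (⇑F.symm)^[n] (G.ψ (x₁, y₁)) = G.ψ (x', y) := by
      rw [hze]
      exact (F.left_inv.iterate n) _
    have hsmall : G.py {y' | (⇑F.symm)^[n] (G.ψ (x₁, y')) ∉ A} < θ := by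
      by_contra! h
      refine hx'B ⟨(x₁, y₁), ⟨⟨?_, h⟩, hZ₃s hz⟩, hze⟩
      rw [hback]
      exact ⟨G.ψ_mem hx' hyE, hxΩ⟩
    obtain ⟨u, huJ, hu, huA⟩ := exists_mem_of_measure_compl_lt G.py_compl (hsmall.trans hθ5)
    obtain ⟨l, hlJ, hl, hlA⟩ := exists_mem_of_measure_compl_lt G.py_compl (hsmall.trans hθ1)
    exact ⟨x', hxI, ⟨⟨x₁, y₁, u, l, hx', hyE, hz.1.2, hz.2.2, hz.1.1, hz.2.1, hze.symm, hxΩ,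
      hu, hl, huJ, hlJ, huA, hlA⟩⟩⟩
  obtain ⟨xa, hxa, ra⟩ := key I₁ hη1
  obtain ⟨xb, hxb, rb⟩ := key I₅ hη5
  exact ⟨y, hyJ, xa, hxa, xb, hxb, ra, rb⟩

end

end

section

section

variable {S : Type} [TopologicalSpace S]

/-- A point of a closed arc through which the arc contains a line in its interior is not an
endpoint, and all parametrizations of a line with unique arcs stay in the arc near that point. -/
lemma UniqueArcs.eventually_mem [T2Space S] {f : ℝ → S} (hf : Continuous f) (hfi : Injective f)
    (hu : UniqueArcs (range f)) {A : Set S} (hA : IsArc (range f) A) {t₀ : ℝ} {c : ℝ → S}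
    (hc : Continuous c) (hci : Injective c) (hcA : range c ⊆ A) (hc0 : c 0 = f t₀) :
    ∀ᶠ t in 𝓝 t₀, f t ∈ A := by
  obtain ⟨_, _, g, hg, hgi, hgr, a, b, hab, rfl, rfl, rfl⟩ := hA
  have hφ : ∀ r, ∃ s ∈ Icc a b, g s = c r := fun r ↦ hcA (mem_range_self r)
  choose φ hφm hφ using hφ
  have hφi : Injective φ := fun r r' h ↦ hci (by rw [← hφ r, ← hφ r', h])
  have hφc : Continuous φ := by
    have hemb : IsClosedEmbedding (fun s : Icc a b ↦ g s) :=
      (hg.comp continuous_subtype_val).isClosedEmbedding (hgi.comp Subtype.val_injective)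
    have : Continuous fun r ↦ (⟨φ r, hφm r⟩ : Icc a b) := by
      rw [hemb.isInducing.continuous_iff]
      convert hc using 1
      exact funext hφ
    exact continuous_subtype_val.comp this
  have hφint : φ 0 ∈ Ioo a b := by
    rcases hφc.strictMono_of_inj hφi with h | h
    · exact ⟨(hφm (-1)).1.trans_lt (h (by norm_num)), (h (zero_lt_one)).trans_le (hφm 1).2⟩
    · exact ⟨(hφm 1).1.trans_lt (h (by norm_num)), (h (by norm_num : (-1 : ℝ) < 0)).trans_le
        (hφm (-1)).2⟩
  have hg0 : g (φ 0) = f t₀ := by rw [hφ, hc0]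
  obtain ⟨ta, hta⟩ : g a ∈ range f := hgr ▸ mem_range_self a
  obtain ⟨tb, htb⟩ : g b ∈ range f := hgr ▸ mem_range_self b
  have hta0 : ta ≠ t₀ := fun h ↦ hφint.1.ne (hgi (by rw [hg0, ← hta, h]))
  have htb0 : tb ≠ t₀ := fun h ↦ hφint.2.ne' (hgi (by rw [hg0, ← htb, h]))
  filter_upwards [Metric.ball_mem_nhds t₀ (dist_pos.2 hta0), Metric.ball_mem_nhds t₀
    (dist_pos.2 htb0)] with t h1 h2
  obtain ⟨s, hs⟩ : f t ∈ range g := hgr ▸ mem_range_self t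
  have hE : f '' uIcc t₀ t = g '' uIcc (φ 0) s := by
    refine hu _ _ (f t₀) (f t) (.of_param_uIcc hf hfi _ _) ?_
    rw [← hgr, ← hg0, ← hs]
    exact .of_param_uIcc hg hgi _ _
  have hno : ∀ {s' t'}, f t' = g s' → dist t t₀ < dist t' t₀ → s' ∉ uIcc (φ 0) s := by
    intro s' t' he hd hs'
    have : g s' ∈ f '' uIcc t₀ t := hE ▸ mem_image_of_mem _ hs'
    rw [← he, hfi.mem_set_image] at this
    have h3 := abs_sub_left_of_mem_uIcc this
    rw [Real.dist_eq, Real.dist_eq] at hd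
    exact hd.not_ge h3
  rw [← hs, hgi.mem_set_image]
  have h3 := hno hta h1
  have h4 := hno htb h2
  rw [mem_uIcc] at h3 h4
  constructor
  · by_contra! h
    exact h3 (Or.inr ⟨h.le, hφint.1.le⟩)
  · by_contra! h
    exact h4 (Or.inl ⟨hφint.2.le, h.le⟩)

end

section

variable {S : Type} [TopologicalSpace S] [MeasurableSpace S] {μ : Measure S}
  {T : MeasuredTurbulation μ} {E E' : Set ℝ} {p : Measure ℝ} {ψ : ℝ × ℝ → S}

/-- A stream arc issued from a grid point, which is shorter than the zones on both sides of the
point, does not leave the fiber of the point. -/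
lemma Rows.exists_param_of_short (r : Rows T E E' p ψ) {y : ℝ} (hy : y ∈ E')
    (hu : UniqueArcs (range (r.h y))) {c₁ c₂ x c₃ c₄ : ℝ} (h₂ : c₂ ∈ E) (hx : x ∈ E)
    (h₃ : c₃ ∈ E) (h2 : c₂ ≤ x) (h3 : x ≤ c₃)
    {A : Set S} {z : S} (hA : IsArcIn (range (r.h y)) A (ψ (x, y)) z)
    (hl : T.ν (range (r.h y)) A < T.ν (range (r.h y)) (r.h y '' Icc (r.α y c₁) (r.α y c₂)))
    (hr : T.ν (range (r.h y)) A < T.ν (range (r.h y)) (r.h y '' Icc (r.α y c₃) (r.α y c₄))) :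
    ∃ t ∈ Ioo (r.α y c₁) (r.α y c₄), r.h y t = z ∧ A = r.h y '' uIcc (r.α y x) t := by
  have hz : z ∈ range (r.h y) := by
    obtain ⟨g, -, -, hgr, a, b, -, -, rfl, -⟩ := hA
    exact hgr ▸ mem_range_self b
  obtain ⟨t, rfl⟩ := hz
  have hm := (r.α_mono y hy).monotoneOn
  have hE : A = r.h y '' uIcc (r.α y x) t := by
    refine hu _ _ _ _ hA ?_
    rw [← r.h_α y hy x hx]
    exact .of_param_uIcc (r.cont y hy) (r.inj y hy) _ _
  refine ⟨t, ⟨?_, ?_⟩, rfl, hE⟩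
  · by_contra! h
    refine hl.not_ge (measure_mono ?_)
    rw [hE]
    exact image_mono (Icc_subset_uIcc'.trans' (Icc_subset_Icc h (hm h₂ hx h2)))
  · by_contra! h
    refine hr.not_ge (measure_mono ?_)
    rw [hE]
    exact image_mono (Icc_subset_uIcc.trans' (Icc_subset_Icc (hm hx h₃ h3) h))

end

section

variable {S : Type} [MetricSpace S] [MeasurableSpace S] [BorelSpace S] {μ : Measure S}
  {T : MeasuredTurbulation μ} {E E' : Set ℝ} {p : Measure ℝ} {ψ : ℝ × ℝ → S}

/-- At time `n` all the good fibers are shorter than the zones `[e₁, e₂]` and `[e₃, e₄]`. -/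
def Rows.Short (r : Rows T E E' p ψ) (F : S ≃ₜ S) (e₁ e₂ e₃ e₄ : ℝ) (n : ℕ) : Prop :=
  ∀ y ∈ E', range (r.h y) ∈ goodLines T F → ∀ s ∈ Icc (r.a y) (r.b y), ∀ t ∈ Icc (r.a y) (r.b y),
    ∀ v ∈ E', T.ν ((⇑F)^[n] '' range (r.h y)) ((⇑F)^[n] '' (r.h y '' uIcc s t)) <
        T.ν (range (r.h v)) (r.h v '' Icc (r.α v e₁) (r.α v e₂)) ∧
      T.ν ((⇑F)^[n] '' range (r.h y)) ((⇑F)^[n] '' (r.h y '' uIcc s t)) <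
        T.ν (range (r.h v)) (r.h v '' Icc (r.α v e₃) (r.α v e₄))

lemma Rows.eventually_short (r : Rows T E E' p ψ) {F : S ≃ₜ S} (hC : Contracts T F)
    {e₁ e₂ e₃ e₄ : ℝ} (h₁ : e₁ ∈ E) (h₂ : e₂ ∈ E) (h₃ : e₃ ∈ E) (h₄ : e₄ ∈ E)
    (h12 : 0 < p (Ioo e₁ e₂)) (h34 : 0 < p (Ioo e₃ e₄)) :
    ∀ᶠ n in atTop, r.Short F e₁ e₂ e₃ e₄ n := by
  obtain ⟨κ, hκ, h5⟩ := r.zone _ h₁ _ h₂ h12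
  obtain ⟨κ', hκ', h6⟩ := r.zone _ h₃ _ h₄ h34
  obtain ⟨L, hL, h7⟩ := r.bdd
  filter_upwards [hC.eventually_ν_lt hL hκ, hC.eventually_ν_lt hL hκ'] with n h8 h9
  intro y hy hg s hs t ht v hv
  have hA := IsArcIn.of_param_uIcc (r.cont y hy) (r.inj y hy) s t
  have hle : T.ν (range (r.h y)) (r.h y '' uIcc s t) ≤ L :=
    (measure_mono (image_mono (ordConnected_Icc.uIcc_subset hs ht))).trans (h7 y hy)
  exact ⟨(h8 _ hg _ _ _ hA hle).trans_le (h5 v hv), (h9 _ hg _ _ _ hA hle).trans_le (h6 v hv)⟩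

/-- If a good grid point returns to the grid when the fibers are short, then its whole fiber is
mapped into the fiber of the image point. -/
lemma Rows.exists_image_param (r : Rows T E E' p ψ) {F : S ≃ₜ S} {e₁ e₂ e₃ e₄ : ℝ} {n : ℕ}
    (hn : r.Short F e₁ e₂ e₃ e₄ n) (h₂ : e₂ ∈ E) (h₃ : e₃ ∈ E) {x y x₁ v : ℝ} (hx : x ∈ E)
    (hy : y ∈ E') (hx₁ : x₁ ∈ E) (hv : v ∈ E') (hm : (⇑F)^[n] (ψ (x, y)) = ψ (x₁, v))
    (hg : range (r.h y) ∈ goodLines T F) (hu : UniqueArcs (range (r.h v)))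
    (h2 : e₂ ≤ x₁) (h3 : x₁ ≤ e₃) :
    (⇑F)^[n] '' range (r.h y) = range (r.h v) ∧
    ∀ t ∈ Icc (r.a y) (r.b y), ∃ t' ∈ Ioo (r.α v e₁) (r.α v e₄), r.h v t' = (⇑F)^[n] (r.h y t) ∧
      (⇑F)^[n] '' (r.h y '' uIcc (r.α y x) t) = r.h v '' uIcc (r.α v x₁) t' := by
  have hl : (⇑F)^[n] '' range (r.h y) = range (r.h v) := by
    refine T.line_unique (hg n) (r.mem v hv) (x := ψ (x₁, v)) ?_ ?_
    · rw [← hm, ← r.h_α y hy x hx]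
      exact mem_image_of_mem _ (mem_range_self _)
    · rw [← r.h_α v hv x₁ hx₁]
      exact mem_range_self _
  refine ⟨hl, fun t ht ↦ ?_⟩
  have hs := hn y hy hg _ (r.α_mem y hy x hx) _ ht v hv
  have hA := (IsArcIn.of_param_uIcc (r.cont y hy) (r.inj y hy) (r.α y x) t).iterate F n
  rw [r.h_α y hy x hx, hm, hl] at hA
  rw [hl] at hs
  exact r.exists_param_of_short hv hu h₂ hx₁ h₃ h2 h3 hA hs.1 hs.2

end

end

section

section

variable {S : Type} [MetricSpace S] [MeasurableSpace S] [BorelSpace S] {μ : Measure S}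
  {Ts Tu : MeasuredTurbulation μ}

/-- An invariant set all of whose points lie on transverse streamlines with unique arcs. -/
structure IsNice (Ts Tu : MeasuredTurbulation μ) (F : S ≃ₜ S) (Ω : Set S) : Prop where
  inv : ∀ x, F x ∈ Ω ↔ x ∈ Ω
  s : ∀ x ∈ Ω, ∀ ℓ ∈ Ts.lines, x ∈ ℓ → ℓ ∈ goodLines Ts F ∧ UniqueArcs ℓ
  u : ∀ x ∈ Ω, ∀ ℓ ∈ Tu.lines, x ∈ ℓ → ℓ ∈ goodLines Tu F.symm ∧ UniqueArcs ℓ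
  tr : ∀ x ∈ Ω, ∃ ℓ ∈ Ts.lines, ∃ ℓ' ∈ Tu.lines, x ∈ ℓ ∧ x ∈ ℓ' ∧ TransverseAt ℓ ℓ' x

/-- A grid point `(x, y)` which is mapped to `(x₁, y₁)` by the `n`-th iterate of `F`, together with
a piece `[lo, hi]` of its column whose image stays in the fiber of the image point. -/
structure Grid.Pulled (G : Grid Ts Tu) (F : S ≃ₜ S) (Ω : Set S) (n : ℕ)
    (e₂ e₃ d₀ d₁ d₂ d₃ d₄ d₅ x y : ℝ) where
  x₁ : ℝ
  y₁ : ℝ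
  lo : ℝ
  hi : ℝ
  wlo : ℝ
  whi : ℝ
  hx : x ∈ G.Ex
  hy : y ∈ G.Ey
  hx₁ : x₁ ∈ G.Ex
  hy₁ : y₁ ∈ G.Ey
  hlo : lo ∈ G.Ey
  hhi : hi ∈ G.Ey
  hwlo : wlo ∈ G.Ey
  hwhi : whi ∈ G.Ey
  x₁_mem : x₁ ∈ Ioo e₂ e₃
  y₁_mem : y₁ ∈ Ioo d₂ d₃
  lo_mem : lo ∈ Ioo d₁ y
  hi_mem : hi ∈ Ioo y d₄
  wlo_mem : wlo ∈ Ioo d₀ d₁ ∪ Ioo d₄ d₅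
  whi_mem : whi ∈ Ioo d₀ d₁ ∪ Ioo d₄ d₅
  map_eq : (⇑F)^[n] (G.ψ (x, y)) = G.ψ (x₁, y₁)
  map_lo : (⇑F)^[n] (G.ψ (x, lo)) = G.ψ (x₁, wlo)
  map_hi : (⇑F)^[n] (G.ψ (x, hi)) = G.ψ (x₁, whi)
  mem_Ω : G.ψ (x, y) ∈ Ω
  lo_mem_Ω : G.ψ (x, lo) ∈ Ω
  hi_mem_Ω : G.ψ (x, hi) ∈ Ω
  range_eq : (⇑F)^[n] '' range (G.cols.h x) = range (G.cols.h x₁)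
  col : ∀ t ∈ Icc (G.cols.α x lo) (G.cols.α x hi), ∃ s ∈ Icc (G.cols.α x₁ d₀) (G.cols.α x₁ d₅),
    (⇑F)^[n] (G.cols.h x t) = G.cols.h x₁ s

lemma iterate_symm_apply {S : Type} [TopologicalSpace S] (F : S ≃ₜ S) (n : ℕ) (z : S) :
    (⇑F)^[n] ((⇑F.symm)^[n] z) = z :=
  (LeftInverse.iterate F.apply_symm_apply n) z

lemma symm_iterate_apply {S : Type} [TopologicalSpace S] (F : S ≃ₜ S) (n : ℕ) (z : S) :
    (⇑F.symm)^[n] ((⇑F)^[n] z) = z :=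
  (LeftInverse.iterate F.symm_apply_apply n) z

theorem Grid.Returns.pulled {G : Grid Ts Tu} {F : S ≃ₜ S} {Ω : Set S} (hΩ : IsNice Ts Tu F Ω)
    {n : ℕ} {e₂ e₃ d₀ d₁ d₂ d₃ d₄ d₅ x y : ℝ} (D0 : d₀ ∈ G.Ey) (D2 : d₂ ∈ G.Ey)
    (D3 : d₃ ∈ G.Ey) (D1 : d₁ ∈ G.Ey) (D4 : d₄ ∈ G.Ey) (D5 : d₅ ∈ G.Ey) (h12 : d₁ ≤ d₂) (h34 : d₃ ≤ d₄)
    (hyd : y ∈ Ioo d₂ d₃)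
    (hn : G.cols.Short F.symm d₁ d₂ d₃ d₄ n)
    (r : G.Returns F Ω n (Ioo e₂ e₃) (Ioo d₀ d₁) (Ioo d₂ d₃) (Ioo d₄ d₅) x y) :
    Nonempty (G.Pulled F Ω n e₂ e₃ d₀ d₁ d₂ d₃ d₄ d₅ x y) := by
  have hx := r.hx
  have hy := r.hy
  have hx₁ := r.hx₁
  have hy₁ := r.hy₁
  have hm' : (⇑F.symm)^[n] (G.ψ (r.x₁, r.y₁)) = G.ψ (x, y) := by
    rw [← r.map_eq, symm_iterate_apply]
  have hΩ₁ : G.ψ (r.x₁, r.y₁) ∈ Ω := by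
    rw [← r.map_eq, iterate_mem_iff hΩ.inv]; exact r.mem_Ω
  have hψc : ∀ {x}, x ∈ G.Ex → ∀ {y}, y ∈ G.Ey → G.cols.h x (G.cols.α x y) = G.ψ (x, y) :=
    fun hx _ hy ↦ G.cols.h_α _ hx _ hy
  have hg := (hΩ.u _ hΩ₁ _ (G.cols.mem _ hx₁) ⟨_, hψc hx₁ hy₁⟩).1
  have hu := (hΩ.u _ r.mem_Ω _ (G.cols.mem _ hx) ⟨_, hψc hx hy⟩).2
  obtain ⟨hr, him⟩ := G.cols.exists_image_param hn D2 D3 hy₁ hx₁ hy hx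
    (by simpa using hm') hg hu hyd.1.le hyd.2.le
  have hαx := (G.cols.α_mono x hx)
  have hαx₁ := (G.cols.α_mono r.x₁ hx₁)
  have hI := G.cols.α_mem x hx
  have hI₁ := G.cols.α_mem r.x₁ hx₁
  have key : ∀ w ∈ G.Ey, (⇑F.symm)^[n] (G.ψ (r.x₁, w)) ∈ G.core →
      ∃ y' ∈ G.Ey, y' ∈ Ioo d₁ d₄ ∧ (⇑F)^[n] (G.ψ (x, y')) = G.ψ (r.x₁, w) ∧
      (⇑F.symm)^[n] '' (G.cols.h r.x₁ '' uIcc (G.cols.α r.x₁ r.y₁) (G.cols.α r.x₁ w)) =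
        G.cols.h x '' uIcc (G.cols.α x y) (G.cols.α x y') := by
    intro w hw hc
    obtain ⟨t', ht', he, hE⟩ := him _ (hI₁ w hw)
    rw [hψc hx₁ hw] at he
    rw [← he, ← G.image_ψ] at hc
    obtain ⟨⟨x', y'⟩, ⟨hx', hy'⟩, hxy⟩ := hc
    rw [← hψc hx' hy'] at hxy
    have htI : t' ∈ Icc (G.cols.a x) (G.cols.b x) :=
      ⟨(hI _ D1).1.trans ht'.1.le, ht'.2.le.trans (hI _ D4).2⟩
    obtain rfl := G.cols.disj _ hx' _ hx _ (G.cols.α_mem _ hx' _ hy') _ htI hxy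
    obtain rfl := G.cols.inj _ hx hxy
    refine ⟨y', hy', ⟨(hαx.lt_iff_lt D1 hy').1 ht'.1, (hαx.lt_iff_lt hy' D4).1 ht'.2⟩, ?_, hE⟩
    rw [← hψc hx hy', he, iterate_symm_apply]
  obtain ⟨p, hp, hpm, hpe, hpE⟩ := key _ r.hu r.u_mem.1
  obtain ⟨q, hq, hqm, hqe, hqE⟩ := key _ r.hl r.l_mem.1
  have hpΩ : G.ψ (x, p) ∈ Ω := by
    rw [← iterate_mem_iff hΩ.inv n, hpe, ← iterate_symm_apply F n (G.ψ (r.x₁, r.u)),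
      iterate_mem_iff hΩ.inv]; exact r.u_mem.2
  have hqΩ : G.ψ (x, q) ∈ Ω := by
    rw [← iterate_mem_iff hΩ.inv n, hqe, ← iterate_symm_apply F n (G.ψ (r.x₁, r.l)),
      iterate_mem_iff hΩ.inv]; exact r.l_mem.2
  have hly : r.l < r.y₁ := (r.hlJ.2.trans_le h12).trans r.hy₁J.1
  have hyu : r.y₁ < r.u := (r.hy₁J.2.trans_le h34).trans r.huJ.1
  have hly' := hαx₁ r.hl hy₁ hly
  have hyu' := hαx₁ hy₁ r.hu hyu
  have inter : uIcc (G.cols.α x y) (G.cols.α x p) ∩ uIcc (G.cols.α x y) (G.cols.α x q) ⊆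
      {G.cols.α x y} := by
    rintro t ⟨htp, htq⟩
    have h1 : G.cols.h x t ∈ _ := mem_image_of_mem (G.cols.h x) htp
    have h2 : G.cols.h x t ∈ _ := mem_image_of_mem (G.cols.h x) htq
    rw [← hpE] at h1
    rw [← hqE] at h2
    obtain ⟨_, ⟨s, hs, rfl⟩, h3⟩ := h1
    obtain ⟨_, ⟨s', hs', rfl⟩, h4⟩ := h2
    have h5 := G.cols.inj _ hx₁ (F.symm.injective.iterate n (h3.trans h4.symm))
    subst h5
    rw [uIcc_of_le hyu'.le] at hs
    rw [uIcc_of_ge hly'.le] at hs'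
    have h6 : s = G.cols.α r.x₁ r.y₁ := le_antisymm hs'.2 hs.1
    rw [h6, hψc hx₁ hy₁, hm', ← hψc hx hy] at h3
    exact (G.cols.inj _ hx h3).symm
  have him1 : ∀ t ∈ uIcc (G.cols.α x y) (G.cols.α x p), ∃ s ∈ Icc (G.cols.α r.x₁ d₀)
      (G.cols.α r.x₁ d₅), (⇑F)^[n] (G.cols.h x t) = G.cols.h r.x₁ s := by
    intro t ht
    have h1 : G.cols.h x t ∈ _ := mem_image_of_mem (G.cols.h x) ht
    rw [← hpE, uIcc_of_le hyu'.le] at h1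
    obtain ⟨_, ⟨s, hs, rfl⟩, h3⟩ := h1
    refine ⟨s, ⟨?_, ?_⟩, by rw [← h3, iterate_symm_apply]⟩
    · exact (hαx₁ D0 hy₁ (r.hlJ.1.trans hly)).le.trans hs.1
    · exact hs.2.trans (hαx₁ r.hu D5 r.huJ.2).le
  have him2 : ∀ t ∈ uIcc (G.cols.α x y) (G.cols.α x q), ∃ s ∈ Icc (G.cols.α r.x₁ d₀)
      (G.cols.α r.x₁ d₅), (⇑F)^[n] (G.cols.h x t) = G.cols.h r.x₁ s := by
    intro t ht
    have h1 : G.cols.h x t ∈ _ := mem_image_of_mem (G.cols.h x) ht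
    rw [← hqE, uIcc_of_ge hly'.le] at h1
    obtain ⟨_, ⟨s, hs, rfl⟩, h3⟩ := h1
    refine ⟨s, ⟨?_, ?_⟩, by rw [← h3, iterate_symm_apply]⟩
    · exact (hαx₁ D0 r.hl r.hlJ.1).le.trans hs.1
    · exact hs.2.trans (hαx₁ hy₁ D5 (hyu.trans r.huJ.2)).le
  have hrange : (⇑F)^[n] '' range (G.cols.h x) = range (G.cols.h r.x₁) := by
    rw [← hr, ← image_comp, (LeftInverse.iterate F.apply_symm_apply n).comp_eq_id, image_id]
  have hpy : p ≠ y := by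
    rintro rfl
    exact hyu'.ne' (G.cols.inj _ hx₁ (by rw [hψc hx₁ r.hu, hψc hx₁ hy₁, ← hpe, r.map_eq]))
  have hqy : q ≠ y := by
    rintro rfl
    exact hly'.ne (G.cols.inj _ hx₁ (by rw [hψc hx₁ r.hl, hψc hx₁ hy₁, ← hqe, r.map_eq]))
  have hmono := hαx.monotoneOn
  rcases lt_or_gt_of_ne hpy with h1 | h1 <;> rcases lt_or_gt_of_ne hqy with h2 | h2
  · exfalso
    have h3 := hαx hp hy h1
    have h4 := hαx hq hy h2
    have h5 := inter ⟨(by rw [uIcc_of_ge h3.le]; exact ⟨le_max_left _ (G.cols.α x q), by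
      simp [h3.le, h4.le]⟩ : max (G.cols.α x p) (G.cols.α x q) ∈ _),
      by rw [uIcc_of_ge h4.le]; exact ⟨le_max_right _ _, by simp [h3.le, h4.le]⟩⟩
    exact (max_lt h3 h4).ne h5
  · exact ⟨⟨r.x₁, r.y₁, p, q, r.u, r.l, hx, hy, hx₁, hy₁, hp, hq, r.hu, r.hl, r.hx₁I, r.hy₁J,
      ⟨hpm.1, h1⟩, ⟨h2, hqm.2⟩, Or.inr r.huJ, Or.inl r.hlJ, r.map_eq, hpe, hqe, r.mem_Ω, hpΩ, hqΩ,
      hrange, fun t ht ↦ (le_total t (G.cols.α x y)).elim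
        (fun h ↦ him1 t (by rw [uIcc_of_ge (hmono hp hy h1.le)]; exact ⟨ht.1, h⟩))
        (fun h ↦ him2 t (by rw [uIcc_of_le (hmono hy hq h2.le)]; exact ⟨h, ht.2⟩))⟩⟩
  · exact ⟨⟨r.x₁, r.y₁, q, p, r.l, r.u, hx, hy, hx₁, hy₁, hq, hp, r.hl, r.hu, r.hx₁I, r.hy₁J,
      ⟨hqm.1, h2⟩, ⟨h1, hpm.2⟩, Or.inl r.hlJ, Or.inr r.huJ, r.map_eq, hqe, hpe, r.mem_Ω, hqΩ, hpΩ,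
      hrange, fun t ht ↦ (le_total t (G.cols.α x y)).elim
        (fun h ↦ him2 t (by rw [uIcc_of_ge (hmono hq hy h2.le)]; exact ⟨ht.1, h⟩))
        (fun h ↦ him1 t (by rw [uIcc_of_le (hmono hy hp h1.le)]; exact ⟨h, ht.2⟩))⟩⟩
  · exfalso
    have h3 := hαx hy hp h1
    have h4 := hαx hy hq h2
    have h5 := inter ⟨(by rw [uIcc_of_le h3.le]; exact ⟨by
      simp [h3.le, h4.le], min_le_left _ (G.cols.α x q)⟩ : min (G.cols.α x p) (G.cols.α x q) ∈ _),
      by rw [uIcc_of_le h4.le]; exact ⟨by simp [h3.le, h4.le], min_le_right _ _⟩⟩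
    exact (lt_min h3 h4).ne' h5

end

end

section

/-- Two transverse families of arcs in the plane, each arc of one family crossing each arc of the
other family once, in a coherent order. -/
structure PlaneGrid where
  Ex : Set ℝ
  Ey : Set ℝ
  h : ℝ → ℝ → ℂ
  a : ℝ → ℝ
  b : ℝ → ℝ
  α : ℝ → ℝ → ℝ
  g : ℝ → ℝ → ℂ
  c : ℝ → ℝ
  d : ℝ → ℝ
  β : ℝ → ℝ → ℝ
  h_cont : ∀ y ∈ Ey, ContinuousOn (h y) (Icc (a y) (b y))
  g_cont : ∀ x ∈ Ex, ContinuousOn (g x) (Icc (c x) (d x))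
  h_inj : ∀ y ∈ Ey, InjOn (h y) (Icc (a y) (b y))
  g_inj : ∀ x ∈ Ex, InjOn (g x) (Icc (c x) (d x))
  h_disj : ∀ y ∈ Ey, ∀ y' ∈ Ey, ∀ s ∈ Icc (a y) (b y), ∀ s' ∈ Icc (a y') (b y'),
    h y s = h y' s' → y = y'
  g_disj : ∀ x ∈ Ex, ∀ x' ∈ Ex, ∀ s ∈ Icc (c x) (d x), ∀ s' ∈ Icc (c x') (d x'),
    g x s = g x' s' → x = x'
  α_mem : ∀ y ∈ Ey, ∀ x ∈ Ex, α y x ∈ Icc (a y) (b y)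
  β_mem : ∀ x ∈ Ex, ∀ y ∈ Ey, β x y ∈ Icc (c x) (d x)
  α_mono : ∀ y ∈ Ey, StrictMonoOn (α y) Ex
  β_mono : ∀ x ∈ Ex, StrictMonoOn (β x) Ey
  meet : ∀ x ∈ Ex, ∀ y ∈ Ey, h y (α y x) = g x (β x y)
  cross : ∀ y ∈ Ey, ∀ x ∈ Ex, ∀ s ∈ Icc (a y) (b y), ∀ t ∈ Icc (c x) (d x),
    h y s = g x t → s = α y x ∧ t = β x y

namespace PlaneGrid

/-- The plane grid with the two families exchanged. -/
def swap (G : PlaneGrid) : PlaneGrid where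
  Ex := G.Ey
  Ey := G.Ex
  h := G.g
  a := G.c
  b := G.d
  α := G.β
  g := G.h
  c := G.a
  d := G.b
  β := G.α
  h_cont := G.g_cont
  g_cont := G.h_cont
  h_inj := G.g_inj
  g_inj := G.h_inj
  h_disj := G.g_disj
  g_disj := G.h_disj
  α_mem := G.β_mem
  β_mem := G.α_mem
  α_mono := G.β_mono
  β_mono := G.α_mono
  meet x hx y hy := (G.meet y hy x hx).symm
  cross x hx y hy s hs t ht he := (G.cross y hy x hx t ht s hs he.symm).symm

variable (G : PlaneGrid)

/-- The points of the subarcs of rows and columns cut by the box `[e, e'] × [d, d']`. -/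
def Win (e e' d d' : ℝ) (z : ℂ) : Prop :=
  (∃ y ∈ G.Ey, y ∈ Icc d d' ∧ ∃ t ∈ Icc (G.α y e) (G.α y e'), z = G.h y t) ∨
    ∃ x ∈ G.Ex, x ∈ Icc e e' ∧ ∃ t ∈ Icc (G.β x d) (G.β x d'), z = G.g x t

lemma Icc_α_subset {y e e' : ℝ} (hy : y ∈ G.Ey) (he : e ∈ G.Ex) (he' : e' ∈ G.Ex) :
    Icc (G.α y e) (G.α y e') ⊆ Icc (G.a y) (G.b y) :=
  Icc_subset_Icc (G.α_mem y hy e he).1 (G.α_mem y hy e' he').2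

lemma Icc_β_subset {x d d' : ℝ} (hx : x ∈ G.Ex) (hd : d ∈ G.Ey) (hd' : d' ∈ G.Ey) :
    Icc (G.β x d) (G.β x d') ⊆ Icc (G.c x) (G.d x) := G.swap.Icc_α_subset hx hd hd'

lemma α_mem_Icc_iff {y e x e' : ℝ} (hy : y ∈ G.Ey) (he : e ∈ G.Ex) (hx : x ∈ G.Ex)
    (he' : e' ∈ G.Ex) : G.α y x ∈ Icc (G.α y e) (G.α y e') ↔ x ∈ Icc e e' :=
  and_congr ((G.α_mono y hy).le_iff_le he hx) ((G.α_mono y hy).le_iff_le hx he')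

lemma β_mem_Icc_iff {x d y d' : ℝ} (hx : x ∈ G.Ex) (hd : d ∈ G.Ey) (hy : y ∈ G.Ey)
    (hd' : d' ∈ G.Ey) : G.β x y ∈ Icc (G.β x d) (G.β x d') ↔ y ∈ Icc d d' :=
  G.swap.α_mem_Icc_iff hx hd hy hd'

lemma not_win_of_win {e e' d d' f f' k k' : ℝ} (he : e ∈ G.Ex) (he' : e' ∈ G.Ex) (hd : d ∈ G.Ey)
    (hd' : d' ∈ G.Ey) (hf : f ∈ G.Ex) (hf' : f' ∈ G.Ex) (hk : k ∈ G.Ey) (hk' : k' ∈ G.Ey)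
    (h1 : Disjoint (Icc e e') (Icc f f')) (h2 : Disjoint (Icc d d') (Icc k k')) {z : ℂ}
    (hz : G.Win e e' d d' z) : ¬ G.Win f f' k k' z := by
  rintro hz'
  rcases hz with ⟨y, hy, hyI, t, ht, rfl⟩ | ⟨x, hx, hxI, t, ht, rfl⟩ <;>
  rcases hz' with ⟨y', hy', hyI', t', ht', hz'⟩ | ⟨x', hx', hxI', t', ht', hz'⟩
  · have := G.h_disj y hy y' hy' t (G.Icc_α_subset hy he he' ht) t' (G.Icc_α_subset hy' hf hf' ht')
      hz'
    exact disjoint_left.1 h2 hyI (this ▸ hyI')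
  · obtain ⟨rfl, -⟩ := G.cross y hy x' hx' t (G.Icc_α_subset hy he he' ht) t'
      (G.Icc_β_subset hx' hk hk' ht') hz'
    exact disjoint_left.1 h1 ((G.α_mem_Icc_iff hy he hx' he').1 ht) hxI'
  · obtain ⟨rfl, -⟩ := G.cross y' hy' x hx t' (G.Icc_α_subset hy' hf hf' ht') t
      (G.Icc_β_subset hx hd hd' ht) hz'.symm
    exact disjoint_left.1 h1 hxI ((G.α_mem_Icc_iff hy' hf hx hf').1 ht')
  · have := G.g_disj x hx x' hx' t (G.Icc_β_subset hx hd hd' ht) t' (G.Icc_β_subset hx' hk hk' ht')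
      hz'
    exact disjoint_left.1 h1 hxI (this ▸ hxI')

lemma wind_row {Q : Quad} {y s t : ℝ} (hy : y ∈ G.Ey) (hs : s ∈ Icc (G.a y) (G.b y))
    (ht : t ∈ Icc (G.a y) (G.b y)) (hd : ∀ r ∈ uIcc s t, G.h y r ∉ Q.trace) :
    Q.wind (G.h y s) = Q.wind (G.h y t) := by
  rcases le_total s t with hst | hst
  · rw [uIcc_of_le hst] at hd
    exact Q.wind_eq_of_path hst ((G.h_cont y hy).mono (Icc_subset_Icc hs.1 ht.2)) hd
  · rw [uIcc_of_ge hst] at hd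
    exact (Q.wind_eq_of_path hst ((G.h_cont y hy).mono (Icc_subset_Icc ht.1 hs.2)) hd).symm

lemma wind_col {Q : Quad} {x s t : ℝ} (hx : x ∈ G.Ex) (hs : s ∈ Icc (G.c x) (G.d x))
    (ht : t ∈ Icc (G.c x) (G.d x)) (hd : ∀ r ∈ uIcc s t, G.g x r ∉ Q.trace) :
    Q.wind (G.g x s) = Q.wind (G.g x t) := G.swap.wind_row hx hs ht hd

/-- A quad which avoids a window has the same winding number about all of its points. -/
lemma wind_win {Q : Quad} {e e' d d' : ℝ} (he : e ∈ G.Ex) (he' : e' ∈ G.Ex) (hd : d ∈ G.Ey)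
    (hd' : d' ∈ G.Ey) (hee : e ≤ e') (hdd : d ≤ d') (hQ : ∀ z, G.Win e e' d d' z → z ∉ Q.trace)
    {z : ℂ} (hz : G.Win e e' d d' z) : Q.wind z = Q.wind (G.h d (G.α d e)) := by
  rcases hz with ⟨y, hy, hyI, t, ht, rfl⟩ | ⟨x, hx, hxI, t, ht, rfl⟩
  · have h1 : Q.wind (G.h y t) = Q.wind (G.h y (G.α y e)) := by
      refine G.wind_row hy (G.Icc_α_subset hy he he' ht) (G.α_mem y hy e he) fun r hr ↦ ?_
      rw [uIcc_of_ge ht.1] at hr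
      exact hQ _ (Or.inl ⟨y, hy, hyI, r, ⟨hr.1, hr.2.trans ht.2⟩, rfl⟩)
    rw [h1, G.meet e he y hy, G.meet e he d hd]
    refine G.wind_col he (G.β_mem e he y hy) (G.β_mem e he d hd) fun r hr ↦ ?_
    have h2 := (G.β_mem_Icc_iff he hd hy hd').2 hyI
    rw [uIcc_of_ge h2.1] at hr
    exact hQ _ (Or.inr ⟨e, he, left_mem_Icc.2 hee, r, ⟨hr.1, hr.2.trans h2.2⟩, rfl⟩)
  · have h1 : Q.wind (G.g x t) = Q.wind (G.g x (G.β x d)) := by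
      refine G.wind_col hx (G.Icc_β_subset hx hd hd' ht) (G.β_mem x hx d hd) fun r hr ↦ ?_
      rw [uIcc_of_ge ht.1] at hr
      exact hQ _ (Or.inr ⟨x, hx, hxI, r, ⟨hr.1, hr.2.trans ht.2⟩, rfl⟩)
    rw [h1, ← G.meet x hx d hd]
    refine G.wind_row hd (G.α_mem d hd x hx) (G.α_mem d hd e he) fun r hr ↦ ?_
    have h2 := (G.α_mem_Icc_iff hd he hx he').2 hxI
    rw [uIcc_of_ge h2.1] at hr
    exact hQ _ (Or.inl ⟨d, hd, left_mem_Icc.2 hdd, r, ⟨hr.1, hr.2.trans h2.2⟩, rfl⟩)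

/-- The grid point `(f, k)` is outside of the box `[e, e'] × [d, d']` and is not surrounded by any
quad in the corresponding window. -/
structure Far (e e' d d' f k : ℝ) : Prop where
  f_mem : f ∈ G.Ex
  k_mem : k ∈ G.Ey
  f_notMem : f ∉ Icc e e'
  k_notMem : k ∉ Icc d d'
  wind : ∀ Q : Quad, (∀ z ∈ Q.trace, G.Win e e' d d' z) → Q.wind (G.h k (G.α k f)) = 0

lemma Far.swap {G : PlaneGrid} {e e' d d' f k : ℝ} (h : G.Far e e' d d' f k) :
    G.swap.Far d d' e e' k f :=
  ⟨h.k_mem, h.f_mem, h.k_notMem, h.f_notMem, fun Q hQ ↦ by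
    rw [← h.wind Q fun z hz ↦ (hQ z hz).symm]
    exact congrArg _ (G.meet f h.f_mem k h.k_mem).symm⟩

lemma far_of_norm_le {e e' d d' f f' k k' : ℝ} (he : e ∈ G.Ex) (he' : e' ∈ G.Ex) (hd : d ∈ G.Ey)
    (hd' : d' ∈ G.Ey) (hf : f ∈ G.Ex) (hf' : f' ∈ G.Ex) (hk : k ∈ G.Ey) (hk' : k' ∈ G.Ey)
    (hff : f ≤ f') (hkk : k ≤ k')
    (h1 : Disjoint (Icc e e') (Icc f f')) (h2 : Disjoint (Icc d d') (Icc k k'))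
    (hle : ∀ z, G.Win e e' d d' z → ∃ w, G.Win f f' k k' w ∧ ‖z‖ ≤ ‖w‖) :
    G.Far e e' d d' f k := by
  refine ⟨hf, hk, fun h ↦ disjoint_left.1 h1 h (left_mem_Icc.2 hff),
    fun h ↦ disjoint_left.1 h2 h (left_mem_Icc.2 hkk), fun Q hQ ↦ ?_⟩
  obtain ⟨z, hz, hmax⟩ := Q.isCompact_trace.exists_isMaxOn
    ⟨_, Q.mapsTo_B (left_mem_Icc.2 zero_le_one)⟩ continuous_norm.continuousOn
  obtain ⟨w, hw, hzw⟩ := hle z (hQ z hz)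
  have hQ' : ∀ z, G.Win f f' k k' z → z ∉ Q.trace := fun z hz hz' ↦
    G.not_win_of_win he he' hd hd' hf hf' hk hk' h1 h2 (hQ z hz') hz
  rw [← G.wind_win hf hf' hk hk' hff hkk hQ' hw]
  exact Q.wind_eq_zero_of_norm_le (hQ' w hw) fun z' hz' ↦ (hmax hz').trans hzw

theorem far_or_far {e e' d d' f f' k k' : ℝ} (he : e ∈ G.Ex) (he' : e' ∈ G.Ex) (hd : d ∈ G.Ey)
    (hd' : d' ∈ G.Ey) (hf : f ∈ G.Ex) (hf' : f' ∈ G.Ex) (hk : k ∈ G.Ey) (hk' : k' ∈ G.Ey)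
    (hee : e ≤ e') (hdd : d ≤ d') (hff : f ≤ f') (hkk : k ≤ k')
    (h1 : Disjoint (Icc e e') (Icc f f')) (h2 : Disjoint (Icc d d') (Icc k k')) :
    G.Far e e' d d' f k ∨ G.Far f f' k k' e d := by
  by_cases hle : ∀ z, G.Win e e' d d' z → ∃ w, G.Win f f' k k' w ∧ ‖z‖ ≤ ‖w‖
  · exact Or.inl (G.far_of_norm_le he he' hd hd' hf hf' hk hk' hff hkk h1 h2 hle)
  · push Not at hle
    obtain ⟨z, hz, hlt⟩ := hle
    exact Or.inr (G.far_of_norm_le hf hf' hk hk' he he' hd hd' hee hdd h1.symm h2.symm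
      fun w hw ↦ ⟨z, hz, (hlt w hw).le⟩)

/-- The points of the rows in `[d, d']` between the columns `e₁` and `e₄`, and of the columns
between `e₁` and `e₄` cut by `[d, d']`. -/
def Band (e₁ e₄ d d' : ℝ) (z : ℂ) : Prop :=
  (∃ y ∈ G.Ey, y ∈ Icc d d' ∧ ∃ t ∈ Ioo (G.α y e₁) (G.α y e₄), z = G.h y t) ∨
    ∃ x ∈ G.Ex, x ∈ Ioo e₁ e₄ ∧ ∃ t ∈ Icc (G.β x d) (G.β x d'), z = G.g x t

lemma wind_eq_zero_of_band {e e₁ e₄ e' d d' f k : ℝ} (he : e ∈ G.Ex) (he₁ : e₁ ∈ G.Ex)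
    (he₄ : e₄ ∈ G.Ex) (he' : e' ∈ G.Ex) (hd : d ∈ G.Ey) (hd' : d' ∈ G.Ey) (h1 : e ≤ e₁)
    (h4 : e₄ ≤ e') (hF : G.Far e e' d d' f k) {Q : Quad} (hQ : ∀ z ∈ Q.trace, G.Band e₁ e₄ d d' z)
    {x : ℝ} (hx : x ∈ G.Ex) (hx' : x ∉ Ioo e₁ e₄) {t : ℝ} (ht : t ∈ Icc (G.c x) (G.d x)) :
    G.g x t ∉ Q.trace ∧ Q.wind (G.g x t) = 0 := by
  have hf := hF.f_mem
  have hk := hF.k_mem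
  have hcol : ∀ t ∈ Icc (G.c x) (G.d x), G.g x t ∉ Q.trace := by
    intro t ht hz
    rcases hQ _ hz with ⟨y, hy, hyI, s, hs, hz⟩ | ⟨x', hx₁, hxI, s, hs, hz⟩
    · obtain ⟨rfl, -⟩ := G.cross y hy x hx s (G.Icc_α_subset hy he₁ he₄ (Ioo_subset_Icc_self hs)) t
        ht hz.symm
      exact hx' ⟨((G.α_mono y hy).lt_iff_lt he₁ hx).1 hs.1,
        ((G.α_mono y hy).lt_iff_lt hx he₄).1 hs.2⟩
    · exact hx' (G.g_disj x hx x' hx₁ t ht s (G.Icc_β_subset hx₁ hd hd' hs) hz ▸ hxI)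
  have hrow : ∀ t ∈ Icc (G.a k) (G.b k), G.h k t ∉ Q.trace := by
    intro t ht hz
    rcases hQ _ hz with ⟨y, hy, hyI, s, hs, hz⟩ | ⟨x', hx₁, hxI, s, hs, hz⟩
    · exact hF.k_notMem (G.h_disj k hk y hy t ht s
        (G.Icc_α_subset hy he₁ he₄ (Ioo_subset_Icc_self hs)) hz ▸ hyI)
    · obtain ⟨-, rfl⟩ := G.cross k hk x' hx₁ t ht s (G.Icc_β_subset hx₁ hd hd' hs) hz
      exact hF.k_notMem ((G.β_mem_Icc_iff hx₁ hd hk hd').1 hs)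
  refine ⟨hcol t ht, ?_⟩
  rw [← hF.wind Q fun z hz ↦ ?_]
  · rw [G.wind_row hk (G.α_mem k hk f hf) (G.α_mem k hk x hx) fun r hr ↦ hrow r
      (ordConnected_Icc.uIcc_subset (G.α_mem k hk f hf) (G.α_mem k hk x hx) hr), G.meet x hx k hk]
    exact G.wind_col hx ht (G.β_mem x hx k hk) fun r hr ↦ hcol r
      (ordConnected_Icc.uIcc_subset ht (G.β_mem x hx k hk) hr)
  · rcases hQ z hz with ⟨y, hy, hyI, s, hs, rfl⟩ | ⟨x', hx₁, hxI, s, hs, rfl⟩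
    · exact Or.inl ⟨y, hy, hyI, s, ⟨((G.α_mono y hy).monotoneOn he he₁ h1).trans hs.1.le,
        hs.2.le.trans ((G.α_mono y hy).monotoneOn he₄ he' h4)⟩, rfl⟩
    · exact Or.inr ⟨x', hx₁, ⟨h1.trans hxI.1.le, hxI.2.le.trans h4⟩, s, hs, rfl⟩

/-- Affine parametrization of a segment. -/
def seg (s t r : ℝ) : ℝ := s + r * (t - s)

@[simp] lemma seg_zero (s t : ℝ) : seg s t 0 = s := by simp [seg]

@[simp] lemma seg_one (s t : ℝ) : seg s t 1 = t := by simp [seg]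

lemma continuous_seg (s t : ℝ) : Continuous (seg s t) := by unfold seg; fun_prop

lemma seg_mem_uIcc {s t r : ℝ} (hr : r ∈ Icc (0 : ℝ) 1) : seg s t r ∈ uIcc s t := by
  have := (convex_uIcc s t) left_mem_uIcc right_mem_uIcc (sub_nonneg.2 hr.2) hr.1 (by ring)
  convert this using 1
  simp [seg]; ring

lemma seg_injective {s t : ℝ} (h : s ≠ t) : Injective (seg s t) := fun _ _ hr ↦
  mul_right_cancel₀ (sub_ne_zero.2 h.symm) (add_left_cancel hr)

lemma mem_Icc_of_seg {y x x' r : ℝ} (hy : y ∈ G.Ey) (hx : x ∈ G.Ex) (hx' : x' ∈ G.Ex)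
    (hr : r ∈ Icc (0 : ℝ) 1) : seg (G.α y x) (G.α y x') r ∈ Icc (G.a y) (G.b y) :=
  ordConnected_Icc.uIcc_subset (G.α_mem y hy x hx) (G.α_mem y hy x' hx') (seg_mem_uIcc hr)

lemma mem_Icc_of_seg' {x y y' r : ℝ} (hx : x ∈ G.Ex) (hy : y ∈ G.Ey) (hy' : y' ∈ G.Ey)
    (hr : r ∈ Icc (0 : ℝ) 1) : seg (G.β x y) (G.β x y') r ∈ Icc (G.c x) (G.d x) :=
  G.swap.mem_Icc_of_seg hx hy hy' hr

/-- The quad bounded by two rows and two columns. -/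
def rect {x x' y y' : ℝ} (hx : x ∈ G.Ex) (hx' : x' ∈ G.Ex) (hy : y ∈ G.Ey) (hy' : y' ∈ G.Ey) :
    Quad where
  B r := G.h y (seg (G.α y x) (G.α y x') r)
  R r := G.g x' (seg (G.β x' y) (G.β x' y') r)
  T r := G.h y' (seg (G.α y' x) (G.α y' x') r)
  L r := G.g x (seg (G.β x y) (G.β x y') r)
  contB := (G.h_cont y hy).comp (continuous_seg _ _).continuousOn
    fun _ hr ↦ G.mem_Icc_of_seg hy hx hx' hr
  contR := (G.g_cont x' hx').comp (continuous_seg _ _).continuousOn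
    fun _ hr ↦ G.mem_Icc_of_seg' hx' hy hy' hr
  contT := (G.h_cont y' hy').comp (continuous_seg _ _).continuousOn
    fun _ hr ↦ G.mem_Icc_of_seg hy' hx hx' hr
  contL := (G.g_cont x hx).comp (continuous_seg _ _).continuousOn
    fun _ hr ↦ G.mem_Icc_of_seg' hx hy hy' hr
  B_zero := by simp [G.meet x hx y hy]
  B_one := by simp [G.meet x' hx' y hy]
  T_zero := by simp [G.meet x hx y' hy']
  T_one := by simp [G.meet x' hx' y' hy']

/-- The quad bounded by two rows in `(d₁, d₄)` and two columns in `[e, e']` does not meet nor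
surround the other rows. -/
lemma wind_rect {e e' d d₁ d₄ d' f k : ℝ} (he : e ∈ G.Ex) (he' : e' ∈ G.Ex) (hd : d ∈ G.Ey)
    (hd₁ : d₁ ∈ G.Ey) (hd₄ : d₄ ∈ G.Ey) (hd' : d' ∈ G.Ey) (h1 : d ≤ d₁) (h4 : d₄ ≤ d')
    (hF : G.Far e e' d d' f k) {x x' y y' : ℝ} (hx : x ∈ G.Ex) (hx' : x' ∈ G.Ex) (hy : y ∈ G.Ey)
    (hy' : y' ∈ G.Ey) (hxe : x ∈ Icc e e') (hxe' : x' ∈ Icc e e') (hyd : y ∈ Ioo d₁ d₄)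
    (hyd' : y' ∈ Ioo d₁ d₄) {v : ℝ} (hv : v ∈ G.Ey) (hv' : v ∉ Ioo d₁ d₄) {t : ℝ}
    (ht : t ∈ Icc (G.a v) (G.b v)) :
    G.h v t ∉ (G.rect hx hx' hy hy').trace ∧ (G.rect hx hx' hy hy').wind (G.h v t) = 0 := by
  refine G.swap.wind_eq_zero_of_band hd hd₁ hd₄ hd' he he' h1 h4 hF.swap ?_ hv hv' ht
  have hα : ∀ {v}, v ∈ G.Ey → ∀ {r}, r ∈ Icc (0 : ℝ) 1 →
      seg (G.α v x) (G.α v x') r ∈ Icc (G.α v e) (G.α v e') := fun hv _ hr ↦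
    ordConnected_Icc.uIcc_subset ((G.α_mem_Icc_iff hv he hx he').2 hxe)
      ((G.α_mem_Icc_iff hv he hx' he').2 hxe') (seg_mem_uIcc hr)
  have hβ : ∀ {w}, w ∈ G.Ex → ∀ {r}, r ∈ Icc (0 : ℝ) 1 →
      seg (G.β w y) (G.β w y') r ∈ Ioo (G.β w d₁) (G.β w d₄) := fun hw _ hr ↦
    ordConnected_Ioo.uIcc_subset ⟨G.β_mono _ hw hd₁ hy hyd.1, G.β_mono _ hw hy hd₄ hyd.2⟩
      ⟨G.β_mono _ hw hd₁ hy' hyd'.1, G.β_mono _ hw hy' hd₄ hyd'.2⟩ (seg_mem_uIcc hr)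
  exact (Quad.trace_subset_iff _ (A := {z | G.swap.Band d₁ d₄ e e' z})).2 ⟨fun r hr ↦ Or.inr ⟨y, hy, hyd, _, hα hy hr, rfl⟩,
    fun r hr ↦ Or.inl ⟨x', hx', hxe', _, hβ hx' hr, rfl⟩,
    fun r hr ↦ Or.inr ⟨y', hy', hyd', _, hα hy' hr, rfl⟩,
    fun r hr ↦ Or.inl ⟨x, hx, hxe, _, hβ hx hr, rfl⟩⟩

end PlaneGrid

end

section

namespace PlaneGrid

lemma exists_seg_eq {s t u : ℝ} (hu : u ∈ Ioo s t) : ∃ r ∈ Ioo (0 : ℝ) 1, seg s t r = u := by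
  have h0 : 0 < t - s := sub_pos.2 (hu.1.trans hu.2)
  refine ⟨(u - s) / (t - s), ⟨div_pos (sub_pos.2 hu.1) h0, (div_lt_one h0).2 (by linarith [hu.2])⟩, ?_⟩
  rw [seg, div_mul_cancel₀ _ h0.ne']; ring

lemma eventually_seg {s t r : ℝ} {P : ℝ → Prop} (h : ∀ᶠ u in 𝓝 (seg s t r), P u) :
    ∀ᶠ q in 𝓝 r, P (seg s t q) := (continuous_seg s t).continuousAt.eventually h

variable (G : PlaneGrid)

/-- A map which stretches a rectangle of the grid across itself has a fixed point. -/
theorem exists_fixedPt_of_rect {Φ : ℂ → ℂ} {e₀ e₁ e₂ e₃ e₄ e₅ d₀ d₁ d₂ d₃ d₄ d₅ f k : ℝ}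
    (E0 : e₀ ∈ G.Ex) (E1 : e₁ ∈ G.Ex) (E4 : e₄ ∈ G.Ex) (E5 : e₅ ∈ G.Ex) (D0 : d₀ ∈ G.Ey)
    (D1 : d₁ ∈ G.Ey) (D4 : d₄ ∈ G.Ey) (D5 : d₅ ∈ G.Ey) (he01 : e₀ < e₁) (he12 : e₁ < e₂)
    (he34 : e₃ < e₄) (he45 : e₄ < e₅) (hd01 : d₀ < d₁) (hd12 : d₁ < d₂)
    (hd34 : d₃ < d₄) (hd45 : d₄ < d₅) (hF : G.Far e₀ e₅ d₀ d₅ f k)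
    {xa xb y lo hi xa' xb' y' wlo whi : ℝ} (hxa : xa ∈ G.Ex) (hxb : xb ∈ G.Ex) (hy : y ∈ G.Ey)
    (hlo : lo ∈ G.Ey) (hhi : hi ∈ G.Ey) (hxa' : xa' ∈ G.Ex) (hxb' : xb' ∈ G.Ex) (hy' : y' ∈ G.Ey)
    (hwlo : wlo ∈ G.Ey) (hwhi : whi ∈ G.Ey) (mxa : xa ∈ Ioo e₀ e₁) (mxb : xb ∈ Ioo e₄ e₅)
    (mlo : lo ∈ Ioo d₁ y) (mhi : hi ∈ Ioo y d₄) (mxa' : xa' ∈ Ioo e₂ e₃) (mxb' : xb' ∈ Ioo e₂ e₃)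
    (my' : y' ∈ Ioo d₂ d₃) (mwlo : wlo ∈ Ioo d₀ d₁ ∪ Ioo d₄ d₅)
    (mwhi : whi ∈ Ioo d₀ d₁ ∪ Ioo d₄ d₅)
    (rlo : ∀ t ∈ Icc (G.a lo) (G.b lo), ∃ s ∈ Ioo (G.α wlo e₁) (G.α wlo e₄),
      Φ (G.h lo t) = G.h wlo s)
    (rhi : ∀ t ∈ Icc (G.a hi) (G.b hi), ∃ s ∈ Ioo (G.α whi e₁) (G.α whi e₄),
      Φ (G.h hi t) = G.h whi s)
    (ca : ∀ t ∈ Icc (G.β xa lo) (G.β xa hi), ∃ s ∈ Icc (G.β xa' d₀) (G.β xa' d₅),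
      Φ (G.g xa t) = G.g xa' s)
    (cb : ∀ t ∈ Icc (G.β xb lo) (G.β xb hi), ∃ s ∈ Icc (G.β xb' d₀) (G.β xb' d₅),
      Φ (G.g xb t) = G.g xb' s)
    (hm : Φ (G.g xb (G.β xb y)) = G.h y' (G.α y' xb'))
    (hinj : InjOn (fun t ↦ Φ (G.g xb t)) (Icc (G.β xb lo) (G.β xb hi)))
    {ε : ℝ} (hε : 0 < ε) {κ : ℝ × ℝ → ℂ} (hκ : ContinuousOn κ (Icc (-ε) ε ×ˢ Icc (-ε) ε))
    (hκi : InjOn κ (Icc (-ε) ε ×ˢ Icc (-ε) ε))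
    (κr : ∀ᶠ s in 𝓝 (G.α y' xb'), ∃ r ∈ Icc (-ε) ε, G.h y' s = κ (r, 0))
    (κc : ∀ᶠ t in 𝓝 (G.β xb y), ∃ q ∈ Icc (-ε) ε, Φ (G.g xb t) = κ (0, q))
    (hΦ : ContinuousOn Φ (G.rect hxa hxb hlo hhi).hull) :
    ∃ z ∈ (G.rect hxa hxb hlo hhi).hull, Φ z = z := by
  set P := G.rect hxa hxb hlo hhi with hP
  set Q := G.rect hxa hxb hlo hy' with hQ
  have hlohi : lo < hi := mlo.2.trans mhi.1
  have mlo' : lo ∈ Ioo d₁ d₄ := ⟨mlo.1, hlohi.trans mhi.2⟩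
  have mhi' : hi ∈ Ioo d₁ d₄ := ⟨mlo.1.trans hlohi, mhi.2⟩
  have my'' : y' ∈ Ioo d₁ d₄ := ⟨hd12.trans my'.1, my'.2.trans hd34⟩
  have nw : ∀ {w}, w ∈ Ioo d₀ d₁ ∪ Ioo d₄ d₅ → w ∉ Ioo d₁ d₄ := by
    rintro w (h | h) h'
    · exact h.2.not_gt h'.1
    · exact h.1.not_gt h'.2
  have wI : ∀ {w}, w ∈ Ioo d₀ d₁ ∪ Ioo d₄ d₅ → w ∈ Icc d₀ d₅ := by
    rintro w (h | h)
    · exact ⟨h.1.le, by linarith [h.2, mlo'.1, mlo'.2]⟩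
    · exact ⟨by linarith [h.1, mlo'.1, mlo'.2], h.2.le⟩
  have xI : ∀ {x}, x ∈ Ioo e₂ e₃ → x ∈ Ioo e₁ e₄ := fun h ↦ ⟨he12.trans h.1, h.2.trans he34⟩
  have xae : xa ∈ Icc e₀ e₅ := ⟨mxa.1.le, by linarith [mxa.2, mxa'.1, mxa'.2]⟩
  have xbe : xb ∈ Icc e₀ e₅ := ⟨by linarith [mxb.1, mxa'.1, mxa'.2], mxb.2.le⟩
  have nxa : xa ∉ Ioo e₁ e₄ := fun h ↦ h.1.not_gt mxa.2
  have nxb : xb ∉ Ioo e₁ e₄ := fun h ↦ h.2.not_gt mxb.1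
  have segr : ∀ {v}, v ∈ G.Ey → ∀ {r}, r ∈ Icc (0 : ℝ) 1 →
      seg (G.α v xa) (G.α v xb) r ∈ Icc (G.a v) (G.b v) := fun hv _ hr ↦
    G.mem_Icc_of_seg hv hxa hxb hr
  have segc : ∀ {x}, x ∈ G.Ex → ∀ {r}, r ∈ Icc (0 : ℝ) 1 →
      seg (G.β x lo) (G.β x hi) r ∈ Icc (G.β x lo) (G.β x hi) := fun {x} hx _ hr ↦ by
    have := seg_mem_uIcc (s := G.β x lo) (t := G.β x hi) hr
    rwa [uIcc_of_le (G.β_mono x hx hlo hhi hlohi).le] at this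
  have segc' : ∀ {x v}, x ∈ G.Ex → v ∈ G.Ey → ∀ {r}, r ∈ Icc (0 : ℝ) 1 →
      seg (G.β x lo) (G.β x v) r ∈ Icc (G.c x) (G.d x) := fun hx hv _ hr ↦
    G.mem_Icc_of_seg' hx hlo hv hr
  have rowne : ∀ {v w}, v ∈ G.Ey → w ∈ G.Ey → v ∈ Ioo d₁ d₄ → w ∈ Ioo d₀ d₁ ∪ Ioo d₄ d₅ →
      (∀ t ∈ Icc (G.a v) (G.b v), ∃ s ∈ Ioo (G.α w e₁) (G.α w e₄), Φ (G.h v t) = G.h w s) →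
      ∀ s ∈ Icc (0 : ℝ) 1, ∀ t ∈ Icc (0 : ℝ) 1, Φ (G.h v (seg (G.α v xa) (G.α v xb) t)) ≠
        G.h v (seg (G.α v xa) (G.α v xb) s) := by
    intro v w hv hw mv mw hr s hs t ht he
    obtain ⟨s', hs', h⟩ := hr _ (segr hv ht)
    rw [h] at he
    exact nw mw (G.h_disj _ hw _ hv _ (G.Icc_α_subset hw E1 E4 (Ioo_subset_Icc_self hs')) _
      (segr hv hs) he ▸ mv)
  have colne : ∀ {x x' x'' v}, x ∈ G.Ex → x' ∈ G.Ex → x'' ∈ G.Ex → v ∈ G.Ey → x' ∈ Ioo e₂ e₃ →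
      x'' ∉ Ioo e₁ e₄ →
      (∀ t ∈ Icc (G.β x lo) (G.β x hi), ∃ s ∈ Icc (G.β x' d₀) (G.β x' d₅), Φ (G.g x t) = G.g x' s) →
      ∀ s ∈ Icc (0 : ℝ) 1, ∀ t ∈ Icc (0 : ℝ) 1, Φ (G.g x (seg (G.β x lo) (G.β x hi) t)) ≠
        G.g x'' (seg (G.β x'' lo) (G.β x'' v) s) := by
    intro x x' x'' v hx hx' hx'' hv mx' mx'' hr s hs t ht he
    obtain ⟨s', hs', h⟩ := hr _ (segc hx ht)
    rw [h] at he
    exact mx'' (G.g_disj _ hx' _ hx'' _ (G.Icc_β_subset hx' D0 D5 hs') _ (segc' hx'' hv hs) he ▸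
      xI mx')
  have hR0 : P.R 0 = G.h lo (G.α lo xb) := by simp [hP, rect, G.meet xb hxb lo hlo]
  have hR1 : P.R 1 = G.h hi (G.α hi xb) := by simp [hP, rect, G.meet xb hxb hi hhi]
  obtain ⟨s0, hs0, hs0'⟩ := rlo _ (G.α_mem lo hlo xb hxb)
  obtain ⟨s1, hs1, hs1'⟩ := rhi _ (G.α_mem hi hhi xb hxb)
  have w0 : ∀ {v} (hv : v ∈ G.Ey), v ∈ Ioo d₁ d₄ →
      Φ (P.R 0) ∉ (G.rect hxa hxb hlo hv).trace ∧ (G.rect hxa hxb hlo hv).wind (Φ (P.R 0)) = 0 := by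
    intro v hv mv
    rw [hR0, hs0']
    exact G.wind_rect E0 E5 D0 D1 D4 D5 hd01.le hd45.le hF hxa hxb hlo hv xae xbe mlo' mv hwlo
      (nw mwlo) (G.Icc_α_subset hwlo E1 E4 (Ioo_subset_Icc_self hs0))
  have w1 : ∀ {v} (hv : v ∈ G.Ey), v ∈ Ioo d₁ d₄ →
      Φ (P.R 1) ∉ (G.rect hxa hxb hlo hv).trace ∧ (G.rect hxa hxb hlo hv).wind (Φ (P.R 1)) = 0 := by
    intro v hv mv
    rw [hR1, hs1']
    exact G.wind_rect E0 E5 D0 D1 D4 D5 hd01.le hd45.le hF hxa hxb hlo hv xae xbe mlo' mv hwhi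
      (nw mwhi) (G.Icc_α_subset hwhi E1 E4 (Ioo_subset_Icc_self hs1))
  refine P.exists_fixedPt hΦ (rowne hlo hwlo mlo' mwlo rlo) (colne hxb hxb' hxb hhi mxb' nxb cb)
    (rowne hhi hwhi mhi' mwhi rhi) (colne hxa hxa' hxa hhi mxa' nxa ca) ?_ ?_
    (w1 hhi mhi').1 (w1 hhi mhi').2 Q (fun s _ ↦ rfl) (colne hxb hxb' hxb hy' mxb' nxb cb)
    (colne hxb hxb' hxa hy' mxb' nxa cb) (w0 hy' my'').1 (w0 hy' my'').2 (w1 hy' my'').1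
    (w1 hy' my'').2 ?_
  · intro s hs t ht he
    obtain ⟨s', hs', h⟩ := rhi _ (segr hhi ht)
    have he' : G.h whi s' = G.g xa (seg (G.β xa lo) (G.β xa hi) s) := h ▸ he
    obtain ⟨rfl, -⟩ := G.cross _ hwhi _ hxa _ (G.Icc_α_subset hwhi E1 E4 (Ioo_subset_Icc_self hs'))
      _ (segc' hxa hhi hs) he'
    exact (((G.α_mono _ hwhi).lt_iff_lt E1 hxa).1 hs'.1).not_gt mxa.2
  · have hB0 : P.B 0 = G.g xa (G.β xa lo) := by simp [hP, rect, G.meet xa hxa lo hlo]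
    rw [hB0]
    refine (G.wind_eq_zero_of_band E0 E1 E4 E5 D0 D5 he01.le he45.le hF ?_ hxa nxa
      (G.β_mem xa hxa lo hlo)).2
    refine (Quad.trace_subset_iff _ (A := {z | G.Band e₁ e₄ d₀ d₅ z})).2
      ⟨fun r hr ↦ ?_, fun r hr ↦ ?_, fun r hr ↦ ?_, fun r hr ↦ ?_⟩
    · obtain ⟨s', hs', h⟩ := rlo _ (segr hlo hr)
      exact Or.inl ⟨wlo, hwlo, wI mwlo, s', hs', h⟩
    · obtain ⟨s', hs', h⟩ := cb _ (segc hxb hr)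
      exact Or.inr ⟨xb', hxb', xI mxb', s', hs', h⟩
    · obtain ⟨s', hs', h⟩ := rhi _ (segr hhi hr)
      exact Or.inl ⟨whi, hwhi, wI mwhi, s', hs', h⟩
    · obtain ⟨s', hs', h⟩ := ca _ (segc hxa hr)
      exact Or.inr ⟨xa', hxa', xI mxa', s', hs', h⟩
  · have hxab : xa < xb := by linarith [mxa.2, mxb.1, mxa'.1, mxa'.2]
    obtain ⟨s₀, hs₀, hs₀'⟩ := exists_seg_eq (s := G.α y' xa) (t := G.α y' xb) (u := G.α y' xb')
      ⟨G.α_mono _ hy' hxa hxb' (by linarith [mxa.2, mxb'.1]),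
        G.α_mono _ hy' hxb' hxb (by linarith [mxb.1, mxb'.2])⟩
    obtain ⟨t₀, ht₀, ht₀'⟩ := exists_seg_eq (s := G.β xb lo) (t := G.β xb hi) (u := G.β xb y)
      ⟨G.β_mono _ hxb hlo hy mlo.2, G.β_mono _ hxb hy hhi mhi.1⟩
    have hβne := (G.β_mono _ hxb hlo hhi hlohi).ne
    have hαne := (G.α_mono _ hy' hxa hxb hxab).ne
    have ht₀I := Ioo_subset_Icc_self ht₀
    have hρi : InjOn (fun t ↦ Φ (P.R t)) (Icc 0 1) := fun t ht t' ht' he ↦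
      seg_injective hβne (hinj (segc hxb ht) (segc hxb ht') he)
    refine bvar_ne_zero_of_transverse (α := Q.T) (ρ := fun t ↦ Φ (P.R t)) Q.contT
      ((hΦ.mono P.trace_subset_hull).comp P.contR P.mapsTo_R)
      (fun s hs s' hs' he ↦ seg_injective hαne (G.h_inj _ hy' (segr hy' hs) (segr hy' hs') he))
      hρi hs₀ ht₀ (fun s hs t ht he ↦ ?_) ?_ hε hκ hκi ?_ ?_
    · obtain ⟨s', hs', h⟩ := cb _ (segc hxb ht)
      have he' : G.h y' (seg (G.α y' xa) (G.α y' xb) s) = G.g xb' s' := he.trans h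
      have h2 := (G.cross _ hy' _ hxb' _ (segr hy' hs) _ (G.Icc_β_subset hxb' D0 D5 hs') he').1
      rw [← hs₀'] at h2
      obtain rfl := seg_injective hαne h2
      refine ⟨rfl, hρi ht ht₀I (he.symm.trans ?_)⟩
      change G.h y' (seg (G.α y' xa) (G.α y' xb) s) = Φ (G.g xb (seg (G.β xb lo) (G.β xb hi) t₀))
      rw [ht₀', hs₀', hm]
    · change G.h y' (seg (G.α y' xa) (G.α y' xb) s₀) = Φ (G.g xb (seg (G.β xb lo) (G.β xb hi) t₀))
      rw [ht₀', hs₀', hm]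
    · rw [← hs₀'] at κr
      exact eventually_seg κr
    · rw [← ht₀'] at κc
      exact eventually_seg κc

end PlaneGrid

end

section

lemma Complex.isConnected_compl_closedBall {r : ℝ} (hr : 0 < r) :
    IsConnected (Metric.closedBall (0 : ℂ) r)ᶜ := by
  have h : (Metric.closedBall (0 : ℂ) r)ᶜ = Complex.exp '' {z | Real.log r < z.re} := by
    ext z
    rw [mem_compl_iff, Metric.mem_closedBall, dist_zero_right, not_le]
    constructor
    · intro hz
      have hz0 : z ≠ 0 := norm_pos_iff.1 (hr.trans hz)
      exact ⟨Complex.log z, by simpa [Complex.log_re] using Real.log_lt_log hr hz,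
        Complex.exp_log hz0⟩
    · rintro ⟨w, hw, rfl⟩
      rw [Complex.norm_exp]
      exact (Real.log_lt_iff_lt_exp hr).1 hw
  rw [h]
  refine IsConnected.image ⟨⟨((Real.log r + 1 : ℝ) : ℂ), ?_⟩, ?_⟩ _
    Complex.continuous_exp.continuousOn
  · simp
  · exact (convex_halfSpace_re_gt _).isPreconnected

section

variable {S : Type} [TopologicalSpace S]

/-- Near a transverse intersection point, the two lines are the axes of a small square. -/
lemma TransverseAt.exists_square [T2Space S] {ℓ ℓ' V : Set S} {x : S} (h : TransverseAt ℓ ℓ' x)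
    (hu : UniqueArcs ℓ) (hu' : UniqueArcs ℓ') (hV : IsOpen V) (hx : x ∈ V) :
    ∃ ε > 0, ∃ κ : ℝ × ℝ → S, Continuous κ ∧ Injective κ ∧
      MapsTo κ (Icc (-ε) ε ×ˢ Icc (-ε) ε) V ∧
      (∀ (f : ℝ → S) (t₀ : ℝ), Continuous f → Injective f → range f = ℓ → f t₀ = x →
        ∀ᶠ t in 𝓝 t₀, ∃ r ∈ Icc (-ε) ε, f t = κ (r, 0)) ∧
      (∀ (f : ℝ → S) (t₀ : ℝ), Continuous f → Injective f → range f = ℓ' → f t₀ = x →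
        ∀ᶠ t in 𝓝 t₀, ∃ r ∈ Icc (-ε) ε, f t = κ (0, r)) := by
  obtain ⟨α, β, hxα, hxβ, hα, hβ, U, hU, hxU, e, hα', hβ'⟩ := h
  set κ : ℝ × ℝ → S := Subtype.val ∘ e.symm with hκd
  have hκ : Continuous κ := continuous_subtype_val.comp e.symm.continuous
  have hκi : Injective κ := Subtype.val_injective.comp e.symm.injective
  have hκo : IsOpenMap κ := hU.isOpenMap_subtype_val.comp e.symm.isOpenMap
  have kα : ∀ p : ℝ × ℝ, κ p ∈ α ↔ p.2 = 0 := by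
    intro p
    have h1 : κ p ∈ α ∩ U ↔ p.2 = 0 := by
      rw [← hα']
      constructor
      · rintro ⟨u, hu, hup⟩
        rw [show u = e.symm p from Subtype.ext hup] at hu
        simpa using hu
      · exact fun h ↦ ⟨e.symm p, by simpa using h, rfl⟩
    rw [← h1]
    exact ⟨fun h ↦ ⟨h, (e.symm p).2⟩, fun h ↦ h.1⟩
  have kβ : ∀ p : ℝ × ℝ, κ p ∈ β ↔ p.1 = 0 := by
    intro p
    have h1 : κ p ∈ β ∩ U ↔ p.1 = 0 := by
      rw [← hβ']
      constructor
      · rintro ⟨u, hu, hup⟩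
        rw [show u = e.symm p from Subtype.ext hup] at hu
        simpa using hu
      · exact fun h ↦ ⟨e.symm p, by simpa using h, rfl⟩
    rw [← h1]
    exact ⟨fun h ↦ ⟨h, (e.symm p).2⟩, fun h ↦ h.1⟩
  have hκx : κ (e ⟨x, hxU⟩) = x := by simp [hκd]
  have h0 : κ (0, 0) = x := by
    have h1 := (kα _).1 (hκx ▸ hxα)
    have h2 := (kβ _).1 (hκx ▸ hxβ)
    rw [← hκx, show e ⟨x, hxU⟩ = (0, 0) from Prod.ext h2 h1]
  have hVn : κ ⁻¹' V ∈ 𝓝 ((0, 0) : ℝ × ℝ) := hκ.continuousAt.preimage_mem_nhds (by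
    rw [h0]; exact hV.mem_nhds hx)
  obtain ⟨ε, hε, hεV⟩ := Metric.nhds_basis_closedBall.mem_iff.1 hVn
  have hball : κ '' Metric.ball (0, 0) ε ∈ 𝓝 x :=
    (hκo _ Metric.isOpen_ball).mem_nhds ⟨_, Metric.mem_ball_self hε, h0⟩
  have hIcc : ∀ p ∈ Metric.ball ((0, 0) : ℝ × ℝ) ε, p.1 ∈ Icc (-ε) ε ∧ p.2 ∈ Icc (-ε) ε := by
    rintro ⟨r, s⟩ hp
    rw [Metric.mem_ball, Prod.dist_eq, max_lt_iff, Real.dist_0_eq_abs, Real.dist_0_eq_abs] at hp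
    exact ⟨abs_le.1 hp.1.le, abs_le.1 hp.2.le⟩
  refine ⟨ε, hε, κ, hκ, hκi, ?_, ?_, ?_⟩
  · rintro ⟨r, s⟩ ⟨hr, hs⟩
    refine hεV ?_
    rw [Metric.mem_closedBall, Prod.dist_eq, max_le_iff, Real.dist_0_eq_abs, Real.dist_0_eq_abs]
    exact ⟨abs_le.2 hr, abs_le.2 hs⟩
  · rintro f t₀ hf hfi rfl hft
    have h1 := hu.eventually_mem hf hfi hα (c := fun r ↦ κ (r, 0)) (t₀ := t₀) (by fun_prop)
      (fun r s hrs ↦ (Prod.ext_iff.1 (hκi hrs)).1) (by rintro _ ⟨r, rfl⟩; exact (kα _).2 rfl)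
      (h0.trans hft.symm)
    filter_upwards [h1, hf.continuousAt.eventually (hft ▸ hball)] with t ht ⟨p, hp, hpt⟩
    have hp2 : p.2 = 0 := (kα p).1 (hpt ▸ ht)
    exact ⟨p.1, (hIcc p hp).1, by rw [← hpt, ← hp2]⟩
  · rintro f t₀ hf hfi rfl hft
    have h1 := hu'.eventually_mem hf hfi hβ (c := fun r ↦ κ (0, r)) (t₀ := t₀) (by fun_prop)
      (fun r s hrs ↦ (Prod.ext_iff.1 (hκi hrs)).2) (by rintro _ ⟨r, rfl⟩; exact (kβ _).2 rfl)
      (h0.trans hft.symm)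
    filter_upwards [h1, hf.continuousAt.eventually (hft ▸ hball)] with t ht ⟨p, hp, hpt⟩
    have hp2 : p.1 = 0 := (kβ p).1 (hpt ▸ ht)
    exact ⟨p.2, (hIcc p hp).2, by rw [← hpt, ← hp2]⟩

/-- The complement of a closed disk in a connected surface is connected. -/
lemma isPreconnected_compl_image_closedBall [T2Space S] [PreconnectedSpace S] {k : ℂ → S}
    (hk : IsOpenEmbedding k) {r : ℝ} (hr : 0 < r) :
    IsPreconnected (k '' Metric.closedBall 0 r)ᶜ := by
  set C := (k '' Metric.closedBall 0 r)ᶜ with hC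
  have hCo : IsOpen C :=
    ((isCompact_closedBall 0 r).image hk.continuous).isClosed.isOpen_compl
  have hA : IsConnected (k '' (Metric.closedBall 0 r)ᶜ) := by
    refine IsConnected.image ?_ k hk.continuous.continuousOn
    exact Complex.isConnected_compl_closedBall hr
  have hAC : k '' (Metric.closedBall 0 r)ᶜ ⊆ C := by
    rintro _ ⟨z, hz, rfl⟩ ⟨w, hw, hwz⟩
    exact hz (hk.injective hwz ▸ hw)
  have key : ∀ u v : Set S, IsOpen u → IsOpen v → u ∪ v = C → Disjoint u v →
      k '' (Metric.closedBall 0 r)ᶜ ⊆ u → v = ∅ := by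
    intro u v hu hv huv hd hAu
    have hvc : vᶜ = u ∪ k '' Metric.ball 0 (r + 1) := by
      ext z
      constructor
      · intro hz
        by_cases hzC : z ∈ C
        · rw [← huv] at hzC
          exact Or.inl (hzC.resolve_right hz)
        · obtain ⟨w, hw, rfl⟩ := not_not.1 hzC
          exact Or.inr (mem_image_of_mem _ (Metric.closedBall_subset_ball (by linarith) hw))
      · rintro (hz | ⟨w, hw, rfl⟩) hzv
        · exact disjoint_left.1 hd hz hzv
        · by_cases hw' : w ∈ Metric.closedBall 0 r
          · exact (huv ▸ Or.inr hzv : k w ∈ C) (mem_image_of_mem _ hw')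
          · exact disjoint_left.1 hd (hAu (mem_image_of_mem _ hw')) hzv
    have hclopen : IsClopen v := by
      refine ⟨⟨?_⟩, hv⟩
      rw [hvc]
      exact hu.union (hk.isOpenMap _ Metric.isOpen_ball)
    refine (isClopen_iff.1 hclopen).resolve_right fun h ↦ ?_
    obtain ⟨z, hz⟩ := hA.nonempty
    exact disjoint_left.1 hd (hAu hz) (h ▸ mem_univ z)
  intro u v hu hv huv hCu hCv
  by_contra hne
  rw [not_nonempty_iff_eq_empty] at hne
  have hd : Disjoint (C ∩ u) (C ∩ v) := by
    rw [disjoint_left]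
    rintro z ⟨hz, hzu⟩ ⟨-, hzv⟩
    exact (hne ▸ ⟨hz, hzu, hzv⟩ : z ∈ (∅ : Set S))
  have hun : C ∩ u ∪ C ∩ v = C := by rw [← inter_union_distrib_left, inter_eq_left.2 huv]
  rcases hA.isPreconnected.subset_or_subset (hCo.inter hu) (hCo.inter hv) hd
    (by rw [hun]; exact hAC) with h | h
  · exact hCv.ne_empty (key _ _ (hCo.inter hu) (hCo.inter hv) hun hd h)
  · exact hCu.ne_empty (key _ _ (hCo.inter hv) (hCo.inter hu) (by rw [union_comm, hun]) hd.symm h)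

/-- A measure preserving embedding which maps the boundary of a quad into a small disk maps the
whole quad into this disk. -/
lemma Quad.mapsTo_hull_of_trace [T2Space S] [PreconnectedSpace S] [MeasurableSpace S] [BorelSpace S]
    {μ : Measure S} [IsProbabilityMeasure μ] (Q : Quad) {k : ℂ → S} (hk : IsOpenEmbedding k)
    (hμ : μ (range k) < 1 / 2) {Φ : S → S} (hΦ : IsOpenEmbedding Φ) (hmp : MeasurePreserving Φ μ μ)
    (h : ∀ z ∈ Q.trace, Φ (k z) ∈ range k) : ∀ z ∈ Q.hull, Φ (k z) ∈ range k := by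
  obtain ⟨j, hjc, hjl, hjr⟩ := hk.exists_leftInverse
  have hc : IsCompact ((fun z ↦ j (Φ (k z))) '' Q.trace) :=
    Q.isCompact_trace.image_of_continuousOn
      (hjc.comp (hΦ.continuous.comp hk.continuous).continuousOn h)
  obtain ⟨r, hr⟩ := hc.isBounded.subset_closedBall (0 : ℂ)
  have hr' := hr.trans (Metric.closedBall_subset_closedBall (le_max_left r 1))
  set C := (k '' Metric.closedBall 0 (max r 1))ᶜ with hC
  have hd : Disjoint C ((Φ ∘ k) '' Q.trace) := by
    rw [disjoint_left]
    rintro _ hz ⟨z, hzt, rfl⟩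
    exact hz ⟨_, hr' (mem_image_of_mem _ hzt), hjl _ (h z hzt)⟩
  intro z hz
  by_contra hn
  have hsub := Q.subset_image_hull (hΦ.comp hk)
    (isPreconnected_compl_image_closedBall hk (lt_max_of_lt_right one_pos)) hd
    ⟨Φ (k z), fun h ↦ hn (image_subset_range _ _ h), mem_image_of_mem _ hz⟩
  have h1 : μ C ≤ μ (range k) := by
    calc μ C ≤ μ (Φ '' range k) := measure_mono (hsub.trans (by
          rw [image_comp]; exact image_mono (image_subset_range _ _)))
      _ = μ (range k) := by
          rw [← hmp.measure_preimage (hΦ.isOpenMap _ hk.isOpen_range).measurableSet.nullMeasurableSet,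
            preimage_image_eq _ hΦ.injective]
  have h2 : (1 : ℝ≥0∞) ≤ μ (range k) + μ C := by
    rw [← measure_univ (μ := μ)]
    refine (measure_mono fun z _ ↦ ?_).trans (measure_union_le _ _)
    by_cases hz : z ∈ range k
    · exact Or.inl hz
    · exact Or.inr fun h ↦ hz (image_subset_range _ _ h)
  have h3 : (1 : ℝ≥0∞) < 1 / 2 + 1 / 2 := (h2.trans (by gcongr)).trans_lt (ENNReal.add_lt_add hμ hμ)
  rw [ENNReal.add_halves] at h3
  exact h3.false

end

/-- A non-atomic measure has an increasing sequence of thresholds with positive gaps in between. -/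
lemma exists_thresholds {p : Measure ℝ} [NullSingletonClass p] {E : Set ℝ} (hE : p Eᶜ = 0)
    (hp : p univ ≠ 0) :
    ∃ c : ℕ → ℝ, StrictMono c ∧ (∀ i, c i ∈ E) ∧ ∀ i, 0 < p (Ioo (c i) (c (i + 1))) := by
  have hsupp : ∀ᵐ x ∂p, x ∈ p.support := Measure.support_mem_ae
  have hE' : ∀ᵐ x ∂p, x ∈ E := mem_ae_iff.2 hE
  have key : ∀ A : Set ℝ, 0 < p A → ∃ u ∈ A, ∃ v ∈ A, ∃ w ∈ A, u < v ∧ v < w ∧ v ∈ E ∧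
      u ∈ p.support ∧ w ∈ p.support := by
    intro A hA
    set B := A ∩ {x | x ∈ p.support ∧ x ∈ E} with hB
    have hBA : p B = p A := measure_inter_conull (mem_ae_iff.1 (hsupp.and hE'))
    have hBi : B.Infinite := fun hf ↦ by
      rw [hf.measure_zero] at hBA
      exact hA.ne hBA
    obtain ⟨t, ht, htc⟩ := hBi.exists_subset_card_eq 3
    have hm : ∀ i, t.orderEmbOfFin htc i ∈ B := fun i ↦ ht (t.orderEmbOfFin_mem htc i)
    exact ⟨_, (hm 0).1, _, (hm 1).1, _, (hm 2).1, (t.orderEmbOfFin htc).strictMono (by decide),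
      (t.orderEmbOfFin htc).strictMono (by decide), (hm 1).2.2, (hm 0).2.1, (hm 2).2.1⟩
  have hpos : ∀ x ∈ p.support, ∀ U : Set ℝ, IsOpen U → x ∈ U → 0 < p U := fun x hx U hU hxU ↦
    (Measure.mem_support_iff_forall x).1 hx U (hU.mem_nhds hxU)
  have step : ∀ a : {a : ℝ // a ∈ E ∧ 0 < p (Ioi a)}, ∃ b : {a : ℝ // a ∈ E ∧ 0 < p (Ioi a)},
      a.1 < b.1 ∧ 0 < p (Ioo a.1 b.1) := by
    rintro ⟨a, ha, hpa⟩
    obtain ⟨u, hu, v, hv, w, hw, huv, hvw, hvE, hus, hws⟩ := key _ hpa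
    exact ⟨⟨v, hvE, hpos w hws _ isOpen_Ioi hvw⟩, hv, hpos u hus _ isOpen_Ioo ⟨hu, huv⟩⟩
  obtain ⟨u, -, v, -, w, -, -, hvw, hvE, -, hws⟩ := key univ (pos_iff_ne_zero.2 hp)
  choose nx hnx hnx' using step
  set c : ℕ → {a : ℝ // a ∈ E ∧ 0 < p (Ioi a)} := fun n ↦
    nx^[n] ⟨v, hvE, hpos w hws _ isOpen_Ioi hvw⟩ with hc
  have hcs : ∀ n, c (n + 1) = nx (c n) := fun n ↦ iterate_succ_apply' _ _ _
  exact ⟨fun n ↦ (c n).1, strictMono_nat_of_lt_succ fun n ↦ by rw [hcs]; exact hnx _,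
    fun n ↦ (c n).2.1, fun n ↦ by simpa only [hcs] using hnx' (c n)⟩

end

section

section

variable {S : Type} [TopologicalSpace S] [MeasurableSpace S] {μ : Measure S}
  {Ts Tu : MeasuredTurbulation μ}

/-- The fibers of the grid all lie in the set `V`. -/
structure Grid.Within (G : Grid Ts Tu) (V : Set S) : Prop where
  row : ∀ y ∈ G.Ey, ∀ t ∈ Icc (G.rows.a y) (G.rows.b y), G.rows.h y t ∈ V
  col : ∀ x ∈ G.Ex, ∀ t ∈ Icc (G.cols.a x) (G.cols.b x), G.cols.h x t ∈ V

/-- A grid on the surface seen through the inverse `j` of a chart `k`. -/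
def Grid.plane (G : Grid Ts Tu) {k : ℂ → S} {j : S → ℂ} (hj : ContinuousOn j (range k))
    (hkj : ∀ z ∈ range k, k (j z) = z) (hG : G.Within (range k)) : PlaneGrid where
  Ex := G.Ex
  Ey := G.Ey
  h y t := j (G.rows.h y t)
  a := G.rows.a
  b := G.rows.b
  α := G.rows.α
  g x t := j (G.cols.h x t)
  c := G.cols.a
  d := G.cols.b
  β := G.cols.α
  h_cont y hy := hj.comp (G.rows.cont y hy).continuousOn (hG.row y hy)
  g_cont x hx := hj.comp (G.cols.cont x hx).continuousOn (hG.col x hx)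
  h_inj y hy s hs t ht he := G.rows.inj y hy ((LeftInvOn.injOn hkj) (hG.row y hy s hs)
    (hG.row y hy t ht) he)
  g_inj x hx s hs t ht he := G.cols.inj x hx ((LeftInvOn.injOn hkj) (hG.col x hx s hs)
    (hG.col x hx t ht) he)
  h_disj y hy y' hy' s hs t ht he := G.rows.disj y hy y' hy' s hs t ht
    ((LeftInvOn.injOn hkj) (hG.row y hy s hs) (hG.row y' hy' t ht) he)
  g_disj x hx x' hx' s hs t ht he := G.cols.disj x hx x' hx' s hs t ht
    ((LeftInvOn.injOn hkj) (hG.col x hx s hs) (hG.col x' hx' t ht) he)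
  α_mem := G.rows.α_mem
  β_mem := G.cols.α_mem
  α_mono := G.rows.α_mono
  β_mono := G.cols.α_mono
  meet x hx y hy := by
    rw [G.rows.h_α y hy x hx, G.cols.h_α x hx y hy]; rfl
  cross y hy x hx s hs t ht he := G.cross y hy x hx s hs t ht
    ((LeftInvOn.injOn hkj) (hG.row y hy s hs) (hG.col x hx t ht) he)

end

section

variable {S : Type} [MetricSpace S] [MeasurableSpace S] [BorelSpace S] {μ : Measure S}
  {Ts Tu : MeasuredTurbulation μ}

lemma Grid.exists_row_image (G : Grid Ts Tu) {F : S ≃ₜ S} {Ω : Set S} (hΩ : IsNice Ts Tu F Ω)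
    {n : ℕ} {e₁ e₂ e₃ e₄ x v x₁ w : ℝ} (E2 : e₂ ∈ G.Ex) (E3 : e₃ ∈ G.Ex)
    (hn : G.rows.Short F e₁ e₂ e₃ e₄ n) (hx : x ∈ G.Ex) (hv : v ∈ G.Ey) (hx₁ : x₁ ∈ G.Ex)
    (hw : w ∈ G.Ey) (hm : (⇑F)^[n] (G.ψ (x, v)) = G.ψ (x₁, w)) (hvΩ : G.ψ (x, v) ∈ Ω)
    (mx₁ : x₁ ∈ Ioo e₂ e₃) : ∀ t ∈ Icc (G.rows.a v) (G.rows.b v),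
      ∃ s ∈ Ioo (G.rows.α w e₁) (G.rows.α w e₄), (⇑F)^[n] (G.rows.h v t) = G.rows.h w s := by
  have hwΩ : G.ψ (x₁, w) ∈ Ω := by rwa [← hm, iterate_mem_iff hΩ.inv]
  intro t ht
  obtain ⟨s, hs, he, -⟩ := (G.rows.exists_image_param hn E2 E3 hx hv hx₁ hw hm
    (hΩ.s _ hvΩ _ (G.rows.mem v hv) ⟨_, G.rows.h_α v hv x hx⟩).1
    (hΩ.s _ hwΩ _ (G.rows.mem w hw) ⟨_, G.rows.h_α w hw x₁ hx₁⟩).2 mx₁.1.le mx₁.2.le).2 t ht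
  exact ⟨s, hs, he.symm⟩

theorem Grid.exists_periodic_of_far [CompactSpace S] [PreconnectedSpace S] [IsProbabilityMeasure μ]
    (G : Grid Ts Tu) {F : S ≃ₜ S} (hs : Contracts Ts F)
    (hu : Contracts Tu F.symm) {Ω : Set S} (hΩm : MeasurableSet Ω) (hΩ0 : μ Ωᶜ = 0)
    (hΩ : IsNice Ts Tu F Ω) {k : ℂ → S} {j : S → ℂ} (hk : IsOpenEmbedding k)
    (hμk : μ (range k) < 1 / 2) (hj : ContinuousOn j (range k))
    (hkj : ∀ z ∈ range k, k (j z) = z) (hG : G.Within (range k))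
    {e d : ℕ → ℝ} (he : StrictMono e) (hd : StrictMono d) (hE : ∀ i, e i ∈ G.Ex)
    (hD : ∀ i, d i ∈ G.Ey) (pe : ∀ i, 0 < G.px (Ioo (e i) (e (i + 1))))
    (pd : ∀ i, 0 < G.py (Ioo (d i) (d (i + 1)))) {f₀ k₀ : ℝ}
    (hF : (G.plane hj hkj hG).Far (e 0) (e 5) (d 0) (d 5) f₀ k₀) :
    ∃ z ∈ range k, ∃ n, 1 ≤ n ∧ (⇑F)^[n] z = z := by
  have he' : ∀ {i l : ℕ}, i < l → e i < e l := fun h ↦ he h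
  have hd' : ∀ {i l : ℕ}, i < l → d i < d l := fun h ↦ hd h
  obtain ⟨n, ⟨hn1, hns, hnu⟩, y, my, xa, mxa, xb, mxb, ⟨ra⟩, ⟨rb⟩⟩ :=
    G.exists_returns hs hu hΩm hΩ0 hΩ.inv measurableSet_Ioo measurableSet_Ioo (pe 0) (pe 2) (pe 4)
      (pd 0) (pd 2) (pd 4) ((eventually_ge_atTop 1).and
      ((G.rows.eventually_short hs (hE 1) (hE 2) (hE 3) (hE 4) (pe 1) (pe 3)).and
        (G.cols.eventually_short hu (hD 1) (hD 2) (hD 3) (hD 4) (pd 1) (pd 3))))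
  obtain ⟨A⟩ := ra.pulled hΩ (hD 0) (hD 2) (hD 3) (hD 1) (hD 4) (hD 5) (hd' (by norm_num)).le
    (hd' (by norm_num)).le my hnu
  obtain ⟨B⟩ := rb.pulled hΩ (hD 0) (hD 2) (hD 3) (hD 1) (hD 4) (hD 5) (hd' (by norm_num)).le
    (hd' (by norm_num)).le my hnu
  obtain ⟨lo, hlo, mlo, wlo, hwlo, mwlo, hAlo, hBlo, rlo⟩ : ∃ lo ∈ G.Ey, lo ∈ Ioo (d 1) y ∧
      ∃ wlo ∈ G.Ey, wlo ∈ Ioo (d 0) (d 1) ∪ Ioo (d 4) (d 5) ∧ A.lo ≤ lo ∧ B.lo ≤ lo ∧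
        ∀ t ∈ Icc (G.rows.a lo) (G.rows.b lo), ∃ s ∈ Ioo (G.rows.α wlo (e 1)) (G.rows.α wlo (e 4)),
          (⇑F)^[n] (G.rows.h lo t) = G.rows.h wlo s := by
    rcases le_total A.lo B.lo with h | h
    · exact ⟨B.lo, B.hlo, B.lo_mem, B.wlo, B.hwlo, B.wlo_mem, h, le_rfl,
        G.exists_row_image hΩ (hE 2) (hE 3) hns B.hx B.hlo B.hx₁ B.hwlo B.map_lo B.lo_mem_Ω B.x₁_mem⟩
    · exact ⟨A.lo, A.hlo, A.lo_mem, A.wlo, A.hwlo, A.wlo_mem, le_rfl, h,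
        G.exists_row_image hΩ (hE 2) (hE 3) hns A.hx A.hlo A.hx₁ A.hwlo A.map_lo A.lo_mem_Ω A.x₁_mem⟩
  obtain ⟨hi, hhi, mhi, whi, hwhi, mwhi, hAhi, hBhi, rhi⟩ : ∃ hi ∈ G.Ey, hi ∈ Ioo y (d 4) ∧
      ∃ whi ∈ G.Ey, whi ∈ Ioo (d 0) (d 1) ∪ Ioo (d 4) (d 5) ∧ hi ≤ A.hi ∧ hi ≤ B.hi ∧
        ∀ t ∈ Icc (G.rows.a hi) (G.rows.b hi), ∃ s ∈ Ioo (G.rows.α whi (e 1)) (G.rows.α whi (e 4)),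
          (⇑F)^[n] (G.rows.h hi t) = G.rows.h whi s := by
    rcases le_total A.hi B.hi with h | h
    · exact ⟨A.hi, A.hhi, A.hi_mem, A.whi, A.hwhi, A.whi_mem, le_rfl, h,
        G.exists_row_image hΩ (hE 2) (hE 3) hns A.hx A.hhi A.hx₁ A.hwhi A.map_hi A.hi_mem_Ω A.x₁_mem⟩
    · exact ⟨B.hi, B.hhi, B.hi_mem, B.whi, B.hwhi, B.whi_mem, h, le_rfl,
        G.exists_row_image hΩ (hE 2) (hE 3) hns B.hx B.hhi B.hx₁ B.hwhi B.map_hi B.hi_mem_Ω B.x₁_mem⟩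
  have colA : ∀ t ∈ Icc (G.cols.α xa lo) (G.cols.α xa hi), ∃ s ∈ Icc (G.cols.α A.x₁ (d 0))
      (G.cols.α A.x₁ (d 5)), (⇑F)^[n] (G.cols.h xa t) = G.cols.h A.x₁ s := fun t ht ↦
    A.col t ⟨((G.cols.α_mono xa A.hx).le_iff_le A.hlo hlo |>.2 hAlo).trans ht.1,
      ht.2.trans ((G.cols.α_mono xa A.hx).le_iff_le hhi A.hhi |>.2 hAhi)⟩
  have colB : ∀ t ∈ Icc (G.cols.α xb lo) (G.cols.α xb hi), ∃ s ∈ Icc (G.cols.α B.x₁ (d 0))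
      (G.cols.α B.x₁ (d 5)), (⇑F)^[n] (G.cols.h xb t) = G.cols.h B.x₁ s := fun t ht ↦
    B.col t ⟨((G.cols.α_mono xb B.hx).le_iff_le B.hlo hlo |>.2 hBlo).trans ht.1,
      ht.2.trans ((G.cols.α_mono xb B.hx).le_iff_le hhi B.hhi |>.2 hBhi)⟩
  set P := G.plane hj hkj hG with hP
  set Φ : ℂ → ℂ := fun z ↦ j ((⇑F)^[n] (k z)) with hΦd
  have Φj : ∀ {z w}, z ∈ range k → (⇑F)^[n] z = w → Φ (j z) = j w := by
    rintro z w hz rfl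
    simp only [hΦd, hkj z hz]
  have rowk : ∀ {v}, v ∈ G.Ey → ∀ t ∈ Icc (G.rows.a v) (G.rows.b v), G.rows.h v t ∈ range k :=
    fun hv ↦ hG.row _ hv
  have rowk' : ∀ {w s}, w ∈ G.Ey → s ∈ Ioo (G.rows.α w (e 1)) (G.rows.α w (e 4)) →
      G.rows.h w s ∈ range k := fun {w s} hw hs ↦
    hG.row w hw s ⟨(G.rows.α_mem w hw _ (hE 1)).1.trans hs.1.le,
      hs.2.le.trans (G.rows.α_mem w hw _ (hE 4)).2⟩
  have colk : ∀ {x t}, x ∈ G.Ex → t ∈ Icc (G.cols.α x lo) (G.cols.α x hi) → G.cols.h x t ∈ range k :=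
    fun {x t} hx ht ↦ hG.col x hx t ⟨(G.cols.α_mem x hx _ hlo).1.trans ht.1,
      ht.2.trans (G.cols.α_mem x hx _ hhi).2⟩
  have colk' : ∀ {x t}, x ∈ G.Ex → t ∈ Icc (G.cols.α x (d 0)) (G.cols.α x (d 5)) →
      G.cols.h x t ∈ range k :=
    fun {x t} hx ht ↦ hG.col x hx t ⟨(G.cols.α_mem x hx _ (hD 0)).1.trans ht.1,
      ht.2.trans (G.cols.α_mem x hx _ (hD 5)).2⟩
  have hFi : Injective (⇑F)^[n] := F.injective.iterate n
  have hFe : IsOpenEmbedding (⇑F)^[n] := by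
    refine .of_continuous_injective_isOpenMap (F.continuous.iterate n) hFi ?_
    clear * -
    induction n with
    | zero => exact IsOpenMap.id
    | succ n ih => rw [iterate_succ]; exact ih.comp F.isOpenMap
  have hlohi : lo < hi := mlo.2.trans mhi.1
  -- the image of the boundary, hence of the whole rectangle, stays in the chart
  have htr : ∀ z ∈ (P.rect A.hx B.hx hlo hhi).trace, (⇑F)^[n] (k z) ∈ range k := by
    have hrow : ∀ {v w}, v ∈ G.Ey → w ∈ G.Ey → (∀ t ∈ Icc (G.rows.a v) (G.rows.b v),
        ∃ s ∈ Ioo (G.rows.α w (e 1)) (G.rows.α w (e 4)), (⇑F)^[n] (G.rows.h v t) = G.rows.h w s) →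
        ∀ r ∈ Icc (0 : ℝ) 1, (⇑F)^[n] (k (P.h v (PlaneGrid.seg (P.α v xa) (P.α v xb) r))) ∈
          range k := by
      intro v w hv hw h r hr
      have hI := P.mem_Icc_of_seg hv A.hx B.hx hr
      obtain ⟨s, hs, h'⟩ := h _ hI
      change (⇑F)^[n] (k (j (G.rows.h v _))) ∈ range k
      rw [hkj _ (rowk hv _ hI)]
      exact h' ▸ rowk' hw hs
    have hcol : ∀ {x x'}, x ∈ G.Ex → x' ∈ G.Ex → (∀ t ∈ Icc (G.cols.α x lo) (G.cols.α x hi),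
        ∃ s ∈ Icc (G.cols.α x' (d 0)) (G.cols.α x' (d 5)),
          (⇑F)^[n] (G.cols.h x t) = G.cols.h x' s) →
        ∀ r ∈ Icc (0 : ℝ) 1, (⇑F)^[n] (k (P.g x (PlaneGrid.seg (P.β x lo) (P.β x hi) r))) ∈
          range k := by
      intro x x' hx hx' h r hr
      have hI := PlaneGrid.seg_mem_uIcc (s := P.β x lo) (t := P.β x hi) hr
      rw [uIcc_of_le (P.β_mono x hx hlo hhi hlohi).le] at hI
      obtain ⟨s, hs, h'⟩ := h _ hI
      change (⇑F)^[n] (k (j (G.cols.h x _))) ∈ range k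
      rw [hkj _ (colk hx hI)]
      exact h' ▸ colk' hx' hs
    exact (Quad.trace_subset_iff _ (A := {z | (⇑F)^[n] (k z) ∈ range k})).2
      ⟨hrow hlo hwlo rlo, hcol B.hx B.hx₁ colB, hrow hhi hwhi rhi, hcol A.hx A.hx₁ colA⟩
  have hhull := (P.rect A.hx B.hx hlo hhi).mapsTo_hull_of_trace hk hμk hFe (hs.mp.iterate n) htr
  have hΦc : ContinuousOn Φ (P.rect A.hx B.hx hlo hhi).hull :=
    hj.comp ((F.continuous.iterate n).comp hk.continuous).continuousOn hhull
  -- local coordinates near the crossing of the row `y` and the column `xb`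
  set q := G.ψ (B.x₁, B.y₁) with hq
  have hqΩ : q ∈ Ω := by rw [hq, ← B.map_eq, iterate_mem_iff hΩ.inv]; exact B.mem_Ω
  have hqr : G.rows.h B.y₁ (G.rows.α B.y₁ B.x₁) = q := G.rows.h_α _ B.hy₁ _ B.hx₁
  have hqc : G.cols.h B.x₁ (G.cols.α B.x₁ B.y₁) = q := G.cols.h_α _ B.hx₁ _ B.hy₁
  have hqk : q ∈ range k := hqr ▸ hG.row _ B.hy₁ _ (G.rows.α_mem _ B.hy₁ _ B.hx₁)
  have hqxb : (⇑F)^[n] (G.cols.h xb (G.cols.α xb y)) = q := by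
    rw [G.cols.h_α xb B.hx y B.hy]; exact B.map_eq
  obtain ⟨ℓ, hℓ, ℓ', hℓ', hqℓ, hqℓ', htrans⟩ := hΩ.tr q hqΩ
  obtain rfl := Ts.line_unique hℓ (G.rows.mem _ B.hy₁) hqℓ ⟨_, hqr⟩
  obtain rfl := Tu.line_unique hℓ' (G.cols.mem _ B.hx₁) hqℓ' ⟨_, hqc⟩
  obtain ⟨ε, hε, κ, hκ, hκi, hκm, κr, κc⟩ := htrans.exists_square (hΩ.s q hqΩ _ hℓ hqℓ).2
    (hΩ.u q hqΩ _ hℓ' hqℓ').2 hk.isOpen_range hqk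
  have κr' := κr _ _ (G.rows.cont _ B.hy₁) (G.rows.inj _ B.hy₁) rfl hqr
  have κc' := κc ((⇑F)^[n] ∘ G.cols.h xb) (G.cols.α xb y)
    ((F.continuous.iterate n).comp (G.cols.cont _ B.hx)) (hFi.comp (G.cols.inj _ B.hx))
    (by rw [range_comp, B.range_eq]) hqxb
  have myy : y ∈ Ioo lo hi := ⟨mlo.2, mhi.1⟩
  have hyI : Ioo (G.cols.α xb lo) (G.cols.α xb hi) ∈ 𝓝 (G.cols.α xb y) :=
    Ioo_mem_nhds (G.cols.α_mono xb B.hx hlo B.hy mlo.2) (G.cols.α_mono xb B.hx B.hy hhi mhi.1)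
  obtain ⟨z, hz, hzΦ⟩ := P.exists_fixedPt_of_rect (Φ := Φ) (hE 0) (hE 1) (hE 4) (hE 5) (hD 0) (hD 1)
    (hD 4) (hD 5) (he' (by norm_num)) (he' (i := 1) (l := 2) (by norm_num))
    (he' (i := 3) (l := 4) (by norm_num)) (he' (by norm_num)) (hd' (by norm_num))
    (hd' (i := 1) (l := 2) (by norm_num)) (hd' (i := 3) (l := 4) (by norm_num)) (hd' (by norm_num))
    hF A.hx B.hx B.hy hlo hhi A.hx₁ B.hx₁ B.hy₁ hwlo hwhi mxa mxb mlo mhi A.x₁_mem B.x₁_mem B.y₁_mem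
    mwlo mwhi
    (fun t ht ↦ (rlo t ht).imp fun s hs ↦ ⟨hs.1, Φj (rowk hlo t ht) hs.2⟩)
    (fun t ht ↦ (rhi t ht).imp fun s hs ↦ ⟨hs.1, Φj (rowk hhi t ht) hs.2⟩)
    (fun t ht ↦ (colA t ht).imp fun s hs ↦ ⟨hs.1, Φj (colk A.hx ht) hs.2⟩)
    (fun t ht ↦ (colB t ht).imp fun s hs ↦ ⟨hs.1, Φj (colk B.hx ht) hs.2⟩)
    (Φj (colk B.hx ⟨(mem_of_mem_nhds hyI).1.le, (mem_of_mem_nhds hyI).2.le⟩) (hqxb.trans hqr.symm))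
    (fun t ht t' ht' hte ↦ by
      obtain ⟨s, hs, h⟩ := colB t ht
      obtain ⟨s', hs', h'⟩ := colB t' ht'
      have h1 : Φ (j (G.cols.h xb t)) = Φ (j (G.cols.h xb t')) := hte
      rw [Φj (colk B.hx ht) h, Φj (colk B.hx ht') h'] at h1
      have h2 := LeftInvOn.injOn hkj (colk' B.hx₁ hs) (colk' B.hx₁ hs') h1
      exact G.cols.inj xb B.hx (hFi (h.trans (h2.trans h'.symm))))
    hε (κ := j ∘ κ) (hj.comp hκ.continuousOn fun p hp ↦ hκm hp)
    (fun p hp p' hp' hpp ↦ hκi (LeftInvOn.injOn hkj (hκm hp) (hκm hp') hpp))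
    (κr'.mono fun t ht ↦ ht.imp fun r hr ↦ ⟨hr.1, congrArg j hr.2⟩)
    (by
      filter_upwards [κc', hyI] with t ⟨r, hr, hr'⟩ ht
      exact ⟨r, hr, Φj (colk B.hx (Ioo_subset_Icc_self ht)) hr'⟩) hΦc
  refine ⟨k z, mem_range_self z, n, hn1, ?_⟩
  rw [← hkj _ (hhull z hz)]
  exact congrArg k hzΦ

/-- A grid in a small disk gives rise to a periodic point in this disk. -/
theorem Grid.exists_periodic [CompactSpace S] [PreconnectedSpace S] [IsProbabilityMeasure μ]
    (G : Grid Ts Tu) (hcore : μ G.core ≠ 0) {F : S ≃ₜ S} (hs : Contracts Ts F)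
    (hu : Contracts Tu F.symm) {Ω : Set S} (hΩm : MeasurableSet Ω) (hΩ0 : μ Ωᶜ = 0)
    (hΩ : IsNice Ts Tu F Ω) {k : ℂ → S} (hk : IsOpenEmbedding k) (hμk : μ (range k) < 1 / 2)
    (hG : G.Within (range k)) : ∃ z ∈ range k, ∃ n, 1 ≤ n ∧ (⇑F)^[n] z = z := by
  have := G.px_fin
  have := G.py_fin
  have := G.px_na
  have := G.py_na
  obtain ⟨j, hj, hkj, -⟩ := hk.exists_leftInverse
  have hpos : G.px univ * G.py univ ≠ 0 := by
    rw [← Measure.prod_prod, univ_prod_univ]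
    intro h0
    have h1 : μ.restrict G.core univ = 0 := by
      rw [← G.map_ψ, Measure.map_apply G.measurable_ψ .univ, preimage_univ, h0]
    exact hcore (by simpa using h1)
  obtain ⟨e, he, hE, pe⟩ := exists_thresholds G.px_compl (left_ne_zero_of_mul hpos)
  obtain ⟨d, hd, hD, pd⟩ := exists_thresholds G.py_compl (right_ne_zero_of_mul hpos)
  have hsh : StrictMono fun i : ℕ ↦ i + 6 := fun _ _ h ↦ Nat.add_lt_add_right h 6
  have hdis : ∀ {c : ℕ → ℝ}, StrictMono c → Disjoint (Icc (c 0) (c 5)) (Icc (c 6) (c 11)) := by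
    intro c hc
    rw [disjoint_left]
    intro t ht ht'
    exact ((hc (by norm_num : 5 < 6)).trans_le ht'.1).not_ge ht.2
  rcases (G.plane hj hkj hG).far_or_far (hE 0) (hE 5) (hD 0) (hD 5) (hE 6) (hE 11) (hD 6) (hD 11)
    (he (by norm_num)).le (hd (by norm_num)).le (he (by norm_num)).le (hd (by norm_num)).le
    (hdis he) (hdis hd) with h | h
  · exact G.exists_periodic_of_far hs hu hΩm hΩ0 hΩ hk hμk hj hkj hG he hd hE hD pe pd h
  · exact G.exists_periodic_of_far hs hu hΩm hΩ0 hΩ hk hμk hj hkj hG (he.comp hsh) (hd.comp hsh)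
      (fun i ↦ hE _) (fun i ↦ hD _) (fun i ↦ pe (i + 6)) (fun i ↦ pd (i + 6)) h

end

end

section

section

variable {S : Type} [MetricSpace S] [CompactSpace S] [MeasurableSpace S] [BorelSpace S]
  {μ : Measure S} [IsProbabilityMeasure μ] {Ts Tu : MeasuredTurbulation μ} {F : S ≃ₜ S} {lam : ℝ}

lemma isCompatibleMetric_dist (S : Type) [MetricSpace S] :
    IsCompatibleMetric S (dist : S → S → ℝ) := by
  refine ⟨dist_comm, fun _ _ ↦ dist_eq_zero, dist_triangle, fun s ↦ ?_⟩
  simp only [Metric.isOpen_iff, subset_def, Metric.mem_ball']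

lemma measurePreserving_homeomorph_symm {F : S ≃ₜ S} (h : MeasurePreserving F μ μ) :
    MeasurePreserving F.symm μ μ :=
  MeasurePreserving.symm F.toMeasurableEquiv h

lemma iterate_image_mem_lines {T : MeasuredTurbulation μ}
    (h : ∀ ℓ ∈ T.lines, F '' ℓ ∈ T.lines) {ℓ : Set S} (hℓ : ℓ ∈ T.lines) (n : ℕ) :
    (⇑F)^[n] '' ℓ ∈ T.lines := by
  induction n with
  | zero => simpa using hℓ
  | succ n ih =>
    rw [iterate_succ', image_comp]
    exact h _ ih

lemma iterate_apply_iterate_symm (F : S ≃ₜ S) (n : ℕ) (x : S) :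
    (⇑F)^[n] ((⇑F.symm)^[n] x) = x :=
  LeftInverse.iterate F.apply_symm_apply n x

lemma iterate_symm_apply_iterate (F : S ≃ₜ S) (n : ℕ) (x : S) :
    (⇑F.symm)^[n] ((⇑F)^[n] x) = x :=
  LeftInverse.iterate F.symm_apply_apply n x

namespace IsMPA

lemma contracts_stable (hF : IsMPA μ F Ts Tu lam) : Contracts Ts F where
  tame := hF.turbulations.2.1 _ (isCompatibleMetric_dist S)
  dense := hF.turbulations.2.2.2.2.1
  mp := hF.measurePreserving
  good_ae := by
    filter_upwards [Ts.ae_mem_lines] with x ⟨ℓ, hℓ, hx⟩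
    exact ⟨ℓ, iterate_image_mem_lines hF.stable_image hℓ, hx⟩
  scale := ⟨(ENNReal.ofReal lam)⁻¹, ENNReal.inv_lt_one.2 (by simpa using hF.one_lt_lam),
    fun ℓ hℓ _ A x y hA ↦ hF.stable_contract ℓ hℓ A x y hA⟩

lemma contracts_unstable (hF : IsMPA μ F Ts Tu lam) : Contracts Tu F.symm where
  tame := hF.turbulations.2.2.1 _ (isCompatibleMetric_dist S)
  dense := hF.turbulations.2.2.2.2.2
  mp := measurePreserving_homeomorph_symm hF.measurePreserving
  good_ae := by
    have h : ∀ᵐ x ∂μ, ∀ n : ℕ, ∃ ℓ ∈ Tu.lines, (⇑F.symm)^[n] x ∈ ℓ := ae_all_iff.2 fun n ↦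
      ((measurePreserving_homeomorph_symm hF.measurePreserving).iterate
        n).quasiMeasurePreserving.ae Tu.ae_mem_lines
    filter_upwards [h] with x hx
    obtain ⟨ℓ, hℓ, hxℓ⟩ := hx 0
    refine ⟨ℓ, fun n ↦ ?_, hxℓ⟩
    obtain ⟨ℓ', hℓ', hx'⟩ := hx n
    have : ℓ = (⇑F)^[n] '' ℓ' := Tu.line_unique hℓ
      (iterate_image_mem_lines hF.unstable_image hℓ' n) hxℓ
      ⟨_, hx', iterate_apply_iterate_symm F n x⟩
    rw [this, ← image_comp]
    convert hℓ'
    rw [show (⇑F.symm)^[n] ∘ (⇑F)^[n] = id from funext (iterate_symm_apply_iterate F n), image_id]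
  scale := by
    refine ⟨(ENNReal.ofReal lam)⁻¹, ENNReal.inv_lt_one.2 (by simpa using hF.one_lt_lam),
      fun ℓ _ hℓ' A x y hA ↦ ?_⟩
    have h := hF.unstable_expand _ hℓ' _ _ _ (hA.image F.symm)
    have hc : ∀ B : Set S, F '' (F.symm '' B) = B := fun B ↦ by
      rw [← image_comp]; simp
    rw [hc, hc] at h
    rw [h, ← mul_assoc, ENNReal.inv_mul_cancel, one_mul]
    · exact (ENNReal.ofReal_pos.2 (one_pos.trans hF.one_lt_lam)).ne'
    · exact ENNReal.ofReal_ne_top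

lemma exists_isNice (hF : IsMPA μ F Ts Tu lam) (hμ : IsOUMeasure μ) :
    ∃ Ω, MeasurableSet Ω ∧ μ Ωᶜ = 0 ∧ IsNice Ts Tu F Ω := by
  have hfull := hF.turbulations.2.2.2.1
  have hs := hF.contracts_stable
  have hu := hF.contracts_unstable
  obtain ⟨W, hWm, hW1, hW⟩ := hF.turbulations.1
  have hWae : ∀ᵐ x ∂μ, x ∈ W := (prob_compl_eq_zero_iff hWm).2 hW1
  have key : ∀ᵐ x ∂μ, (∀ ℓ ∈ Ts.lines, x ∈ ℓ → ℓ ∈ goodLines Ts F ∧ UniqueArcs ℓ) ∧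
      (∀ ℓ ∈ Tu.lines, x ∈ ℓ → ℓ ∈ goodLines Tu F.symm ∧ UniqueArcs ℓ) ∧ x ∈ W := by
    filter_upwards [hs.good_ae, hu.good_ae,
      hs.ae_uniqueArcs (fun ℓ hℓ ↦ hfull.measure_line hℓ) hμ,
      hu.ae_uniqueArcs (fun ℓ hℓ ↦ hfull.swap.measure_line hℓ) hμ, hWae]
      with x ⟨ℓ, hℓ, hx⟩ ⟨ℓ', hℓ', hx'⟩ h1 h2 hxW
    refine ⟨fun m hm hxm ↦ ⟨?_, h1 m hm hxm⟩, fun m hm hxm ↦ ⟨?_, h2 m hm hxm⟩, hxW⟩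
    · rwa [Ts.line_unique hm (mem_lines_of_good hℓ) hxm hx]
    · rwa [Tu.line_unique hm (mem_lines_of_good hℓ') hxm hx']
  obtain ⟨N, hN, hNm, hN0⟩ := exists_measurable_superset_of_null (ae_iff.1 key)
  have hgood : ∀ x ∉ N, (∀ ℓ ∈ Ts.lines, x ∈ ℓ → ℓ ∈ goodLines Ts F ∧ UniqueArcs ℓ) ∧
      (∀ ℓ ∈ Tu.lines, x ∈ ℓ → ℓ ∈ goodLines Tu F.symm ∧ UniqueArcs ℓ) ∧ x ∈ W :=
    fun x hx ↦ by_contra fun h ↦ hx (hN h)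
  set Ω : Set S := {x | (∀ n, (⇑F)^[n] x ∉ N) ∧ ∀ n, (⇑F.symm)^[n] x ∉ N} with hΩdef
  have hmem : ∀ x ∈ Ω, x ∉ N := fun x hx ↦ hx.1 0
  have fwd : ∀ x ∈ Ω, F x ∈ Ω := by
    rintro x ⟨h1, h2⟩
    refine ⟨fun n ↦ by simpa using h1 (n + 1), fun n ↦ ?_⟩
    cases n with
    | zero => exact h1 1
    | succ n => simpa using h2 n
  have bwd : ∀ x ∈ Ω, F.symm x ∈ Ω := by
    rintro x ⟨h1, h2⟩
    refine ⟨fun n ↦ ?_, fun n ↦ by simpa using h2 (n + 1)⟩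
    cases n with
    | zero => exact h2 1
    | succ n => simpa using h1 n
  refine ⟨Ω, ?_, ?_, ⟨fun x ↦ ⟨fun h ↦ by simpa using bwd _ h, fwd x⟩,
    fun x hx ↦ (hgood x (hmem x hx)).1, fun x hx ↦ (hgood x (hmem x hx)).2.1,
    fun x hx ↦ hW x (hgood x (hmem x hx)).2.2⟩⟩
  · refine .inter ?_ ?_
    · exact .congr (.iInter fun n ↦ (hs.mp.iterate n).measurable hNm.compl) (by ext; simp; rfl)
    · exact .congr (.iInter fun n ↦ (hu.mp.iterate n).measurable hNm.compl) (by ext; simp; rfl)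
  · have hNae : ∀ᵐ x ∂μ, x ∉ N := measure_eq_zero_iff_ae_notMem.1 hN0
    have : ∀ᵐ x ∂μ, x ∈ Ω := by
      filter_upwards [ae_all_iff.2 fun n ↦ (hs.mp.iterate n).quasiMeasurePreserving.ae hNae,
        ae_all_iff.2 fun n ↦ (hu.mp.iterate n).quasiMeasurePreserving.ae hNae] with x h1 h2
      exact ⟨h1, h2⟩
    exact this

lemma preconnectedSpace (hF : IsMPA μ F Ts Tu lam) : PreconnectedSpace S := by
  obtain ⟨x, ℓ, hℓ, -⟩ := (Ts.ae_mem_lines (μ := μ)).exists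
  obtain ⟨f, hf, -, hr⟩ := Ts.lines_immersed ℓ hℓ
  have hd := hF.turbulations.2.2.2.2.1 ℓ hℓ
  refine ⟨?_⟩
  rw [← hd.closure_eq, ← hr]
  exact (isPreconnected_range hf).closure

/-- Periodic points of a measurable pseudo-Anosov homeomorphism are dense. -/
lemma exists_periodic_mem (hF : IsMPA μ F Ts Tu lam) (hμ : IsOUMeasure μ) {U : Set S}
    (hU : IsOpen U) (hUn : U.Nonempty) : ∃ x ∈ U, ∃ n : ℕ, 1 ≤ n ∧ (⇑F)^[n] x = x := by
  have := hF.preconnectedSpace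
  obtain ⟨Ω, hΩm, hΩ0, hΩ⟩ := hF.exists_isNice hμ
  obtain ⟨x, hxU, hxb⟩ : ∃ x ∈ U, x ∉ ManifoldBdry S := by
    by_contra! h
    exact (hμ.openPos U hU hUn).ne' (measure_mono_null h hμ.boundaryNull)
  obtain ⟨k₀, hk₀, w, rfl⟩ := exists_chart_of_notMem_bdry hxb
  obtain ⟨O, hxO, hO, hμO⟩ := Set.exists_isOpen_lt_of_lt {k₀ w} (μ := μ) (1 / 2) (by
    rw [hμ.noAtoms]; simp)
  have hopen : IsOpen (k₀ ⁻¹' (U ∩ O)) := (hU.inter hO).preimage hk₀.continuous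
  obtain ⟨r, hr, hball⟩ := Metric.isOpen_iff.1 hopen w ⟨hxU, hxO rfl⟩
  set k : ℂ → S := k₀ ∘ OpenPartialHomeomorph.univBall w r with hkdef
  have hk : IsOpenEmbedding k := hk₀.comp
    ((OpenPartialHomeomorph.univBall (E := ℂ) w r).isOpenEmbedding
      (OpenPartialHomeomorph.univBall_source w r))
  have hrange : range k ⊆ U ∩ O := by
    rintro _ ⟨z, rfl⟩
    apply hball
    rw [← OpenPartialHomeomorph.univBall_target (E := ℂ) w hr]
    exact (OpenPartialHomeomorph.univBall (E := ℂ) w r).map_source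
      (by rw [OpenPartialHomeomorph.univBall_source]; trivial)
  obtain ⟨R, hR, hpos, hsub⟩ := hF.turbulations.2.2.2.1.2 (range k) hk.isOpen_range
    (range_nonempty k)
  obtain ⟨G, hG, hrow, hcol⟩ := R.exists_grid hR hpos
  have hW : G.Within (range k) := by
    refine ⟨fun y hy t ht ↦ hsub (Or.inl ?_), fun x hx t ht ↦ hsub (Or.inr ?_)⟩
    · rw [← R.fibs_cover]
      exact ⟨_, hrow y hy, mem_image_of_mem _ ht⟩
    · rw [← R.fibu_cover]
      exact ⟨_, hcol x hx, mem_image_of_mem _ ht⟩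
  obtain ⟨z, hz, n, hn, hzn⟩ := G.exists_periodic (by rw [hG]; exact hpos.ne')
    hF.contracts_stable hF.contracts_unstable hΩm hΩ0 hΩ hk
    ((measure_mono (hrange.trans inter_subset_right)).trans_lt hμO) hW
  exact ⟨z, (hrange hz).1, n, hn, hzn⟩

lemma transitive (hF : IsMPA μ F Ts Tu lam) (hμ : IsOUMeasure μ) {U V : Set S}
    (hU : IsOpen U) (hUn : U.Nonempty) (hV : IsOpen V) (hVn : V.Nonempty) :
    ∃ n : ℕ, 0 < n ∧ ((⇑F)^[n] '' U ∩ V).Nonempty :=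
  hF.contracts_stable.transitive hμ.openPos hV hVn hU hUn

lemma sensitive (hF : IsMPA μ F Ts Tu lam) (hμ : IsOUMeasure μ) :
    ∃ ε : ℝ, 0 < ε ∧ ∀ x : S, ∀ U ∈ 𝓝 x, ∃ y ∈ U, ∃ n : ℕ,
      ε < dist ((⇑F)^[n] x) ((⇑F)^[n] y) := by
  have : Nonempty S := μ.nonempty_of_neZero
  have : NullSingletonClass μ := ⟨hμ.noAtoms⟩
  exact sensitive_of_transitive_of_dense_periodic F.continuous
    (fun U hU hUn hfin ↦ (hμ.openPos U hU hUn).ne' (hfin.measure_zero μ))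
    (fun U V hU hUn hV hVn ↦ hF.transitive hμ hU hUn hV hVn)
    (fun U hU hUn ↦ hF.exists_periodic_mem hμ hU hUn)

end IsMPA

end

end

/-- every measurable pseudo-Anosov homeomorphism has sensitive dependence
on initial conditions, and is chaotic in the sense of Devaney (topologically transitive,
dense periodic points, sensitive dependence). -/
theorem mpa_sensitive_dependence_and_devaney_chaotic
    {S : Type} [TopologicalSpace S] [T2Space S] [CompactSpace S]
    [ChartedSpace (EuclideanHalfSpace 2) S] [MeasurableSpace S] [BorelSpace S]
    (μ : Measure S) [IsProbabilityMeasure μ] (hμ : IsOUMeasure μ)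
    (Ts Tu : MeasuredTurbulation μ) (F : S ≃ₜ S) (lam : ℝ)
    (hF : IsMPA μ F Ts Tu lam) :
    (∀ d : S → S → ℝ, IsCompatibleMetric S d →
      ∃ ε : ℝ, 0 < ε ∧ ∀ x : S, ∀ U ∈ 𝓝 x, ∃ y ∈ U, ∃ n : ℕ,
        ε < d ((⇑F)^[n] x) ((⇑F)^[n] y)) ∧
    (∀ U V : Set S, IsOpen U → U.Nonempty → IsOpen V → V.Nonempty →
      ∃ n : ℕ, 0 < n ∧ ((⇑F)^[n] '' U ∩ V).Nonempty) ∧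
    (∀ U : Set S, IsOpen U → U.Nonempty →
      ∃ x ∈ U, ∃ n : ℕ, 1 ≤ n ∧ (⇑F)^[n] x = x) := by
  have : SecondCountableTopology (EuclideanHalfSpace 2) :=
    inferInstanceAs (SecondCountableTopology {x : EuclideanSpace ℝ (Fin 2) // 0 ≤ x 0})
  have : SecondCountableTopology S :=
    ChartedSpace.secondCountable_of_sigmaCompact (EuclideanHalfSpace 2) S
  refine ⟨fun d ⟨hd1, hd2, hd3, hd4⟩ ↦ ?_, fun U V hU hUn hV hVn ↦ ?_, fun U hU hUn ↦ ?_⟩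
  · let _ : MetricSpace S := MetricSpace.ofDistTopology d (fun x ↦ (hd2 x x).2 rfl) hd1 hd3 hd4
      fun x y ↦ (hd2 x y).1
    exact hF.sensitive hμ
  · let _ : MetricSpace S := TopologicalSpace.metrizableSpaceMetric S
    exact hF.transitive hμ hU hUn hV hVn
  · let _ : MetricSpace S := TopologicalSpace.metrizableSpaceMetric S
    exact hF.exists_periodic_mem hμ hU hUn

end
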